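/- Let n ≥ 1, α ∈ (0, n+1), C ≥ 1 and 0 < δ₀ ≤ 1, and set k = ⌊α⌋. Let F ⊂ B_{ℝ^{n+1}}(0,1) be a finite nonempty set and μ the uniform measure on F, and assume μ(B_{ℝ^{n+1}}(x,δ)) ≤ C·δ^α for all x ∈ ℝ^{n+1} and all δ ∈ [δ₀, 1]. Then for every ε ∈ (0, min{α, n+1−α}/(10⁴ n)) there exist constants D ≥ 1 and c > 0 depending only on n and ε such that: for all δ ∈ [δ₀, 1/100] and all t ≥ D with e^{nt/2}·δ₀ ≤ δ ≤ e^{−nt/2}, there exists 𝓔 ⊂ [0,1] with |𝓔| ≤ D·e^{−cε²t} so that for every r ∈ [0,1] \ 𝓔 there exists F_r ⊂ F with μ(F \ F_r) ≤ D·e^{−cε²t}, and for all x ∈ ℝ^{n+1}: μ({w' ∈ F_r : ‖a_t·u_r·w' − x‖ ≤ δ}) ≤ D·C·e^{−t(nα − k(k+1))/2}·δ^{α−ε}. -/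

import Mathlib

open MeasureTheory Real Metric

noncomputable section

/-- The `i`-th coordinate (0-indexed) of the `j`-th derivative of the curve
`ξ(r) = (r/1!, r²/2!, …, r^{n+1}/(n+1)!) ∈ ℝ^{n+1}`; the `i`-th coordinate of `ξ` is
`r^{i+1}/(i+1)!`, so its `j`-th derivative is `r^{i+1-j}/(i+1-j)!` if `j ≤ i+1` and `0`
otherwise. -/
def xiD (n j : ℕ) (r : ℝ) : EuclideanSpace ℝ (Fin (n + 1)) :=
  (EuclideanSpace.equiv (Fin (n + 1)) ℝ).symm fun i =>
    if j ≤ i.1 + 1 then r ^ (i.1 + 1 - j) / (Nat.factorial (i.1 + 1 - j) : ℝ) else 0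

/-- The action of `u_r`: `u_r·w = (w·ξ^{(1)}(r), …, w·ξ^{(n+1)}(r))`. -/
def uAct (n : ℕ) (r : ℝ) (w : EuclideanSpace ℝ (Fin (n + 1))) :
    EuclideanSpace ℝ (Fin (n + 1)) :=
  (EuclideanSpace.equiv (Fin (n + 1)) ℝ).symm fun i => ∑ l, w l * xiD n (i.1 + 1) r l

/-- The action of `a_t`: `a_t·w = (e^{nt/2} w₁, e^{(n−2)t/2} w₂, …, e^{−nt/2} w_{n+1})`. -/
def aAct (n : ℕ) (t : ℝ) (w : EuclideanSpace ℝ (Fin (n + 1))) :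
    EuclideanSpace ℝ (Fin (n + 1)) :=
  (EuclideanSpace.equiv (Fin (n + 1)) ℝ).symm fun i =>
    Real.exp ((((n : ℝ) - 2 * (i.1 : ℝ)) * t) / 2) * w i

/-- The uniform (normalized counting) measure of a set `A` with respect to a finite set `F`. -/
def mass {V : Type*} (F : Finset V) (A : Set V) : ℝ :=
  (Nat.card ↥(A ∩ (F : Set V)) : ℝ) / F.card

/-- `ϖ(α) = max{nα − ⌊α⌋(⌊α⌋+1), ⌊α⌋(2n − ⌊α⌋ + 1) − nα}`. -/
def varpi (n : ℕ) (α : ℝ) : ℝ :=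
  max ((n : ℝ) * α - (⌊α⌋ : ℝ) * ((⌊α⌋ : ℝ) + 1))
    ((⌊α⌋ : ℝ) * (2 * (n : ℝ) - (⌊α⌋ : ℝ) + 1) - (n : ℝ) * α)

section

open Filter Topology

/-- Monotone, coordinatewise `1`-Lipschitz, submodular functions. -/
structure IsRankLike {ι : Type*} [DecidableEq ι] (H : (ι → ℝ) → ℝ) : Prop where
  mono : Monotone H
  lip : ∀ x i s, 0 ≤ s → H (x + Pi.single i s) ≤ H x + s
  submod : ∀ x y, H (x ⊔ y) + H (x ⊓ y) ≤ H x + H y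

theorem submod_rise_anti {ι : Type*} {H : (ι → ℝ) → ℝ}
    (hH : ∀ x y, H (x ⊔ y) + H (x ⊓ y) ≤ H x + H y) {z y d : ι → ℝ} (hzy : z ≤ y) (hd : 0 ≤ d)
    (h : ∀ k, d k ≠ 0 → z k = y k) : H (y + d) - H y ≤ H (z + d) - H z := by
  have h1 : y ⊔ (z + d) = y + d := by
    ext k
    by_cases hk : d k = 0
    · simpa [hk] using hzy k
    · simpa [h k hk] using hd k
  have h2 : y ⊓ (z + d) = z := by
    ext k
    by_cases hk : d k = 0
    · simpa [hk] using hzy k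
    · simpa [h k hk] using hd k
  have := hH y (z + d)
  rw [h1, h2] at this
  linarith

namespace IsRankLike

variable {ι : Type*} [DecidableEq ι] {H : (ι → ℝ) → ℝ}

theorem rise_anti (hH : IsRankLike H) {z y d : ι → ℝ} (hzy : z ≤ y) (hd : 0 ≤ d)
    (h : ∀ k, d k ≠ 0 → z k = y k) : H (y + d) - H y ≤ H (z + d) - H z :=
  submod_rise_anti hH.submod hzy hd h

variable [Fintype ι]

theorem rise_le_sum (hH : IsRankLike H) (x : ι → ℝ) {d : ι → ℝ} (hd : 0 ≤ d) :
    H (x + d) - H x ≤ ∑ i, (H (x + Pi.single i (d i)) - H x) := by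
  have key : ∀ S : Finset ι, H (x + ∑ i ∈ S, Pi.single i (d i)) - H x ≤
      ∑ i ∈ S, (H (x + Pi.single i (d i)) - H x) := by
    intro S
    induction S using Finset.induction_on with
    | empty => simp
    | insert a S ha ih =>
      rw [Finset.sum_insert ha, Finset.sum_insert ha]
      have h0 : (0 : ι → ℝ) ≤ ∑ i ∈ S, Pi.single i (d i) :=
        Finset.sum_nonneg fun i _ => by simpa using hd i
      have := hH.rise_anti (z := x) (y := x + ∑ i ∈ S, Pi.single i (d i))
        (d := Pi.single a (d a)) (by simpa using h0) (by simpa using hd a) (by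
          intro k hk
          have hka : k = a := by
            by_contra hne
            exact hk (Pi.single_eq_of_ne hne _)
          subst hka
          have : (∑ i ∈ S, Pi.single i (d i) : ι → ℝ) k = 0 := by
            rw [Finset.sum_apply]
            refine Finset.sum_eq_zero fun i hi => ?_
            rw [Pi.single_eq_of_ne]
            rintro rfl
            exact ha hi
          simp [this])
      have e : x + (Pi.single a (d a) + ∑ i ∈ S, Pi.single i (d i)) =
        x + ∑ i ∈ S, Pi.single i (d i) + Pi.single a (d a) := by abel
      rw [e]
      linarith
  have := key Finset.univ
  rwa [Finset.univ_sum_single] at this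

theorem rise_le (hH : IsRankLike H) (x : ι → ℝ) {d : ι → ℝ} (hd : 0 ≤ d) :
    H (x + d) ≤ H x + ∑ i, d i := by
  have := hH.rise_le_sum x hd
  have h2 : ∑ i, (H (x + Pi.single i (d i)) - H x) ≤ ∑ i, d i :=
    Finset.sum_le_sum fun i _ => by linarith [hH.lip x i (d i) (hd i)]
  linarith

theorem le_of_le_add (hH : IsRankLike H) {x y : ι → ℝ} {c : ℝ} (hc : 0 ≤ c)
    (h : ∀ i, x i ≤ y i + c) : H x ≤ H y + Fintype.card ι * c := by
  have h1 : H x ≤ H (y + fun _ => c) := hH.mono fun i => h i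
  have h2 := hH.rise_le y (d := fun _ => c) (fun _ => hc)
  simp at h2
  linarith

theorem continuous (hH : IsRankLike H) : Continuous H := by
  have : LipschitzWith (Fintype.card ι) H := by
    refine LipschitzWith.of_le_add_mul _ fun x y => ?_
    have := hH.le_of_le_add (x := x) (y := y) (c := dist x y) dist_nonneg (by
      intro i
      have := dist_le_pi_dist x y i
      rw [Real.dist_eq] at this
      linarith [le_abs_self (x i - y i)])
    simpa using this
  exact this.continuous

/-- Lowering `x` by `d` loses the largest possible amount `∑ d`. -/
def Full (H : (ι → ℝ) → ℝ) (x d : ι → ℝ) : Prop := ∑ i, d i ≤ H x - H (x - d)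

theorem Full.anti (hH : IsRankLike H) {x d d' : ι → ℝ} (h : Full H x d) (h1 : d' ≤ d) :
    Full H x d' := by
  have := hH.rise_le (x - d) (d := d - d') (by simpa using h1)
  have e : x - d + (d - d') = x - d' := by abel
  rw [e] at this
  simp only [Full, Pi.sub_apply, Finset.sum_sub_distrib] at *
  linarith

theorem Full.tail (hH : IsRankLike H) {x d d' : ι → ℝ} (h : Full H x d) (h0 : 0 ≤ d') :
    Full H (x - d') (d - d') := by
  have := hH.rise_le (x - d') (d := d') h0
  have e : x - d' + d' = x := by abel
  have e2 : x - d' - (d - d') = x - d := by abel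
  simp only [Full, Pi.sub_apply, Finset.sum_sub_distrib] at *
  rw [e] at this
  rw [e2]
  linarith

theorem Full.trans {κ : Type*} [Fintype κ] {H : (κ → ℝ) → ℝ} {x d d' : κ → ℝ}
    (h : Full H x d) (h' : Full H (x - d) d') :
    Full H x (d + d') := by
  simp only [Full, Pi.add_apply, Finset.sum_add_distrib, sub_sub] at *
  linarith

theorem Full.transfer (hH : IsRankLike H) {x z d : ι → ℝ} (h : Full H x d) (hd : 0 ≤ d)
    (hz : z ≤ x) (hzd : ∀ k, d k ≠ 0 → z k = x k) : Full H z d := by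
  have := hH.rise_anti (z := z - d) (y := x - d) (d := d) (by intro k; simpa using hz k) hd
    (by intro k hk; simp [hzd k hk])
  simp only [sub_add_cancel] at this
  simp only [Full] at *
  linarith

theorem Full.eq (hH : IsRankLike H) {x d : ι → ℝ} (h : Full H x d) (hd : 0 ≤ d) :
    H (x - d) = H x - ∑ i, d i := by
  have := hH.rise_le (x - d) hd
  rw [sub_add_cancel] at this
  simp only [Full] at h
  linarith

theorem full_of_single (hH : IsRankLike H) (x : ι → ℝ) {d : ι → ℝ} (hd : 0 ≤ d)
    (h : ∀ i, Full H x (Pi.single i (d i))) : Full H x d := by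
  have key : ∀ S : Finset ι, Full H x (∑ i ∈ S, Pi.single i (d i)) := by
    intro S
    induction S using Finset.induction_on with
    | empty => simp [Full]
    | insert a S ha ih =>
      rw [Finset.sum_insert ha, add_comm]
      refine ih.trans ((h a).transfer hH (by simpa using hd a) ?_ ?_)
      · have h0 : (0 : ι → ℝ) ≤ ∑ i ∈ S, Pi.single i (d i) :=
          Finset.sum_nonneg fun i _ => by simpa using hd i
        simpa using h0
      · intro k hk
        have hka : k = a := by
          by_contra hne
          exact hk (Pi.single_eq_of_ne hne _)
        subst hka
        have : (∑ i ∈ S, Pi.single i (d i) : ι → ℝ) k = 0 := by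
          rw [Finset.sum_apply]
          refine Finset.sum_eq_zero fun i hi => ?_
          rw [Pi.single_eq_of_ne]
          rintro rfl
          exact ha hi
        simp only [Pi.sub_apply, this, sub_zero]
  have := key Finset.univ
  rwa [Finset.univ_sum_single] at this

end IsRankLike

theorem exists_tendsto_hyperfilter {f : ℕ → ℝ} {B : ℝ} (h : ∀ᶠ m in atTop, |f m| ≤ B) :
    ∃ L, Tendsto f (hyperfilter ℕ : Filter ℕ) (𝓝 L) := by
  have hle : (hyperfilter ℕ : Filter ℕ) ≤ atTop := by
    rw [← Nat.cofinite_eq_atTop]; exact hyperfilter_le_cofinite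
  have hc : IsCompact (Set.Icc (-B) B) := isCompact_Icc
  obtain ⟨L, -, hL⟩ := hc.ultrafilter_le_nhds' ((hyperfilter ℕ).map f) (by
    rw [Ultrafilter.mem_map]
    filter_upwards [hle h] with m hm
    exact abs_le.1 hm)
  exact ⟨L, hL⟩

namespace IsRankLike

/-- `J` changes by a constant under translation by `p`. -/
def QuasiPeriod {V : Type*} [AddCommGroup V] (J : V → ℝ) (p : V) : Prop :=
  ∃ a, ∀ v, J (v + p) = J v + a

theorem QuasiPeriod.add {V : Type*} [AddCommGroup V] {J : V → ℝ} {p q : V}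
    (hp : QuasiPeriod J p) (hq : QuasiPeriod J q) : QuasiPeriod J (p + q) := by
  obtain ⟨a, ha⟩ := hp
  obtain ⟨b, hb⟩ := hq
  exact ⟨a + b, fun v => by rw [← add_assoc, hb, ha, add_assoc]⟩

theorem QuasiPeriod.neg {V : Type*} [AddCommGroup V] {J : V → ℝ} {p : V}
    (hp : QuasiPeriod J p) : QuasiPeriod J (-p) := by
  obtain ⟨a, ha⟩ := hp
  exact ⟨-a, fun v => by have := ha (v + -p); simp at this; linarith⟩

theorem QuasiPeriod.nsmul {V : Type*} [AddCommGroup V] {J : V → ℝ} {p : V}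
    (hp : QuasiPeriod J p) (m : ℕ) : QuasiPeriod J (m • p) := by
  induction m with
  | zero => exact ⟨0, fun v => by simp⟩
  | succ m ih => rw [succ_nsmul]; exact ih.add hp

/-- A submodular function which is quasi-periodic in the directions `1` and `(0, 1, …, n)` has
increments in the `j`-th direction depending on the `j`-th coordinate only. -/
theorem increment_eq {n : ℕ} {J : (Fin (n + 1) → ℝ) → ℝ}
    (hJ : ∀ x y, J (x ⊔ y) + J (x ⊓ y) ≤ J x + J y)
    (h1 : QuasiPeriod J 1) (hι : QuasiPeriod J fun k => (k : ℝ)) (j : Fin (n + 1)) :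
    ∀ v w : Fin (n + 1) → ℝ, v j = w j → ∀ K : ℝ, 0 ≤ K →
      J (v + Pi.single j K) - J v = J (w + Pi.single j K) - J w := by
  induction j using WellFoundedLT.induction with
  | ind j ih =>
  intro v w hvw K hK
  set D : (Fin (n + 1) → ℝ) → ℝ := fun v => J (v + Pi.single j K) - J v with hD
  have hstep : ∀ i < j, ∀ (v : Fin (n + 1) → ℝ) (t : ℝ), 0 ≤ t → D (v + Pi.single i t) = D v := by
    intro i hi v t ht
    have := ih i hi (v + Pi.single j K) v (by simp [hi.ne]) t ht
    simp only [hD]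
    rw [add_right_comm]
    linarith
  have hupd : ∀ i < j, ∀ (v : Fin (n + 1) → ℝ) (c : ℝ), D (Function.update v i c) = D v := by
    intro i hi v c
    rcases le_total (v i) c with h | h
    · rw [← hstep i hi v (c - v i) (by linarith)]
      congr 1
      ext k
      by_cases hk : k = i
      · subst hk; simp
      · simp [hk]
    · rw [← hstep i hi (Function.update v i c) (v i - c) (by linarith)]
      congr 1
      ext k
      by_cases hk : k = i
      · subst hk; simp
      · simp [hk]
  have hlow : ∀ (v w : Fin (n + 1) → ℝ), D ((Finset.Iio j).piecewise w v) = D v := by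
    intro v w
    have : ∀ S : Finset (Fin (n + 1)), S ⊆ Finset.Iio j → D (S.piecewise w v) = D v := by
      intro S
      induction S using Finset.induction_on with
      | empty => simp
      | insert a S ha ih' =>
        intro hS
        rw [Finset.piecewise_insert, hupd a (by simpa using hS (Finset.mem_insert_self a S))]
        exact ih' ((Finset.subset_insert a S).trans hS)
    exact this _ subset_rfl
  have hanti : ∀ v w : Fin (n + 1) → ℝ, v ≤ w → v j = w j → D w ≤ D v := by
    intro v w h1 h2
    refine submod_rise_anti hJ h1 (by simpa using hK) fun k hk => ?_
    by_cases hkj : k = j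
    · rw [hkj, h2]
    · simp [hkj] at hk
  have hmain : ∀ v w : Fin (n + 1) → ℝ, v ≤ w → v j = w j → D v = D w := by
    intro v w h2 h3
    refine le_antisymm ?_ (hanti v w h2 h3)
    obtain ⟨m, hm⟩ := exists_nat_ge (∑ k, |w k - v k|)
    have hm' : ∀ k, w k - v k ≤ m := fun k => (le_abs_self _).trans
      ((Finset.single_le_sum (f := fun k => |w k - v k|) (fun _ _ => abs_nonneg _)
        (Finset.mem_univ k)).trans hm)
    obtain ⟨a, ha⟩ := (hι.nsmul m).add (h1.nsmul (m * j)).neg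
    set p : Fin (n + 1) → ℝ := m • (fun k : Fin (n + 1) => (k : ℝ)) +
      -((m * (j : ℕ)) • (1 : Fin (n + 1) → ℝ)) with hp
    have hpk : ∀ k, p k = m * ((k : ℝ) - j) := by
      intro k
      simp [hp]
      ring
    have e1 : D (v + p) = D v := by
      simp only [hD]
      rw [add_right_comm, ha, ha]
      ring
    rw [← e1, ← hlow (v + p) w]
    refine hanti _ _ ?_ ?_
    · intro k
      by_cases hk : k < j
      · simp [hk]
      · rw [Finset.piecewise_eq_of_notMem _ _ _ (by simpa using hk), Pi.add_apply, hpk]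
        rcases (not_lt.1 hk).eq_or_lt with h | h
        · subst h; simp [h3]
        · have h4 : (1 : ℝ) ≤ (k : ℝ) - j := by
            have : (j : ℕ) + 1 ≤ (k : ℕ) := h
            have : ((j : ℕ) : ℝ) + 1 ≤ ((k : ℕ) : ℝ) := by exact_mod_cast this
            linarith
          have h5 : (m : ℝ) ≤ m * ((k : ℝ) - j) := le_mul_of_one_le_right (by positivity) h4
          linarith [hm' k]
    · rw [Finset.piecewise_eq_of_notMem _ _ _ (by simp), Pi.add_apply, hpk]
      simp [h3]
  have e1 := hmain v (v ⊔ w) le_sup_left (by simp [hvw])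
  have e2 := hmain w (v ⊔ w) le_sup_right (by simp [hvw])
  exact e1.trans e2.symm

end IsRankLike

namespace IsRankLike

theorem abs_sub_le {ι : Type*} [DecidableEq ι] [Fintype ι] {H : (ι → ℝ) → ℝ}
    (hH : IsRankLike H) (x v : ι → ℝ) : |H (x + v) - H x| ≤ Fintype.card ι * ‖v‖ := by
  rw [abs_sub_le_iff]
  constructor
  · have := hH.le_of_le_add (x := x + v) (y := x) (c := ‖v‖) (norm_nonneg _) fun i => by
      have := norm_le_pi_norm v i
      rw [Real.norm_eq_abs] at this
      simpa using (le_abs_self _).trans this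
    linarith
  · have := hH.le_of_le_add (x := x) (y := x + v) (c := ‖v‖) (norm_nonneg _) fun i => by
      have := norm_le_pi_norm v i
      rw [Real.norm_eq_abs] at this
      simp only [Pi.add_apply]
      linarith [neg_abs_le (v i)]
    linarith

theorem rescale {ι : Type*} [DecidableEq ι] {H : (ι → ℝ) → ℝ} (hH : IsRankLike H) (y : ι → ℝ)
    {s : ℝ} (hs : 0 < s) : IsRankLike fun v => H (y + s • v) / s where
  mono v w h := by
    refine div_le_div_of_nonneg_right (hH.mono fun i => ?_) hs.le
    have := h i
    simp only [Pi.add_apply, Pi.smul_apply, smul_eq_mul]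
    gcongr
  lip x i u hu := by
    have := hH.lip (y + s • x) i (s * u) (by positivity)
    have e : y + s • (x + Pi.single i u) = y + s • x + Pi.single i (s * u) := by
      rw [smul_add, add_assoc, ← Pi.single_smul', smul_eq_mul]
    simp only [e]
    rw [div_add' _ _ _ hs.ne', div_le_div_iff_of_pos_right hs]
    linarith
  submod v w := by
    have := hH.submod (y + s • v) (y + s • w)
    have e1 : (y + s • v) ⊔ (y + s • w) = y + s • (v ⊔ w) := by
      ext i
      simp only [Pi.add_apply, Pi.smul_apply, Pi.sup_apply, smul_eq_mul]
      rw [mul_max_of_nonneg _ _ hs.le, max_add_add_left]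
    have e2 : (y + s • v) ⊓ (y + s • w) = y + s • (v ⊓ w) := by
      ext i
      simp only [Pi.add_apply, Pi.smul_apply, Pi.inf_apply, smul_eq_mul]
      rw [mul_min_of_nonneg _ _ hs.le, min_add_add_left]
    rw [e1, e2] at this
    rw [← add_div, ← add_div, div_le_div_iff_of_pos_right hs]
    exact this

/-- The amount by which a rise of size `K` in direction `j` shrinks when all other coordinates
are raised by `W`. -/
def defect {ι : Type*} [DecidableEq ι] (H : (ι → ℝ) → ℝ) (K W : ℝ) (j : ι) (b : ι → ℝ) : ℝ :=
  (H (b + Pi.single j K) - H b) -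
    (H (b + (fun k => if k = j then 0 else W) + Pi.single j K) -
      H (b + fun k => if k = j then 0 else W))

theorem defect_nonneg {ι : Type*} [DecidableEq ι] {H : (ι → ℝ) → ℝ} (hH : IsRankLike H) {K W : ℝ}
    (hK : 0 ≤ K) (hW : 0 ≤ W) (j : ι) (b : ι → ℝ) : 0 ≤ defect H K W j b := by
  rw [defect, sub_nonneg]
  refine hH.rise_anti ?_ (by simpa using hK) fun k hk => ?_
  · intro k
    by_cases hk : k = j <;> simp [hk, hW]
  · have : k = j := by
      by_contra h
      simp [h] at hk
    simp [this]

variable {n : ℕ}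

/-- The points of the planar grid with directions `-1` and `(k - l)ₖ`. -/
def gridPoint (l : Fin (n + 1)) (i k : ℕ) : Fin (n + 1) → ℝ :=
  fun j => (k : ℝ) * ((j : ℝ) - l) - i

/-- Averages of a function over translates of the planar grid. -/
def gridAverage (G : (Fin (n + 1) → ℝ) → ℝ) (l : Fin (n + 1)) (M m : ℕ)
    (v : Fin (n + 1) → ℝ) : ℝ :=
  (∑ i ∈ Finset.range m, ∑ k ∈ Finset.range (M * m),
    (G (gridPoint l i k + v) - G (gridPoint l i k))) / (m * m)

theorem gridAverage_submod {G : (Fin (n + 1) → ℝ) → ℝ} (hG : IsRankLike G)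
    (l : Fin (n + 1)) (M : ℕ) {m : ℕ} (hm : 0 < m) (x y : Fin (n + 1) → ℝ) :
    gridAverage G l M m (x ⊔ y) + gridAverage G l M m (x ⊓ y) ≤
      gridAverage G l M m x + gridAverage G l M m y := by
  have hm' : (0 : ℝ) < m := by exact_mod_cast hm
  unfold gridAverage
  rw [← add_div, ← add_div, div_le_div_iff_of_pos_right (by positivity)]
  simp only [← Finset.sum_add_distrib]
  refine Finset.sum_le_sum fun i _ => Finset.sum_le_sum fun k _ => ?_
  have := hG.submod (gridPoint l i k + x) (gridPoint l i k + y)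
  have e1 : (gridPoint l i k + x) ⊔ (gridPoint l i k + y) = gridPoint l i k + x ⊔ y := by
    ext j; simp [max_add_add_left]
  have e2 : (gridPoint l i k + x) ⊓ (gridPoint l i k + y) = gridPoint l i k + x ⊓ y := by
    ext j; simp [min_add_add_left]
  rw [e1, e2] at this
  linarith

theorem abs_gridAverage_le {G : (Fin (n + 1) → ℝ) → ℝ} (hG : IsRankLike G)
    (l : Fin (n + 1)) (M : ℕ) {m : ℕ} (hm : 0 < m) (v : Fin (n + 1) → ℝ) :
    |gridAverage G l M m v| ≤ M * ((n + 1) * ‖v‖) := by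
  have hm' : (0 : ℝ) < m := by exact_mod_cast hm
  unfold gridAverage
  rw [abs_div, abs_of_pos (mul_pos hm' hm'), div_le_iff₀ (by positivity)]
  have : |∑ i ∈ Finset.range m, ∑ k ∈ Finset.range (M * m),
      (G (gridPoint l i k + v) - G (gridPoint l i k))| ≤
      ∑ i ∈ Finset.range m, ∑ k ∈ Finset.range (M * m), (n + 1) * ‖v‖ := by
    refine (Finset.abs_sum_le_sum_abs _ _).trans (Finset.sum_le_sum fun i _ => ?_)
    refine (Finset.abs_sum_le_sum_abs _ _).trans (Finset.sum_le_sum fun k _ => ?_)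
    simpa using hG.abs_sub_le (gridPoint l i k) v
  refine this.trans (le_of_eq ?_)
  simp only [Finset.sum_const, Finset.card_range, nsmul_eq_mul]
  push_cast
  ring

theorem gridAverage_one {G : (Fin (n + 1) → ℝ) → ℝ} (hG : IsRankLike G)
    (l : Fin (n + 1)) (M : ℕ) {m : ℕ} (hm : 0 < m) (v : Fin (n + 1) → ℝ) :
    |(gridAverage G l M m (v + 1) - gridAverage G l M m v) -
      (gridAverage G l M m (0 + 1) - gridAverage G l M m 0)| ≤
      (2 * (n + 1) * ‖v‖ * M) / m := by
  have hm' : (0 : ℝ) < m := by exact_mod_cast hm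
  have key : ∀ v, gridAverage G l M m (v + 1) - gridAverage G l M m v =
      (∑ k ∈ Finset.range (M * m), (G (gridPoint l 0 k + 1 + v) - G (gridPoint l m k + 1 + v)))
        / (m * m) := by
    intro v
    unfold gridAverage
    rw [← sub_div]
    congr 1
    rw [Finset.sum_comm, Finset.sum_comm (s := Finset.range m), ← Finset.sum_sub_distrib]
    refine Finset.sum_congr rfl fun k _ => ?_
    rw [← Finset.sum_range_sub' (fun i => G (gridPoint l i k + 1 + v)), ← Finset.sum_sub_distrib]
    refine Finset.sum_congr rfl fun i _ => ?_
    have : gridPoint l (i + 1) k + 1 + v = gridPoint l i k + v := by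
      ext j; simp [gridPoint]; ring
    rw [this, add_comm v 1, ← add_assoc]
    ring
  rw [key, key, ← sub_div, abs_div, abs_of_pos (mul_pos hm' hm'), ← Finset.sum_sub_distrib,
    div_le_div_iff₀ (by positivity) hm']
  have : |∑ k ∈ Finset.range (M * m), (G (gridPoint l 0 k + 1 + v) - G (gridPoint l m k + 1 + v) -
      (G (gridPoint l 0 k + 1 + 0) - G (gridPoint l m k + 1 + 0)))| ≤
      ∑ k ∈ Finset.range (M * m), 2 * ((n + 1) * ‖v‖) := by
    refine (Finset.abs_sum_le_sum_abs _ _).trans (Finset.sum_le_sum fun k _ => ?_)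
    have h1 := hG.abs_sub_le (gridPoint l 0 k + 1) v
    have h2 := hG.abs_sub_le (gridPoint l m k + 1) v
    rw [abs_le] at *
    simp at h1 h2 ⊢
    constructor <;> linarith
  rw [Finset.sum_const, Finset.card_range, nsmul_eq_mul] at this
  push_cast at this
  nlinarith

theorem gridAverage_dir {G : (Fin (n + 1) → ℝ) → ℝ} (hG : IsRankLike G)
    (l : Fin (n + 1)) (M : ℕ) {m : ℕ} (hm : 0 < m) (v : Fin (n + 1) → ℝ) :
    |(gridAverage G l M m (v + gridPoint l 0 1) - gridAverage G l M m v) -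
      (gridAverage G l M m (0 + gridPoint l 0 1) - gridAverage G l M m 0)| ≤
      (2 * (n + 1) * ‖v‖) / m := by
  have hm' : (0 : ℝ) < m := by exact_mod_cast hm
  have key : ∀ v, gridAverage G l M m (v + gridPoint l 0 1) - gridAverage G l M m v =
      (∑ i ∈ Finset.range m, (G (gridPoint l i (M * m) + v) - G (gridPoint l i 0 + v)))
        / (m * m) := by
    intro v
    unfold gridAverage
    rw [← sub_div]
    congr 1
    rw [← Finset.sum_sub_distrib]
    refine Finset.sum_congr rfl fun i _ => ?_
    rw [← Finset.sum_range_sub (fun k => G (gridPoint l i k + v)), ← Finset.sum_sub_distrib]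
    refine Finset.sum_congr rfl fun k _ => ?_
    have : gridPoint l i k + (v + gridPoint l 0 1) = gridPoint l i (k + 1) + v := by
      ext j; simp [gridPoint]; ring
    rw [this]
    ring
  rw [key, key, ← sub_div, abs_div, abs_of_pos (mul_pos hm' hm'), ← Finset.sum_sub_distrib,
    div_le_div_iff₀ (by positivity) hm']
  have : |∑ i ∈ Finset.range m, (G (gridPoint l i (M * m) + v) - G (gridPoint l i 0 + v) -
      (G (gridPoint l i (M * m) + 0) - G (gridPoint l i 0 + 0)))| ≤
      ∑ i ∈ Finset.range m, 2 * ((n + 1) * ‖v‖) := by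
    refine (Finset.abs_sum_le_sum_abs _ _).trans (Finset.sum_le_sum fun i _ => ?_)
    have h1 := hG.abs_sub_le (gridPoint l i (M * m)) v
    have h2 := hG.abs_sub_le (gridPoint l i 0) v
    rw [abs_le] at *
    simp at h1 h2 ⊢
    constructor <;> linarith
  rw [Finset.sum_const, Finset.card_range, nsmul_eq_mul] at this
  nlinarith

/-- For sequences of rank-like functions, the average defect over long grids is small. -/
theorem exists_sum_defect_le {G : ℕ → (Fin (n + 1) → ℝ) → ℝ} (hG : ∀ m, 0 < m → IsRankLike (G m))
    (l : Fin (n + 1)) (M : ℕ) (v₀ : Fin (n + 1) → ℝ) {K W : Fin (n + 1) → ℝ} (hK : 0 ≤ K)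
    {η : ℝ} (hη : 0 < η) (m₀ : ℕ) :
    ∃ m, m₀ ≤ m ∧ 0 < m ∧ ∑ i ∈ Finset.range m, ∑ k ∈ Finset.range (M * m),
      ∑ j, defect (G m) (K j) (W j) j (gridPoint l i k + v₀) ≤ η * (m * m) := by
  have hle : (hyperfilter ℕ : Filter ℕ) ≤ atTop := by
    rw [← Nat.cofinite_eq_atTop]; exact hyperfilter_le_cofinite
  have hpos : ∀ᶠ m : ℕ in (hyperfilter ℕ : Filter ℕ), 0 < m := hle (eventually_gt_atTop 0)
  have hex : ∀ v, ∃ L, Tendsto (fun m => gridAverage (G m) l M m v)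
      (hyperfilter ℕ : Filter ℕ) (𝓝 L) := fun v =>
    exists_tendsto_hyperfilter (B := M * ((n + 1) * ‖v‖))
      ((eventually_gt_atTop 0).mono fun m hm => abs_gridAverage_le (hG m hm) l M hm v)
  choose J hJ using hex
  have hsub : ∀ x y, J (x ⊔ y) + J (x ⊓ y) ≤ J x + J y := fun x y =>
    le_of_tendsto_of_tendsto ((hJ _).add (hJ _)) ((hJ _).add (hJ _))
      (hpos.mono fun m hm => gridAverage_submod (hG m hm) l M hm x y)
  have hper : ∀ (p : Fin (n + 1) → ℝ), (∀ v, ∃ B : ℝ, ∀ m : ℕ, 0 < m →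
      |(gridAverage (G m) l M m (v + p) - gridAverage (G m) l M m v) -
        (gridAverage (G m) l M m (0 + p) - gridAverage (G m) l M m 0)| ≤ B / m) →
      QuasiPeriod J p := by
    intro p hp
    refine ⟨J (0 + p) - J 0, fun v => ?_⟩
    obtain ⟨B, hB⟩ := hp v
    have h1 := ((hJ (v + p)).sub (hJ v)).sub ((hJ (0 + p)).sub (hJ 0))
    have h2 : Tendsto (fun m : ℕ => B / (m : ℝ)) (hyperfilter ℕ : Filter ℕ) (𝓝 0) :=
      (tendsto_const_div_atTop_nhds_zero_nat B).mono_left hle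
    have h3 := le_of_tendsto_of_tendsto h1.abs h2 (hpos.mono fun m hm => hB m hm)
    have h4 := abs_nonpos_iff.1 h3
    linarith
  have h1 : QuasiPeriod J 1 :=
    hper 1 fun v => ⟨_, fun m hm => gridAverage_one (hG m hm) l M hm v⟩
  have hl : QuasiPeriod J (gridPoint l 0 1) :=
    hper _ fun v => ⟨_, fun m hm => gridAverage_dir (hG m hm) l M hm v⟩
  have hι : QuasiPeriod J fun k => (k : ℝ) := by
    have := hl.add (h1.nsmul l)
    convert this using 1
    ext k
    simp [gridPoint]
  have hinc := fun j => increment_eq hsub h1 hι j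
  have hdef : ∀ j, defect J (K j) (W j) j v₀ = 0 := by
    intro j
    rw [defect, sub_eq_zero]
    exact hinc j _ _ (by simp) _ (hK j)
  have hlim : Tendsto (fun m => ∑ j, defect (gridAverage (G m) l M m) (K j) (W j) j v₀)
      (hyperfilter ℕ : Filter ℕ) (𝓝 0) := by
    have : (0 : ℝ) = ∑ j, defect J (K j) (W j) j v₀ := by simp [hdef]
    rw [this]
    refine tendsto_finsetSum _ fun j _ => ?_
    exact ((hJ _).sub (hJ _)).sub ((hJ _).sub (hJ _))
  obtain ⟨m, h1, h2, h3⟩ := ((hlim.eventually (gt_mem_nhds hη)).and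
    (hpos.and (hle (eventually_ge_atTop m₀)))).exists
  refine ⟨m, h3, h2, ?_⟩
  have hm' : (0 : ℝ) < m := by exact_mod_cast h2
  have e : ∑ j, defect (gridAverage (G m) l M m) (K j) (W j) j v₀ =
      (∑ i ∈ Finset.range m, ∑ k ∈ Finset.range (M * m),
      ∑ j, defect (G m) (K j) (W j) j (gridPoint l i k + v₀)) / (m * m) := by
    have e1 : ∀ j, defect (gridAverage (G m) l M m) (K j) (W j) j v₀ =
        (∑ i ∈ Finset.range m, ∑ k ∈ Finset.range (M * m),
          defect (G m) (K j) (W j) j (gridPoint l i k + v₀)) / (m * m) := by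
      intro j
      unfold defect gridAverage
      rw [← sub_div, ← sub_div, ← sub_div]
      simp only [← Finset.sum_sub_distrib]
      congr 1
      refine Finset.sum_congr rfl fun i _ => Finset.sum_congr rfl fun k _ => ?_
      simp only [add_assoc]
      ring
    simp only [e1]
    rw [← Finset.sum_div]
    congr 1
    rw [Finset.sum_comm]
    refine Finset.sum_congr rfl fun i _ => ?_
    rw [Finset.sum_comm]
  rw [e, div_lt_iff₀ (by positivity)] at h1
  exact h1.le

end IsRankLike

/-- Rank-like functions satisfying the dichotomy for neighbouring coordinates separated by a
dominant gap, and bounded below by `α s` on the diagonal. -/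
structure IsAdmissible (n : ℕ) (α : ℝ) (H : (Fin (n + 1) → ℝ) → ℝ) : Prop
    extends IsRankLike H where
  pair : ∀ (x : Fin (n + 1) → ℝ) (j : Fin n) (Δ θ : ℝ), 0 < Δ → 0 < θ → (∀ i, Δ < x i) →
    (∀ i, x i + θ < n) → Δ < x j.castSucc - x j.succ →
    (∀ i, i ≠ j → x i.castSucc - x i.succ + 2 * Δ < x j.castSucc - x j.succ) →
    H (x + Pi.single j.succ θ) ≤ H x ∨ Δ - θ ≤ H x - H (x - Pi.single j.castSucc Δ)
  diag : ∀ s : ℝ, 0 ≤ s → s ≤ n → α * s ≤ H fun _ => s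

namespace IsAdmissible

open IsRankLike

variable {n : ℕ} {α : ℝ} {H : (Fin (n + 1) → ℝ) → ℝ}

/-- The arithmetic progression with gap `g` and `l`-th term `c`. -/
def progression (l : Fin (n + 1)) (c g : ℝ) : Fin (n + 1) → ℝ := fun k => c + ((l : ℝ) - k) * g

/-- The change of the terms before the `l`-th when the gap shrinks by `σ`. -/
def lowPart (l : Fin (n + 1)) (σ : ℝ) : Fin (n + 1) → ℝ :=
  fun k => if k < l then ((l : ℝ) - k) * σ else 0

/-- Lowering the `i`-th coordinate never loses the largest possible amount. -/
def Deficient (H : (Fin (n + 1) → ℝ) → ℝ) (i : Fin (n + 1)) (x : Fin (n + 1) → ℝ) : Prop :=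
  ∀ U, 0 < U → H x - H (x - Pi.single i U) < U

theorem lowPart_nonneg (l : Fin (n + 1)) {σ : ℝ} (hσ : 0 ≤ σ) : 0 ≤ lowPart l σ := by
  intro k
  unfold lowPart
  split_ifs with h
  · have : ((k : ℕ) : ℝ) ≤ ((l : ℕ) : ℝ) := by exact_mod_cast h.le
    exact mul_nonneg (by linarith) hσ
  · rfl

theorem lowPart_add (l : Fin (n + 1)) (σ τ : ℝ) :
    lowPart l (σ + τ) = lowPart l σ + lowPart l τ := by
  ext k
  simp only [lowPart, Pi.add_apply]
  split_ifs <;> ring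

theorem full_lowPart (hH : IsRankLike H) (l : Fin (n + 1)) (c g : ℝ) {τ : ℝ} (hτ : 0 ≤ τ)
    (h : ∀ σ, 0 ≤ σ → σ < τ → ∀ i < l, ¬ Deficient H i (progression l c (g - σ))) :
    Full H (progression l c g) (lowPart l τ) := by
  set S : Set ℝ := {σ | Full H (progression l c g) (lowPart l σ)} with hS
  have hcont : Continuous fun σ => lowPart l σ := by
    refine continuous_pi fun k => ?_
    unfold lowPart
    split_ifs <;> fun_prop
  have hclosed : IsClosed S := by
    have := hH.continuous
    simp only [hS, Full]
    refine isClosed_le ?_ ?_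
    · exact continuous_finsetSum _ fun i _ => (continuous_apply i).comp hcont
    · fun_prop
  have : Set.Icc 0 τ ⊆ S := by
    refine (hclosed.inter isClosed_Icc).Icc_subset_of_forall_exists_gt ?_ ?_
    · have : lowPart l 0 = 0 := by ext; simp [lowPart]
      simp [hS, Full, this]
    · rintro σ ⟨hσ, h0, h1⟩ y hy
      have hy : σ < y := hy
      have hU : ∀ i : Fin (n + 1), ∃ U, 0 < U ∧ (i < l →
          Full H (progression l c (g - σ)) (Pi.single i U)) := by
        intro i
        by_cases hi : i < l
        · have := h σ h0 h1 i hi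
          simp only [Deficient, not_forall, not_lt] at this
          obtain ⟨U, hU, h2⟩ := this
          exact ⟨U, hU, fun _ => by simpa [Full] using h2⟩
        · exact ⟨1, one_pos, fun h => absurd h hi⟩
      choose U hU hfull using hU
      obtain ⟨U₀, hU₀, hle⟩ : ∃ U₀, 0 < U₀ ∧ ∀ i, U₀ ≤ U i := by
        refine ⟨Finset.univ.inf' Finset.univ_nonempty U, ?_, fun i => Finset.inf'_le _ (by simp)⟩
        simpa [Finset.lt_inf'_iff] using hU
      set e := min (U₀ / (n + 1)) (y - σ) with he
      have hepos : 0 < e := lt_min (by positivity) (by linarith)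
      refine ⟨σ + e, ?_, by
        constructor <;> [linarith; linarith [min_le_right (U₀ / (n + 1)) (y - σ)]]⟩
      simp only [hS, Set.mem_ofPred_eq, lowPart_add]
      refine Full.trans hσ ?_
      have hf : Full H (progression l c (g - σ)) (lowPart l e) := by
        refine full_of_single hH _ (lowPart_nonneg l hepos.le) fun i => ?_
        by_cases hi : i < l
        · refine (hfull i hi).anti hH ?_
          simp only [Pi.single_le_single]
          simp only [lowPart, hi, if_true]
          refine le_trans ?_ (hle i)
          have h3 : (l : ℝ) - i ≤ n + 1 := by
            have : ((l : ℕ) : ℝ) ≤ n + 1 := by exact_mod_cast l.2.le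
            have : (0 : ℝ) ≤ ((i : ℕ) : ℝ) := by positivity
            linarith
          calc ((l : ℝ) - i) * e ≤ (n + 1) * (U₀ / (n + 1)) := by
                gcongr
                exact min_le_left _ _
            _ = U₀ := by field_simp
        · simp [lowPart, hi, Full]
      refine hf.transfer hH (lowPart_nonneg l hepos.le) ?_ ?_
      · intro k
        simp only [Pi.sub_apply, progression, lowPart]
        split_ifs with hk
        · linarith
        · have : ((l : ℕ) : ℝ) ≤ ((k : ℕ) : ℝ) := by exact_mod_cast not_lt.1 hk
          nlinarith
      · intro k hk
        simp only [lowPart, ne_eq, ite_eq_right_iff, Classical.not_imp] at hk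
        simp only [Pi.sub_apply, progression, lowPart, hk.1, if_true]
        ring
  exact this ⟨hτ, le_rfl⟩

/-- Box sizes used to propagate flatness from one coordinate to the next. -/
def boxSize (n : ℕ) (i : Fin (n + 1)) : ℕ := 2 * n + 3 * (n - i)

theorem rise_le_defect (hH : IsAdmissible n α H) (l : Fin (n + 1)) {c g s : ℝ} (hg : 0 ≤ g)
    (hs : 0 < s) {q : ℕ} (hq : 2 ≤ q) (hlo : ∀ i, s < progression l c g i)
    (hhi : ∀ i, progression l c g i + (5 * n + 1) * s < n)
    (hdef : ∀ x : Fin (n + 1) → ℝ, (∀ i, i ≤ l → x i = progression l c g i + boxSize n l * s) →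
      (∀ i, l < i → progression l c g i ≤ x i) → H x - H (x - Pi.single l s) < s - s / q)
    (hsmall : ∑ j, defect H (boxSize n j * s) ((boxSize n j + 3) * s) j (progression l c g) ≤ s / 4)
    (j : Fin n) (hj : l ≤ j.castSucc) :
    H (progression l c g + Pi.single j.succ (boxSize n j.succ * s)) - H (progression l c g) ≤
      defect H (boxSize n j.succ * s) ((boxSize n j.succ + 3) * s) j.succ (progression l c g) := by
  set b := progression l c g with hb
  induction j using WellFoundedLT.induction with
  | ind j ih =>
  have hn : (1 : ℝ) ≤ n := by exact_mod_cast j.pos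
  have hbox : (boxSize n j.succ : ℝ) + 3 = boxSize n j.castSucc := by
    have : boxSize n j.succ + 3 = boxSize n j.castSucc := by
      simp only [boxSize, Fin.val_succ, Fin.val_castSucc]
      omega
    exact_mod_cast this
  have hbox5 : ∀ i, (boxSize n i : ℝ) ≤ 5 * n := by
    intro i
    have : boxSize n i ≤ 5 * n := by simp only [boxSize]; omega
    exact_mod_cast this
  have hq' : (2 : ℝ) ≤ q := by exact_mod_cast hq
  have hθ : s / q ≤ s / 2 := by gcongr
  have hθ0 : 0 < s / q := by positivity
  set K : ℝ := ((boxSize n j.succ : ℕ) : ℝ) with hK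
  have hK0 : 0 ≤ K := by positivity
  set X : ℝ → Fin (n + 1) → ℝ := fun z =>
    b + (fun k => if k = j.succ then 0 else (K + 3) * s) + Pi.single j.succ z with hX
  have hXs : ∀ z, X z j.succ = b j.succ + z := by intro z; simp [hX]
  have hXk : ∀ z k, k ≠ j.succ → X z k = b k + (K + 3) * s := by
    intro z k hk
    simp [hX, hk]
  have hjc : j.castSucc ≠ j.succ := j.castSucc_lt_succ.ne
  have hdrop : ∀ z, 0 ≤ z → H (X z) - H (X z - Pi.single j.castSucc s) < s - s / q := by
    intro z hz
    rcases hj.eq_or_lt with h | h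
    · subst h
      refine hdef (X z) ?_ ?_
      · intro i hi
        have : i ≠ j.succ := (hi.trans_lt j.castSucc_lt_succ).ne
        rw [hXk z i this, hbox]
      · intro i hi
        by_cases h2 : i = j.succ
        · rw [h2, hXs]; linarith
        · rw [hXk z i h2]; nlinarith
    · have hj0 : 0 < (j : ℕ) := lt_of_le_of_lt (Nat.zero_le _) h
      set j' : Fin n := ⟨j - 1, by omega⟩ with hj'
      have e1 : j'.succ = j.castSucc := by
        ext; simp [hj']; omega
      have h2 := ih j' (by rw [Fin.lt_def]; simp [hj']; omega) (by
        rw [Fin.le_def]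
        have : (l : ℕ) < j := h
        simp [hj']; omega)
      rw [e1] at h2
      have h3 : defect H (boxSize n j.castSucc * s) ((boxSize n j.castSucc + 3) * s) j.castSucc b ≤
          s / 4 := by
        refine le_trans ?_ hsmall
        exact Finset.single_le_sum (f := fun j => defect H (boxSize n j * s)
          ((boxSize n j + 3) * s) j b) (fun i _ => hH.defect_nonneg (by positivity)
          (by positivity) i b) (Finset.mem_univ j.castSucc)
      rw [← hbox] at h2 h3
      have h4 := hH.rise_anti (z := b + Pi.single j.castSucc ((K + 2) * s))
        (y := X z - Pi.single j.castSucc s) (d := Pi.single j.castSucc s) ?_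
        (by simpa using hs.le) ?_
      · have h5 : b + Pi.single j.castSucc ((K + 2) * s) + Pi.single j.castSucc s =
            b + Pi.single j.castSucc ((K + 3) * s) := by
          rw [add_assoc, ← Pi.single_add]
          congr 2
          ring
        rw [h5, sub_add_cancel] at h4
        have h6 : H b ≤ H (b + Pi.single j.castSucc ((K + 2) * s)) :=
          hH.mono (le_add_of_nonneg_right (by simp; positivity))
        linarith
      · intro k
        by_cases hk : k = j.castSucc
        · subst hk
          simp only [Pi.add_apply, Pi.single_eq_same, Pi.sub_apply, hXk z _ hjc]
          linarith
        · simp only [Pi.add_apply, Pi.single_eq_of_ne hk, Pi.sub_apply]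
          by_cases h7 : k = j.succ
          · rw [h7, hXs]; linarith
          · rw [hXk z _ h7]; nlinarith
      · intro k hk
        have hk : k = j.castSucc := by
          by_contra h
          exact hk (Pi.single_eq_of_ne h _)
        subst hk
        simp only [Pi.add_apply, Pi.single_eq_same, Pi.sub_apply, hXk z _ hjc]
        ring
  have hgap : ∀ i : Fin n, b i.castSucc - b i.succ = g := by
    intro i
    simp [hb, progression]
    ring
  have hstep : ∀ z, 0 ≤ z → z ≤ K * s → H (X (z + s / q)) ≤ H (X z) := by
    intro z hz hzK
    have h1 := hH.pair (X z) j s (s / q) hs hθ0 ?_ ?_ ?_ ?_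
    · have e : X z + Pi.single j.succ (s / q) = X (z + s / q) := by
        simp only [hX, Pi.single_add, add_assoc]
      rw [e] at h1
      rcases h1 with h1 | h1
      · exact h1
      · linarith [hdrop z hz]
    · intro i
      have := hlo i
      by_cases h7 : i = j.succ
      · subst h7; rw [hXs]; linarith
      · rw [hXk z _ h7]; nlinarith
    · intro i
      have h8 := hhi i
      have h9 : (K + 3) * s ≤ 5 * n * s := by
        rw [hbox]; exact mul_le_mul_of_nonneg_right (hbox5 _) hs.le
      by_cases h7 : i = j.succ
      · subst h7; rw [hXs]; nlinarith
      · rw [hXk z _ h7]; nlinarith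
    · rw [hXs, hXk z _ hjc]
      have := hgap j
      nlinarith
    · intro i hi
      have h10 : i.succ ≠ j.succ := fun h => hi (Fin.succ_injective _ h)
      have h11 := hgap i
      have h12 := hgap j
      rw [hXs, hXk z _ hjc, hXk z _ h10]
      by_cases h13 : i.castSucc = j.succ
      · rw [h13] at h11 ⊢
        rw [hXs]
        linarith
      · rw [hXk z _ h13]
        linarith
  have hchain : ∀ m : ℕ, m ≤ boxSize n j.succ * q → H (X (m * (s / q))) ≤ H (X 0) := by
    intro m
    induction m with
    | zero => simp
    | succ m ihm =>
      intro hm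
      have h1 := hstep (m * (s / q)) (by positivity) (by
        have : (m : ℝ) ≤ K * q := by
          have : m ≤ boxSize n j.succ * q := by omega
          rw [hK]; exact_mod_cast this
        calc (m : ℝ) * (s / q) ≤ K * q * (s / q) := by gcongr
          _ = K * s := by field_simp)
      have e : ((m + 1 : ℕ) : ℝ) * (s / q) = m * (s / q) + s / q := by push_cast; ring
      rw [e]
      exact h1.trans (ihm (by omega))
  have hfin := hchain _ le_rfl
  have e : ((boxSize n j.succ * q : ℕ) : ℝ) * (s / q) = K * s := by
    push_cast
    field_simp
    rw [hK]
  rw [e] at hfin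
  unfold defect
  simp only [hX, Pi.single_zero, add_zero] at hfin
  linarith

theorem sum_lowPart (l : Fin (n + 1)) (σ : ℝ) :
    ∑ k, lowPart l σ k = σ * ∑ k, lowPart l 1 k := by
  rw [Finset.mul_sum]
  refine Finset.sum_congr rfl fun k _ => ?_
  simp only [lowPart]
  split_ifs <;> ring

theorem fin_sub_le (l k : Fin (n + 1)) : (l : ℝ) - k ≤ n := by
  have h1 : ((l : ℕ) : ℝ) ≤ n := by exact_mod_cast Nat.le_of_lt_succ l.2
  have : (0 : ℝ) ≤ ((k : ℕ) : ℝ) := by positivity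
  linarith

theorem step_le_rises (hH : IsRankLike H) (l : Fin (n + 1)) {c g s : ℝ} (hs : 0 < s)
    (hfull : Full H (progression l (c + n * s) g) (lowPart l s)) :
    H (progression l (c + n * s) (g - s)) + s * ∑ k, lowPart l 1 k ≤
      H (progression l (c + n * s) g) + ∑ j, if l < j then
        H (progression l c g + Pi.single j (boxSize n j * s)) - H (progression l c g) else 0 := by
  set b := progression l c g with hb
  set P := progression l (c + n * s) g with hP
  set up : Fin (n + 1) → ℝ := fun k => if l < k then ((k : ℝ) - l) * s else 0 with hup
  have hup0 : 0 ≤ up := by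
    intro k
    simp only [hup]
    split_ifs with h
    · have : ((l : ℕ) : ℝ) ≤ ((k : ℕ) : ℝ) := by exact_mod_cast h.le
      exact mul_nonneg (by linarith) hs.le
    · rfl
  have e : progression l (c + n * s) (g - s) = P - lowPart l s + up := by
    ext k
    simp only [progression, hP, lowPart, hup, Pi.add_apply, Pi.sub_apply]
    rcases lt_trichotomy k l with h | h | h
    · simp [h, h.not_gt]; ring
    · subst h; simp
    · simp [h, h.not_gt]; ring
  have hlow : ∀ k, lowPart l s k ≤ n * s := by
    intro k
    simp only [lowPart]
    split_ifs
    · exact mul_le_mul_of_nonneg_right (fin_sub_le l k) hs.le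
    · positivity
  have h1 := hH.rise_le_sum (P - lowPart l s) hup0
  have h2 := hfull.eq hH (lowPart_nonneg l hs.le)
  rw [sum_lowPart] at h2
  rw [e]
  have h3 : ∑ i, (H (P - lowPart l s + Pi.single i (up i)) - H (P - lowPart l s)) ≤
      ∑ j, if l < j then H (b + Pi.single j (boxSize n j * s)) - H b else 0 := by
    refine Finset.sum_le_sum fun j _ => ?_
    split_ifs with hj
    · have h4 := hH.rise_anti (z := b + Pi.single j (n * s)) (y := P - lowPart l s)
        (d := Pi.single j (up j)) ?_ (by simpa using hup0 j) ?_
      · refine h4.trans ?_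
        have h5 : H b ≤ H (b + Pi.single j (n * s)) :=
          hH.mono (le_add_of_nonneg_right (by simp; positivity))
        have h6 : H (b + Pi.single j (n * s) + Pi.single j (up j)) ≤
            H (b + Pi.single j (boxSize n j * s)) := by
          rw [add_assoc, ← Pi.single_add]
          apply hH.mono
          gcongr
          simp only [hup, hj, if_true, ← add_mul]
          have h7 := fin_sub_le j l
          have h8 : (2 : ℝ) * n ≤ boxSize n j := by
            have : 2 * n ≤ boxSize n j := by simp [boxSize]
            exact_mod_cast this
          gcongr
          linarith
        linarith
      · intro k
        by_cases hk : k = j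
        · subst hk
          simp [hb, hP, progression, lowPart, hj.not_gt]
          linarith
        · simp only [Pi.add_apply, Pi.single_eq_of_ne hk, Pi.sub_apply, add_zero]
          have := hlow k
          simp only [hb, hP, progression]
          linarith
      · intro k hk
        have hk : k = j := by
          by_contra h
          exact hk (Pi.single_eq_of_ne h _)
        subst hk
        simp [hb, hP, progression, lowPart, hj.not_gt]
        ring
    · simp [hup, hj]
  linarith

theorem step_le_defect (hH : IsAdmissible n α H) (l : Fin (n + 1)) {c g s : ℝ} (hg : 0 ≤ g)
    (hs : 0 < s) {q : ℕ} (hq : 2 ≤ q) (hlo : ∀ i, s < progression l c g i)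
    (hhi : ∀ i, progression l c g i + (5 * n + 1) * s < n)
    (hdef : ∀ x : Fin (n + 1) → ℝ, (∀ i, i ≤ l → x i = progression l c g i + boxSize n l * s) →
      (∀ i, l < i → progression l c g i ≤ x i) → H x - H (x - Pi.single l s) < s - s / q)
    (hfull : Full H (progression l (c + n * s) g) (lowPart l s)) :
    H (progression l (c + n * s) (g - s)) + s * ∑ k, lowPart l 1 k ≤
      H (progression l (c + n * s) g) + 20 * (n + 1) ^ 2 *
        ∑ j, defect H (boxSize n j * s) ((boxSize n j + 3) * s) j (progression l c g) := by
  refine (step_le_rises hH.toIsRankLike l hs hfull).trans ?_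
  gcongr
  set b := progression l c g with hb
  have hnn : ∀ j, 0 ≤ defect H (boxSize n j * s) ((boxSize n j + 3) * s) j b := fun j =>
    hH.defect_nonneg (by positivity) (by positivity) j b
  set S := ∑ j, defect H (boxSize n j * s) ((boxSize n j + 3) * s) j b with hS
  have hS0 : 0 ≤ S := Finset.sum_nonneg fun j _ => hnn j
  by_cases hsmall : S ≤ s / 4
  · have : (∑ j, if l < j then H (b + Pi.single j (boxSize n j * s)) - H b else 0) ≤ S := by
      refine Finset.sum_le_sum fun j _ => ?_
      split_ifs with hj
      · have hj0 : (0 : ℕ) < j := lt_of_le_of_lt (Nat.zero_le _) hj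
        obtain ⟨j', rfl⟩ := Fin.exists_succ_eq.2 (show j ≠ 0 by rintro rfl; simp at hj0)
        exact rise_le_defect hH l hg hs hq hlo hhi hdef hsmall j' (Fin.le_castSucc_iff.2 hj)
      · exact hnn j
    refine this.trans ?_
    have : (1 : ℝ) ≤ 20 * (n + 1) ^ 2 := by nlinarith [(Nat.cast_nonneg n : (0 : ℝ) ≤ n)]
    exact le_mul_of_one_le_left hS0 this
  · have : (∑ j, if l < j then H (b + Pi.single j (boxSize n j * s)) - H b else 0) ≤
        ∑ j : Fin (n + 1), 5 * (n + 1) * s := by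
      refine Finset.sum_le_sum fun j _ => ?_
      split_ifs with hj
      · have h1 := hH.lip b j (boxSize n j * s) (by positivity)
        have h2 : (boxSize n j : ℝ) ≤ 5 * (n + 1) := by
          have : boxSize n j ≤ 5 * (n + 1) := by simp only [boxSize]; omega
          exact_mod_cast this
        have h3 : (boxSize n j : ℝ) * s ≤ 5 * (n + 1) * s := by gcongr
        linarith
      · positivity
    refine this.trans ?_
    simp only [Finset.sum_const, Finset.card_univ, Fintype.card_fin, nsmul_eq_mul]
    push_cast
    have h4 : s ≤ 4 * S := by linarith
    calc ((n : ℝ) + 1) * (5 * (n + 1) * s) ≤ (n + 1) * (5 * (n + 1) * (4 * S)) := by gcongr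
      _ = _ := by ring

theorem exists_low_defect_column {m N : ℕ} (hm : 0 < m) {ψ : ℕ → ℝ} {e : ℕ → ℕ → ℝ}
    {s κ B : ℝ} (hs : 0 < s) (hκ1 : κ ≤ 1) (hB : 0 < B) (hψ : ∀ i, ψ (i + 1) ≤ ψ i)
    (hsum : ψ 0 - ψ m ≤ (1 - κ) * (m * s)) (he : ∀ i k, 0 ≤ e i k)
    (hη : ∑ i ∈ Finset.range m, ∑ k ∈ Finset.range N, e i k ≤ B * κ / 2 * m) :
    ∃ i < m, ψ i - ψ (i + 1) ≤ (1 - κ / 2) * s ∧ ∑ k ∈ Finset.range N, e i k ≤ B := by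
  by_contra hcon
  push Not at hcon
  have hm' : (0 : ℝ) < m := by exact_mod_cast hm
  have hκs : 0 < (1 - κ / 2) * s := mul_pos (by linarith) hs
  have h1 : ∀ i ∈ Finset.range m, (1 - κ / 2) * s * B <
      (ψ i - ψ (i + 1)) * B + (1 - κ / 2) * s * ∑ k ∈ Finset.range N, e i k := by
    intro i hi
    have h2 := hψ i
    have h3 : 0 ≤ ∑ k ∈ Finset.range N, e i k := Finset.sum_nonneg fun k _ => he i k
    by_cases h : ψ i - ψ (i + 1) ≤ (1 - κ / 2) * s
    · have h4 := hcon i (Finset.mem_range.1 hi) h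
      have h5 : 0 ≤ (ψ i - ψ (i + 1)) * B := mul_nonneg (by linarith) hB.le
      have := mul_lt_mul_of_pos_left h4 hκs
      linarith
    · push Not at h
      have := mul_lt_mul_of_pos_right h hB
      have := mul_nonneg hκs.le h3
      linarith
  have h2 := Finset.sum_lt_sum_of_nonempty (Finset.nonempty_range_iff.2 hm.ne') h1
  have h6 : ∑ i ∈ Finset.range m, (ψ i - ψ (i + 1)) * B = (ψ 0 - ψ m) * B := by
    rw [← Finset.sum_mul, Finset.sum_range_sub']
  rw [Finset.sum_add_distrib, h6, Finset.sum_const, Finset.card_range, nsmul_eq_mul,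
    ← Finset.mul_sum] at h2
  have h3 := mul_le_mul_of_nonneg_right hsum hB.le
  have h4 := mul_le_mul_of_nonneg_left hη hκs.le
  have h5 : 0 < m * s * B := by positivity
  nlinarith [mul_nonneg h5.le (sq_nonneg κ)]

/-- The drop in the pivot coordinate persists after lowering the earlier coordinates along a
full direction and raising the later ones. -/
theorem pivot_drop_le (hH : IsRankLike H) (l : Fin (n + 1)) {c g T C τ s : ℝ} (hs : 0 ≤ s)
    (hC : C ≤ c) (hCτ : c - C ≤ T - τ) (hτ : 0 ≤ τ)
    (hfull : Full H (progression l c g) (lowPart l T)) {x : Fin (n + 1) → ℝ}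
    (hx : ∀ i ≤ l, x i = progression l C (g - τ) i)
    (hx' : ∀ i, l < i → progression l c g i ≤ x i) :
    H x - H (x - Pi.single l s) ≤
      H (Function.update (progression l c g) l C) -
        H (Function.update (progression l c g) l (C - s)) := by
  set o := progression l c g with ho
  set d : Fin (n + 1) → ℝ := fun i => if i < l then (c - C) + ((l : ℝ) - i) * τ else 0 with hd
  have hpos : ∀ i < l, (1 : ℝ) ≤ (l : ℝ) - i := by
    intro i hi
    have : ((i + 1 : ℕ) : ℝ) ≤ ((l : ℕ) : ℝ) := by exact_mod_cast hi
    push_cast at this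
    linarith
  have hd0 : 0 ≤ d := by
    intro i
    simp only [hd]
    split_ifs with h
    · have := hpos i h
      have : 0 ≤ ((l : ℝ) - i) * τ := by positivity
      simp only [Pi.zero_apply]
      linarith
    · rfl
  have hfd : Full H o d := by
    refine hfull.anti hH fun i => ?_
    simp only [hd, lowPart]
    split_ifs with h
    · have := hpos i h
      nlinarith
    · rfl
  have hol : o l = c := by simp [ho, progression]
  have htr : ∀ y ≤ c, H (Function.update o l y - d) = H (Function.update o l y) - ∑ i, d i := by
    intro y hy
    refine (hfd.transfer hH hd0 ?_ ?_).eq hH hd0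
    · intro k
      by_cases hk : k = l
      · subst hk; simp [hol, hy]
      · simp [hk]
    · intro k hk
      have : k ≠ l := by
        rintro rfl
        simp [hd] at hk
      simp [this]
  have h1 := htr C hC
  have h2 := htr (C - s) (by linarith)
  have h3 := hH.rise_anti (z := Function.update o l (C - s) - d) (y := x - Pi.single l s)
    (d := Pi.single l s) ?_ (by simpa using hs) ?_
  · have e : Function.update o l (C - s) - d + Pi.single l s = Function.update o l C - d := by
      ext k
      by_cases hk : k = l
      · subst hk; simp; ring
      · simp [hk]
    rw [e, sub_add_cancel] at h3
    linarith
  · intro k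
    rcases lt_trichotomy k l with hk | hk | hk
    · simp only [Pi.sub_apply, hx k hk.le, Function.update_of_ne hk.ne, ho, hd, hk, if_true,
        Pi.single_eq_of_ne hk.ne, progression]
      linarith
    · subst hk
      simp [hx k le_rfl, progression, hd]
    · simp only [Pi.sub_apply, Function.update_of_ne hk.ne', hd, hk.not_gt, if_false,
        Pi.single_eq_of_ne hk.ne', sub_zero]
      exact hx' k hk
  · intro k hk
    have hk : k = l := by
      by_contra h
      exact hk (Pi.single_eq_of_ne h _)
    subst hk
    simp [hx k le_rfl, progression, hd]

theorem progression_bounds (l : Fin (n + 1)) {c g g' a b : ℝ} (h0 : 0 ≤ g') (hg : g' ≤ g)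
    (ha : ∀ i, a ≤ progression l c g i) (hb : ∀ i, progression l c g i ≤ b) (i : Fin (n + 1)) :
    a ≤ progression l c g' i ∧ progression l c g' i ≤ b := by
  have h1 := ha i
  have h2 := hb i
  have h3 := ha l
  have h4 := hb l
  simp only [progression, sub_self, zero_mul, add_zero] at *
  rcases le_total ((i : ℕ) : ℝ) ((l : ℕ) : ℝ) with h | h
  · constructor <;> nlinarith
  · constructor <;> nlinarith

theorem column_step (hH : IsAdmissible n α H) (hn : 1 ≤ n) (l : Fin (n + 1))
    {c g T u s e τ : ℝ} {q : ℕ} (hs0 : 0 < s) (hq2 : 2 ≤ q) (hKsu : boxSize n l * s + s ≤ u)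
    (h5s : (5 * n + 1) * s ≤ u) (he0 : 0 ≤ e) (heu : e ≤ u) (hτ : 2 * u ≤ τ)
    (hτT : τ + 4 * u ≤ T + 2 * u) (hTg : T ≤ g) (hlo : ∀ i, 3 * u ≤ progression l c g i)
    (hhi : ∀ i, progression l c g i ≤ n - 3 * u)
    (hnd : ∀ τ, 0 ≤ τ → τ < T → ∀ i < l, ¬ Deficient H i (progression l c (g - τ)))
    (hdrop : H (Function.update (progression l c g) l (c - e)) -
      H (Function.update (progression l c g) l (c - e - s)) < s - s / q) :
    H (progression l (c - e - boxSize n l * s + n * s) (g - τ - s)) + s * ∑ k, lowPart l 1 k ≤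
      H (progression l (c - e - boxSize n l * s + n * s) (g - τ)) + 20 * (n + 1) ^ 2 *
        ∑ j, defect H (boxSize n j * s) ((boxSize n j + 3) * s) j
          (progression l (c - e - boxSize n l * s) (g - τ)) := by
  have hn' : (1 : ℝ) ≤ n := by exact_mod_cast hn
  have hboxn : (n : ℝ) ≤ boxSize n l := by
    have : n ≤ boxSize n l := by simp only [boxSize]; omega
    exact_mod_cast this
  have hKs0 : 0 ≤ boxSize n l * s := by positivity
  have hnKs : n * s ≤ boxSize n l * s := by gcongr
  have hsn : s ≤ n * s := le_mul_of_one_le_left hs0.le hn'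
  have hfull := full_lowPart hH.toIsRankLike l c g (by linarith : 0 ≤ T) hnd
  have hbd : ∀ r, 3 * u ≤ progression l c (g - τ) r ∧
      progression l c (g - τ) r ≤ n - 3 * u := fun r =>
    progression_bounds l (by linarith) (by linarith) hlo hhi r
  obtain ⟨Ks, hKs⟩ : ∃ Ks : ℝ, Ks = boxSize n l * s := ⟨_, rfl⟩
  simp only [← hKs] at hKsu hKs0 hnKs ⊢
  refine step_le_defect hH l (by linarith) hs0 hq2 ?_ ?_ ?_ ?_
  · intro r
    have := (hbd r).1
    simp only [progression] at this ⊢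
    linarith
  · intro r
    have := (hbd r).2
    simp only [progression] at this ⊢
    linarith
  · intro x hx hx'
    have h1 := pivot_drop_le hH.toIsRankLike l (C := c - e) (τ := τ) hs0.le
      (by linarith) (by linarith) (by linarith) hfull (x := x) ?_ ?_
    · exact lt_of_le_of_lt h1 hdrop
    · intro r hr
      rw [hx r hr, ← hKs]
      simp only [progression]
      ring
    · intro r hr
      refine le_trans ?_ (hx' r hr)
      have h4 : (1 : ℝ) ≤ (r : ℝ) - l := by
        have : ((l + 1 : ℕ) : ℝ) ≤ ((r : ℕ) : ℝ) := by exact_mod_cast hr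
        push_cast at this
        linarith
      simp only [progression]
      nlinarith
  · set e' := e + Ks - n * s with he'
    have hfull' := full_lowPart hH.toIsRankLike l c (g - τ)
      (τ := T - τ) (by linarith) fun σ h0 h1 r hr => by
        have := hnd (τ + σ) (by linarith) (by linarith) r hr
        rwa [← sub_sub] at this
    set d : Fin (n + 1) → ℝ := fun r => if r < l then e' else 0 with hd
    have hd0 : 0 ≤ d := by
      intro r
      simp only [hd]
      split_ifs
      · simp only [Pi.zero_apply]; linarith
      · rfl
    have h1 : Full H _ (lowPart l s) := (hfull'.tail hH.toIsRankLike hd0).anti hH.toIsRankLike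
      (d' := lowPart l s) (by
        intro r
        simp only [lowPart, hd, Pi.sub_apply]
        split_ifs with hr
        · have h4 : (1 : ℝ) ≤ (l : ℝ) - r := by
            have : ((r + 1 : ℕ) : ℝ) ≤ ((l : ℕ) : ℝ) := by exact_mod_cast hr
            push_cast at this
            linarith
          nlinarith
        · simp)
    refine h1.transfer hH.toIsRankLike (lowPart_nonneg l hs0.le) ?_ ?_
    · intro r
      simp only [Pi.sub_apply, progression, hd]
      split_ifs <;> linarith
    · intro r hr
      simp only [lowPart, ne_eq, ite_eq_right_iff, Classical.not_imp] at hr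
      simp only [Pi.sub_apply, progression, hd, hr.1, if_true]
      linarith

set_option maxHeartbeats 1000000 in
theorem contraction_aux (hH : IsAdmissible n α H) (hn : 1 ≤ n) (l : Fin (n + 1)) {c g u : ℝ} (M : ℕ)
    (hu : 0 < u) (hg : (M + 4) * u ≤ g) (hlo : ∀ i, 3 * u ≤ progression l c g i)
    (hhi : ∀ i, progression l c g i ≤ n - 3 * u) (hdef : Deficient H l (progression l c g))
    (hnd : ∀ τ, 0 ≤ τ → τ < (M + 4) * u → ∀ i < l, ¬ Deficient H i (progression l c (g - τ))) :
    H (progression l c (g - (M + 4) * u)) + (M + 4) * u * ∑ k, lowPart l 1 k ≤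
      H (progression l c g) +
        u * (1 + 4 * ∑ k, lowPart l 1 k + (n + 1) * (4 * n + 2)) := by
  set T := (M + 4) * u with hT
  have hM0 : (0 : ℝ) ≤ M := by positivity
  have hn' : (1 : ℝ) ≤ n := by exact_mod_cast hn
  have hT0 : 0 ≤ T := by positivity
  have hTM : T = M * u + 4 * u := by rw [hT]; ring
  set o := progression l c g with ho
  have hol : o l = c := by simp [ho, progression]
  have hfull := full_lowPart hH.toIsRankLike l c g hT0 hnd
  set Λ := ∑ k, lowPart l 1 k with hΛ
  -- the deficiency of the pivot
  obtain ⟨κ, hκ0, hκ1, hκ⟩ : ∃ κ : ℝ, 0 < κ ∧ κ ≤ 1 ∧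
      H o - H (o - Pi.single l u) ≤ (1 - κ) * u := by
    refine ⟨1 - (H o - H (o - Pi.single l u)) / u, ?_, ?_, ?_⟩
    · rw [sub_pos, div_lt_one hu]
      exact hdef u hu
    · have : H (o - Pi.single l u) ≤ H o := hH.mono (sub_le_self _ (by simpa using hu.le))
      have : 0 ≤ (H o - H (o - Pi.single l u)) / u := div_nonneg (by linarith) hu.le
      linarith
    · rw [sub_sub_cancel, div_mul_cancel₀ _ hu.ne']
  obtain ⟨q, hq⟩ := exists_nat_gt (2 / κ)
  have hq2 : 2 ≤ q := by
    have : (2 : ℝ) < q := lt_of_le_of_lt (by rw [le_div_iff₀ hκ0]; linarith) hq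
    exact_mod_cast this.le
  have hq0 : (0 : ℝ) < q := by positivity
  set A : ℝ := 20 * (n + 1) ^ 2 with hA
  have hA0 : 0 < A := by positivity
  -- choose a grid
  have hG : ∀ m : ℕ, 0 < m → IsRankLike
      fun v => H (progression l c (g - 2 * u) + (u / m) • v) / (u / m) := fun m hm =>
    hH.toIsRankLike.rescale _ (by positivity)
  obtain ⟨m, hm5, hm0, hsum⟩ := exists_sum_defect_le hG l M (fun _ => -(boxSize n l : ℝ))
    (K := fun j => boxSize n j) (W := fun j => boxSize n j + 3) (fun j => by simp)
    (η := κ / (2 * A)) (by positivity) (5 * n + 1)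
  have hm' : (0 : ℝ) < m := by exact_mod_cast hm0
  set s := u / m with hs
  have hs0 : 0 < s := by positivity
  have hms : m * s = u := by rw [hs]; field_simp
  have h5s : (5 * n + 1) * s ≤ u := by
    rw [← hms]
    gcongr
    exact_mod_cast hm5
  have hbox5 : (boxSize n l : ℝ) ≤ 5 * n := by
    have : boxSize n l ≤ 5 * n := by simp only [boxSize]; omega
    exact_mod_cast this
  have hboxn : (n : ℝ) ≤ boxSize n l := by
    have : n ≤ boxSize n l := by simp only [boxSize]; omega
    exact_mod_cast this
  set Ks : ℝ := boxSize n l * s with hKs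
  have hKsu : Ks + s ≤ u := by
    have : Ks ≤ 5 * n * s := by rw [hKs]; gcongr
    linarith
  have hnKs : n * s ≤ Ks := by rw [hKs]; gcongr
  have hKs0 : 0 ≤ Ks := by positivity
  have hsn : s ≤ n * s := le_mul_of_one_le_left hs0.le hn'
  set b : ℕ → ℕ → Fin (n + 1) → ℝ := fun i k =>
    progression l (c - i * s - Ks) (g - (2 * u + k * s)) with hb
  set E : ℕ → ℕ → ℝ := fun i k =>
    ∑ j, defect H (boxSize n j * s) ((boxSize n j + 3) * s) j (b i k) with hE
  have hE0 : ∀ i k, 0 ≤ E i k := fun i k => Finset.sum_nonneg fun j _ =>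
    hH.defect_nonneg (by positivity) (by positivity) j _
  have hEsum : ∑ i ∈ Finset.range m, ∑ k ∈ Finset.range (M * m), E i k ≤
      (u / A) * κ / 2 * m := by
    have e1 : ∀ (i k : ℕ), ∑ j, defect (fun v => H (progression l c (g - 2 * u) + s • v) / s)
        (boxSize n j) (boxSize n j + 3) j (gridPoint l i k + fun _ => -(boxSize n l : ℝ)) =
        E i k / s := by
      intro i k
      rw [hE, Finset.sum_div]
      refine Finset.sum_congr rfl fun j _ => ?_
      have e2 : b i k = progression l c (g - 2 * u) +
          s • (gridPoint l i k + fun _ => -(boxSize n l : ℝ)) := by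
        ext r
        simp only [hb, progression, gridPoint, Pi.add_apply, Pi.smul_apply, smul_eq_mul, hKs]
        ring
      have e3 : (s • fun r => if r = j then (0 : ℝ) else boxSize n j + 3) =
          fun r => if r = j then 0 else (boxSize n j + 3) * s := by
        ext r
        simp [mul_comm]
      rw [e2]
      simp only [defect, smul_add, ← Pi.single_smul', smul_eq_mul, e3, ← add_assoc]
      rw [mul_comm s]
      ring
    simp only [e1] at hsum
    simp only [← Finset.sum_div] at hsum
    rw [div_le_iff₀ hs0] at hsum
    refine hsum.trans (le_of_eq ?_)
    rw [← hms]
    field_simp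
  -- choose a column
  obtain ⟨i, him, hdrop, hcol⟩ := exists_low_defect_column hm0
    (ψ := fun i => H (Function.update o l (c - i * s))) hs0 hκ1 (by positivity)
    (by
      intro i
      refine hH.mono (Function.update_mono ?_)
      push_cast
      linarith)
    (by
      have e1 : Function.update o l (c - (0 : ℕ) * s) = o := by
        rw [Nat.cast_zero, zero_mul, sub_zero, ← hol, Function.update_eq_self]
      have e2 : Function.update o l (c - m * s) = o - Pi.single l u := by
        ext k
        by_cases hk : k = l
        · subst hk; simp [hol, hms]
        · simp [hk]
      rw [e1, e2, hms]
      exact hκ) hE0 hEsum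
  have hi0 : 0 ≤ i * s := by positivity
  have hiu : i * s ≤ u := by
    rw [← hms]
    gcongr
  have hdrop' : H (Function.update o l (c - i * s)) -
      H (Function.update o l (c - i * s - s)) < s - s / q := by
    have e2 : c - i * s - s = c - (i + 1 : ℕ) * s := by push_cast; ring
    rw [e2]
    refine lt_of_le_of_lt hdrop ?_
    have h2 : 1 / (q : ℝ) < κ / 2 := by
      rw [div_lt_iff₀ hq0]
      rw [div_lt_iff₀ hκ0] at hq
      linarith
    have h3 : s / q = s * (1 / q) := by ring
    rw [h3]
    nlinarith
  -- one step along the column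
  set f : ℕ → ℝ := fun k => H (progression l (c - i * s - Ks + n * s) (g - (2 * u + k * s))) with hf
  have hstep : ∀ k < M * m, f (k + 1) + s * Λ ≤ f k + A * E i k := by
    intro k hk
    have hk0 : 0 ≤ k * s := by positivity
    have hkM : k * s ≤ M * u := by
      rw [← hms, ← mul_assoc]
      gcongr
      exact_mod_cast hk.le
    have e : g - (2 * u + (k + 1 : ℕ) * s) = g - (2 * u + k * s) - s := by push_cast; ring
    simp only [hf]
    rw [e]
    have := column_step hH hn l (τ := 2 * u + k * s) hs0 hq2 hKsu h5s hi0 hiu (by linarith)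
      (by linarith) (by linarith) hlo hhi hnd hdrop'
    exact this
  have hchain : ∀ N ≤ M * m, f N + N * s * Λ ≤ f 0 + A * ∑ k ∈ Finset.range N, E i k := by
    intro N
    induction N with
    | zero => simp
    | succ N ih =>
      intro hN
      have h1 := ih (by omega)
      have h2 := hstep N (by omega)
      rw [Finset.sum_range_succ, mul_add]
      push_cast
      linarith
  have hend := hchain (M * m) le_rfl
  have h6 : A * ∑ k ∈ Finset.range (M * m), E i k ≤ u := by
    calc _ ≤ A * (u / A) := by gcongr
      _ = u := by field_simp
  have h7 : ((M * m : ℕ) : ℝ) * s = M * u := by rw [← hms]; push_cast; ring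
  rw [h7] at hend
  have hlk : ∀ k : Fin (n + 1), -(n : ℝ) ≤ (l : ℝ) - k := fun k => by
    have := fin_sub_le k l; linarith
  have h8 : f 0 ≤ H o + (n + 1) * (2 * n * u) := by
    have := hH.le_of_le_add 
      (x := progression l (c - i * s - Ks + n * s) (g - (2 * u + (0 : ℕ) * s)))
      (y := o) (c := 2 * n * u) (by positivity) (by
        intro k
        simp only [ho, progression, Nat.cast_zero, zero_mul, add_zero]
        nlinarith [hlk k])
    simpa [hf] using this
  have h9 : H (progression l c (g - T)) ≤ f (M * m) + (n + 1) * ((2 * n + 2) * u) := by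
    have := hH.le_of_le_add (x := progression l c (g - T))
      (y := progression l (c - i * s - Ks + n * s) (g - (2 * u + (M * m : ℕ) * s)))
      (c := (2 * n + 2) * u) (by positivity) (by
        intro k
        simp only [progression, h7, hTM]
        nlinarith [hlk k])
    simpa [hf] using this
  have h10 : T * Λ = M * u * Λ + 4 * u * Λ := by rw [hTM]; ring
  rw [h10]
  linarith

theorem contraction (hH : IsAdmissible n α H) (hn : 1 ≤ n) (l : Fin (n + 1)) {c g T : ℝ}
    (hT : 0 ≤ T) (hTg : T ≤ g) (hlo : ∀ i, 0 < progression l c g i)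
    (hhi : ∀ i, progression l c g i < n) (hdef : l ≠ Fin.last n → Deficient H l (progression l c g))
    (hnd : ∀ τ, 0 ≤ τ → τ < T → ∀ i < l, ¬ Deficient H i (progression l c (g - τ))) :
    H (progression l c (g - T)) + T * ∑ k, lowPart l 1 k ≤ H (progression l c g) := by
  by_cases hl : l = Fin.last n
  · have hfull := full_lowPart hH.toIsRankLike l c g hT hnd
    have := hfull.eq hH.toIsRankLike (lowPart_nonneg l hT)
    rw [sum_lowPart] at this
    have e : progression l c (g - T) = progression l c g - lowPart l T := by
      ext k
      simp only [progression, lowPart, Pi.sub_apply]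
      split_ifs with h
      · ring
      · have : k = l := by rw [hl] at h ⊢; exact Fin.last_le_iff.1 (not_lt.1 h)
        subst this
        simp
    rw [e]
    linarith
  rcases hT.eq_or_lt with rfl | hT0
  · simp
  set Λ := ∑ k, lowPart l 1 k with hΛ
  have hΛ0 : 0 ≤ Λ := Finset.sum_nonneg fun k _ => lowPart_nonneg l zero_le_one k
  set B := 1 + 4 * Λ + (n + 1) * (4 * n + 2) with hB
  obtain ⟨ν, hν0, hν⟩ : ∃ ν, 0 < ν ∧ ∀ i, ν ≤ progression l c g i ∧
      ν ≤ n - progression l c g i := by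
    refine ⟨Finset.univ.inf' Finset.univ_nonempty fun i =>
      min (progression l c g i) (n - progression l c g i), ?_, fun i => ?_⟩
    · rw [Finset.lt_inf'_iff]
      intro i _
      exact lt_min (hlo i) (by linarith [hhi i])
    · have := Finset.inf'_le (fun i => min (progression l c g i) (n - progression l c g i))
        (Finset.mem_univ i)
      exact ⟨this.trans (min_le_left _ _), this.trans (min_le_right _ _)⟩
  refine le_of_forall_pos_le_add fun ε hε => ?_
  have hlim : Tendsto (fun M : ℕ => T / (M + 4 : ℝ)) atTop (𝓝 0) := by
    refine Tendsto.div_atTop tendsto_const_nhds ?_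
    exact tendsto_atTop_add_const_right _ _ tendsto_natCast_atTop_atTop
  have h1 : ∀ᶠ M : ℕ in atTop, T / (M + 4 : ℝ) < ν / 3 := hlim.eventually_lt_const (by positivity)
  have h2 : ∀ᶠ M : ℕ in atTop, T / (M + 4 : ℝ) < ε / B :=
    hlim.eventually_lt_const (by positivity)
  obtain ⟨M, h1, h2⟩ := (h1.and h2).exists
  have hM4 : (0 : ℝ) < M + 4 := by positivity
  have e : (M + 4) * (T / (M + 4 : ℝ)) = T := by field_simp
  have := contraction_aux hH hn l M (u := T / (M + 4 : ℝ)) (c := c) (g := g) (by positivity)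
    (by rwa [e]) (fun i => by linarith [(hν i).1]) (fun i => by linarith [(hν i).2]) (hdef hl)
    (by rwa [e])
  rw [e] at this
  rw [lt_div_iff₀ (by positivity)] at h2
  linarith

theorem sum_lowPart_one (l : Fin (n + 1)) :
    ∑ k, lowPart l 1 k = (l : ℝ) * (l + 1) / 2 := by
  simp only [lowPart, mul_one, Fin.lt_def]
  rw [Fin.sum_univ_eq_sum_range (fun k : ℕ => if k < (l : ℕ) then ((l : ℕ) : ℝ) - k else 0),
    ← Finset.sum_filter]
  have e : (Finset.range (n + 1)).filter (fun k => k < (l : ℕ)) = Finset.range l := by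
    ext k
    simp only [Finset.mem_filter, Finset.mem_range]
    have := l.2
    omega
  rw [e]
  have h : ∀ m : ℕ, ∑ k ∈ Finset.range m, (m - k : ℝ) = m * (m + 1) / 2 := by
    intro m
    induction m with
    | zero => simp
    | succ m ih =>
      have : ∑ k ∈ Finset.range m, ((m + 1 : ℕ) - k : ℝ) =
          ∑ k ∈ Finset.range m, ((m - k : ℝ) + 1) :=
        Finset.sum_congr rfl fun k _ => by push_cast; ring
      rw [Finset.sum_range_succ, this, Finset.sum_add_distrib, ih]
      simp
      ring
  exact h l

theorem le_progression (hH : IsAdmissible n α H) (hn : 1 ≤ n) {Φ : ℝ}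
    (hΦ : ∀ l : ℕ, l ≤ n → α * l - l * (l + 1) / 2 ≤ Φ) (l : Fin (n + 1)) :
    ∀ c g : ℝ, 0 ≤ g → (∀ i, 0 < progression l c g i) → (∀ i, progression l c g i < n) →
      (l ≠ Fin.last n → Deficient H l (progression l c g)) →
      α * (c + l * g) - g * Φ ≤ H (progression l c g) := by
  induction l using WellFoundedLT.induction with
  | ind l ih =>
  intro c g hg hlo hhi hdef
  set S : Set ℝ :=
    insert g {τ | (0 ≤ τ ∧ τ ≤ g) ∧ ∃ i < l, Deficient H i (progression l c (g - τ))} with hS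
  have hS0 : ∀ τ ∈ S, 0 ≤ τ ∧ τ ≤ g := by
    rintro τ (rfl | h)
    · exact ⟨hg, le_rfl⟩
    · exact h.1
  have hbdd : BddBelow S := ⟨0, fun τ h => (hS0 τ h).1⟩
  have hgS : g ∈ S := Set.mem_insert _ _
  set T := sInf S with hT
  have hT0 : 0 ≤ T := le_csInf ⟨g, hgS⟩ fun τ h => (hS0 τ h).1
  have hTg : T ≤ g := csInf_le hbdd hgS
  have hcon := contraction hH hn l hT0 hTg hlo hhi hdef (by
    intro τ h0 h1 i hi h2
    exact h1.not_ge (csInf_le hbdd (Set.mem_insert_of_mem _ ⟨⟨h0, h1.le.trans hTg⟩, i, hi, h2⟩)))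
  have hclosed : IsClosed {τ : ℝ | α * (c + l * (g - τ)) - (g - τ) * Φ ≤
      H (progression l c (g - τ))} := by
    refine isClosed_le (by fun_prop) (hH.continuous.comp ?_)
    unfold progression
    fun_prop
  have hsub : S ⊆ {τ : ℝ | α * (c + l * (g - τ)) - (g - τ) * Φ ≤
      H (progression l c (g - τ))} := by
    rintro τ hτ
    have hb : ∀ k, 0 < progression l c (g - τ) k ∧ progression l c (g - τ) k < n := by
      intro k
      obtain ⟨h0, h1⟩ := hS0 τ hτ
      have e1 := hlo k
      have e2 := hhi k
      have e3 := hlo l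
      have e4 := hhi l
      simp only [progression, sub_self, zero_mul, add_zero] at *
      rcases le_total ((k : ℕ) : ℝ) ((l : ℕ) : ℝ) with h | h
      · constructor <;> nlinarith
      · constructor <;> nlinarith
    rcases hτ with rfl | ⟨⟨h0, h1⟩, i, hi, h2⟩
    · have h3 := hb l
      have e : progression l c (τ - τ) = fun _ => c := by
        ext k
        simp [progression]
      have e' : progression l c (τ - τ) l = c := by rw [e]
      rw [e'] at h3
      have := hH.diag c h3.1.le h3.2.le
      simp only [Set.mem_ofPred_eq, e]
      simpa using this
    · have e : progression l c (g - τ) = progression i (c + ((l : ℝ) - i) * (g - τ)) (g - τ) := by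
        ext k
        simp only [progression]
        ring
      rw [e] at h2 hb
      have := ih i hi _ _ (by linarith) (fun k => (hb k).1) (fun k => (hb k).2) fun _ => h2
      simp only [Set.mem_ofPred_eq]
      rw [e]
      linarith
  have hTm : α * (c + l * (g - T)) - (g - T) * Φ ≤ H (progression l c (g - T)) :=
    hclosed.closure_subset_iff.2 hsub (csInf_mem_closure ⟨g, hgS⟩ hbdd)
  have hl := hΦ l (Nat.le_of_lt_succ l.2)
  rw [sum_lowPart_one] at hcon
  nlinarith

theorem le_decreasing (hH : IsAdmissible n α H) (hn : 1 ≤ n) {Φ : ℝ}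
    (hΦ : ∀ l : ℕ, l ≤ n → α * l - l * (l + 1) / 2 ≤ Φ) :
    α * n - Φ ≤ H fun k => (n : ℝ) - k := by
  have hn' : (1 : ℝ) ≤ n := by exact_mod_cast hn
  have hclosed : IsClosed {η : ℝ | α * (η + n * (1 - 2 * η)) - (1 - 2 * η) * Φ ≤
      H (progression (Fin.last n) η (1 - 2 * η))} := by
    refine isClosed_le (by fun_prop) (hH.continuous.comp ?_)
    unfold progression
    fun_prop
  have hsub : Set.Ioo (0 : ℝ) (1 / 2) ⊆ {η : ℝ | α * (η + n * (1 - 2 * η)) - (1 - 2 * η) * Φ ≤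
      H (progression (Fin.last n) η (1 - 2 * η))} := by
    rintro η ⟨h0, h1⟩
    have hk : ∀ k : Fin (n + 1), (0 : ℝ) ≤ (n : ℝ) - k ∧ (n : ℝ) - k ≤ n := fun k => by
      have h1 : ((k : ℕ) : ℝ) ≤ n := by exact_mod_cast Nat.le_of_lt_succ k.2
      have : (0 : ℝ) ≤ ((k : ℕ) : ℝ) := by positivity
      constructor <;> linarith
    have := le_progression hH hn hΦ (Fin.last n) η (1 - 2 * η) (by linarith) (fun k => by
      have := (hk k).1
      simp only [progression, Fin.val_last]
      nlinarith) (fun k => by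
      have := (hk k).2
      simp only [progression, Fin.val_last]
      nlinarith) (fun h => absurd rfl h)
    simpa only [Fin.val_last, Set.mem_ofPred_eq] using this
  have h0 : (0 : ℝ) ∈ closure (Set.Ioo (0 : ℝ) (1 / 2)) := by
    rw [closure_Ioo (by norm_num)]
    constructor <;> norm_num
  have := hclosed.closure_subset_iff.2 hsub h0
  have e : progression (Fin.last n) 0 (1 - 2 * 0) = fun k : Fin (n + 1) => (n : ℝ) - k := by
    ext k
    simp [progression]
  simp only [Set.mem_ofPred_eq, e] at this
  simpa using this

end IsAdmissible

/-- Approximate rank-like functions on the lattice box `{0, …, n q}^{n+1}`, with errors `C₀`. -/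
structure IsDiscreteAdmissible (n q : ℕ) (α C₀ : ℝ) (h : (Fin (n + 1) → ℕ) → ℝ) : Prop where
  mono : ∀ a b, a ≤ b → (∀ i, b i ≤ n * q) → h a ≤ h b + C₀
  lip : ∀ a b, a ≤ b → (∀ i, b i ≤ n * q) → h b ≤ h a + ∑ i, ((b i : ℝ) - a i) + C₀
  submod : ∀ a b, (∀ i, a i ≤ n * q) → (∀ i, b i ≤ n * q) →
    h (a ⊔ b) + h (a ⊓ b) ≤ h a + h b + C₀
  pair : ∀ (a x : Fin (n + 1) → ℕ) (j : Fin n) (W v : ℕ), 1 ≤ W → 1 ≤ v →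
    x = a + Pi.single j.castSucc W →
    (∀ i, (x + Pi.single j.succ v : Fin (n + 1) → ℕ) i ≤ n * q) →
    x j.succ + W ≤ x j.castSucc →
    (∀ i, i ≠ j → x i.castSucc + 2 * W + 2 + x j.succ ≤ x j.castSucc + x i.succ) →
    h (x + Pi.single j.succ v) ≤ h x + C₀ ∨ h a + W - v - C₀ ≤ h x
  diag : ∀ s : ℕ, s ≤ n * q → α * s - C₀ ≤ h fun _ => s

/-- Rounding to the grid `{0, …, n q}`. -/
def gridFloor (n q : ℕ) (t : ℝ) : ℕ := ⌊q * max 0 (min t n)⌋₊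

theorem gridFloor_mono (n q : ℕ) : Monotone (gridFloor n q) := fun s t h => by
  unfold gridFloor
  gcongr

theorem gridFloor_le (n q : ℕ) (t : ℝ) : gridFloor n q t ≤ n * q := by
  refine Nat.floor_le_of_le ?_
  have : max 0 (min t n) ≤ (n : ℝ) := max_le (by positivity) (min_le_right _ _)
  push_cast
  rw [mul_comm (n : ℝ)]
  gcongr

theorem gridFloor_le_mul {n q : ℕ} {t : ℝ} (h0 : 0 ≤ t) : (gridFloor n q t : ℝ) ≤ q * t := by
  refine (Nat.floor_le (by positivity)).trans ?_
  gcongr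
  exact max_le h0 (min_le_left _ _)

theorem lt_gridFloor_add_one {n q : ℕ} {t : ℝ} (h1 : t ≤ n) : q * t < gridFloor n q t + 1 := by
  refine lt_of_le_of_lt ?_ (Nat.lt_floor_add_one _)
  gcongr
  rw [min_eq_left h1]
  exact le_max_right _ _

theorem gridFloor_add_le (n q : ℕ) (t : ℝ) {s : ℝ} (hs : 0 ≤ s) :
    (gridFloor n q (t + s) : ℝ) ≤ gridFloor n q t + (q * s + 1) := by
  have h1 := Nat.floor_le (show 0 ≤ q * max 0 (min (t + s) n) by positivity)
  have h2 := Nat.lt_floor_add_one (q * max 0 (min t n))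
  have h3 : max 0 (min (t + s) n) ≤ max 0 (min t n) + s := by
    refine max_le (by positivity) ?_
    rcases le_total t n with h | h
    · rw [min_eq_left h]
      exact (min_le_left _ _).trans (by gcongr; exact le_max_right _ _)
    · rw [min_eq_right h]
      exact (min_le_right _ _).trans (by linarith [le_max_right (0 : ℝ) n])
  have h4 : q * max 0 (min (t + s) n) ≤ q * max 0 (min t n) + q * s := by
    rw [← mul_add]
    gcongr
  simp only [gridFloor]
  linarith

/-- The coordinatewise rounding of a point to the grid. -/
def gridPt (n q : ℕ) (x : Fin (n + 1) → ℝ) : Fin (n + 1) → ℕ := fun i => gridFloor n q (x i)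

theorem gridPt_mono (n q : ℕ) : Monotone (gridPt n q) := fun _ _ h i => gridFloor_mono n q (h i)

theorem gridPt_le (n q : ℕ) (x : Fin (n + 1) → ℝ) (i : Fin (n + 1)) : gridPt n q x i ≤ n * q :=
  gridFloor_le n q _

theorem gridPt_sup (n q : ℕ) (x y : Fin (n + 1) → ℝ) :
    gridPt n q (x ⊔ y) = gridPt n q x ⊔ gridPt n q y := by
  ext i
  exact (gridFloor_mono n q).map_max

theorem gridPt_inf (n q : ℕ) (x y : Fin (n + 1) → ℝ) :
    gridPt n q (x ⊓ y) = gridPt n q x ⊓ gridPt n q y := by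
  ext i
  exact (gridFloor_mono n q).map_min

theorem gridPt_add_single (n q : ℕ) (x : Fin (n + 1) → ℝ) (i : Fin (n + 1)) {s : ℝ}
    (hs : 0 ≤ s) : gridPt n q (x + Pi.single i s) =
      gridPt n q x + Pi.single i (gridFloor n q (x i + s) - gridFloor n q (x i)) := by
  ext k
  by_cases hk : k = i
  · subst hk
    have := gridFloor_mono n q (show x k ≤ x k + s by linarith)
    simp [gridPt]
    omega
  · simp [gridPt, hk]

namespace IsDiscreteAdmissible

/-- A limit of discrete admissible functions is admissible. -/
theorem isAdmissible_of_tendsto {n : ℕ} {C₀ : ℝ} {q : ℕ → ℕ} {α : ℕ → ℝ}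
    {h : ℕ → (Fin (n + 1) → ℕ) → ℝ} (hq : ∀ m, m + 1 ≤ q m)
    (hh : ∀ m, IsDiscreteAdmissible n (q m) (α m) C₀ (h m)) {A : ℝ} {H : (Fin (n + 1) → ℝ) → ℝ}
    (hα : Tendsto α (hyperfilter ℕ : Filter ℕ) (𝓝 A))
    (hH : ∀ x, Tendsto (fun m => h m (gridPt n (q m) x) / q m) (hyperfilter ℕ : Filter ℕ)
      (𝓝 (H x))) : IsAdmissible n A H := by
  have hle : (hyperfilter ℕ : Filter ℕ) ≤ atTop := by
    rw [← Nat.cofinite_eq_atTop]; exact hyperfilter_le_cofinite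
  have hq0 : ∀ m, (0 : ℝ) < q m := fun m => by
    have := hq m
    exact_mod_cast (by omega : 0 < q m)
  have hqtop : Tendsto (fun m => (q m : ℝ)) (hyperfilter ℕ : Filter ℕ) atTop := by
    refine Tendsto.mono_left ?_ hle
    refine tendsto_natCast_atTop_atTop.comp (tendsto_atTop_mono (fun m => ?_) tendsto_id)
    have := hq m
    simp only [id]
    omega
  have hzero : ∀ c : ℝ, Tendsto (fun m => c / q m) (hyperfilter ℕ : Filter ℕ) (𝓝 0) := fun c =>
    tendsto_const_nhds.div_atTop hqtop
  refine ⟨⟨?_, ?_, ?_⟩, ?_, ?_⟩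
  · intro x y hxy
    have h1 := (hH y).add (hzero C₀)
    rw [add_zero] at h1
    refine le_of_tendsto_of_tendsto (hH x) h1 (Eventually.of_forall fun m => ?_)
    have := (hh m).mono _ _ (gridPt_mono n (q m) hxy) (gridPt_le n (q m) y)
    have h0 := hq0 m
    simp only
    rw [← add_div]
    gcongr
  · intro x i s hs
    have h1 := ((hH x).add_const s).add (hzero (C₀ + 1))
    rw [add_zero] at h1
    refine le_of_tendsto_of_tendsto (hH _) h1 (Eventually.of_forall fun m => ?_)
    have h2 := (hh m).lip _ _ (gridPt_mono n (q m) (show x ≤ x + Pi.single i s from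
      le_add_of_nonneg_right (by simpa using hs))) (gridPt_le n (q m) _)
    have h0 := hq0 m
    have h3 : ∑ k, ((gridPt n (q m) (x + Pi.single i s) k : ℝ) - gridPt n (q m) x k) ≤
        q m * s + 1 := by
      rw [Finset.sum_eq_single i]
      · have := gridFloor_add_le n (q m) (x i) hs
        simp only [gridPt, Pi.add_apply, Pi.single_eq_same]
        linarith
      · intro k _ hk
        simp [gridPt, hk]
      · simp
    have e : h m (gridPt n (q m) x) / q m + s + (C₀ + 1) / q m =
        (h m (gridPt n (q m) x) + (q m * s + 1) + C₀) / q m := by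
      field_simp
      ring
    simp only
    rw [e]
    gcongr
    linarith
  · intro x y
    have h1 := ((hH x).add (hH y)).add (hzero C₀)
    rw [add_zero] at h1
    refine le_of_tendsto_of_tendsto ((hH _).add (hH _)) h1 (Eventually.of_forall fun m => ?_)
    have h2 := (hh m).submod _ _ (gridPt_le n (q m) x) (gridPt_le n (q m) y)
    have h0 := hq0 m
    simp only [gridPt_sup, gridPt_inf]
    rw [← add_div, ← add_div, ← add_div]
    gcongr
  · intro x j Δ θ hΔ hθ hlo hhi hgap hgaps
    have hjs : j.castSucc ≠ j.succ := j.castSucc_lt_succ.ne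
    have hev : ∀ᶠ m in (hyperfilter ℕ : Filter ℕ),
        h m (gridPt n (q m) (x + Pi.single j.succ θ)) ≤ h m (gridPt n (q m) x) + C₀ ∨
        h m (gridPt n (q m) (x - Pi.single j.castSucc Δ)) + (q m * Δ - 1) - (q m * θ + 1) - C₀ ≤
          h m (gridPt n (q m) x) := by
      have hlarge : ∀ s : ℝ, 0 < s → ∀ᶠ m in (hyperfilter ℕ : Filter ℕ), 10 ≤ q m * s :=
        fun s hs => by
          filter_upwards [hqtop.eventually_ge_atTop (10 / s)] with m hm
          rwa [div_le_iff₀ hs] at hm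
      have hgaps' : ∀ᶠ m in (hyperfilter ℕ : Filter ℕ), ∀ i, i ≠ j → 10 ≤ q m *
          (x j.castSucc - x j.succ - (x i.castSucc - x i.succ + 2 * Δ)) := by
        rw [eventually_all]
        intro i
        by_cases hi : i = j
        · simp [hi]
        · filter_upwards [hlarge _ (sub_pos.2 (hgaps i hi))] with m hm _ using hm
      filter_upwards [hlarge Δ hΔ, hlarge θ hθ, hlarge _ (sub_pos.2 hgap), hgaps'] with
        m hm1 hm2 hm3 hm4
      set a := gridPt n (q m) (x - Pi.single j.castSucc Δ) with ha
      set W := gridFloor n (q m) (x j.castSucc) - gridFloor n (q m) (x j.castSucc - Δ) with hW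
      set v := gridFloor n (q m) (x j.succ + θ) - gridFloor n (q m) (x j.succ) with hv
      have hfl : ∀ t : ℝ, 0 ≤ t → t ≤ n →
          (gridFloor n (q m) t : ℝ) ≤ q m * t ∧ q m * t < gridFloor n (q m) t + 1 :=
        fun t h0 h1 => ⟨gridFloor_le_mul h0, lt_gridFloor_add_one h1⟩
      have hx0 : ∀ i, 0 ≤ x i ∧ x i ≤ n := fun i =>
        ⟨(hΔ.trans (hlo i)).le, by linarith [hhi i]⟩
      have hxj := hfl _ (hx0 j.castSucc).1 (hx0 j.castSucc).2
      have hxs := hfl _ (hx0 j.succ).1 (hx0 j.succ).2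
      have hxj' := hfl (x j.castSucc - Δ) (by linarith [hlo j.castSucc])
        (by linarith [hx0 j.castSucc])
      have hxs' := hfl (x j.succ + θ) (by linarith [hx0 j.succ]) (hhi _).le
      have hWr : (W : ℝ) =
          gridFloor n (q m) (x j.castSucc) - gridFloor n (q m) (x j.castSucc - Δ) := by
        rw [hW, Nat.cast_sub (gridFloor_mono n (q m) (by linarith))]
      have hvr : (v : ℝ) = gridFloor n (q m) (x j.succ + θ) - gridFloor n (q m) (x j.succ) := by
        rw [hv, Nat.cast_sub (gridFloor_mono n (q m) (by linarith))]
      have e1 : a + Pi.single j.castSucc W = gridPt n (q m) x := by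
        have := gridPt_add_single n (q m) (x - Pi.single j.castSucc Δ) j.castSucc hΔ.le
        rw [sub_add_cancel] at this
        rw [this, ha, hW]
        simp
      have e2 : gridPt n (q m) x + Pi.single j.succ v =
          gridPt n (q m) (x + Pi.single j.succ θ) :=
        (gridPt_add_single n (q m) x j.succ hθ.le).symm
      have h1 := (hh m).pair a _ j W v ?_ ?_ e1.symm ?_ ?_ ?_
      · rw [e2] at h1
        refine h1.imp id fun h2 => ?_
        rw [hWr, hvr] at h2
        linarith
      · have : (1 : ℝ) ≤ W := by rw [hWr]; linarith
        exact_mod_cast this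
      · have : (1 : ℝ) ≤ v := by rw [hvr]; linarith
        exact_mod_cast this
      · rw [e2]
        exact gridPt_le n (q m) _
      · have : ((gridFloor n (q m) (x j.succ) : ℕ) : ℝ) ≤
            gridFloor n (q m) (x j.castSucc - Δ) := by linarith
        have h7 : gridFloor n (q m) (x j.succ) ≤ gridFloor n (q m) (x j.castSucc - Δ) := by
          exact_mod_cast this
        have h8 := gridFloor_mono n (q m) (show x j.castSucc - Δ ≤ x j.castSucc by linarith)
        simp only [gridPt]
        omega
      · intro i hi
        have h4 := hm4 i hi
        have h5 := hfl _ (hx0 i.castSucc).1 (hx0 i.castSucc).2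
        have h6 := hfl _ (hx0 i.succ).1 (hx0 i.succ).2
        have : (gridFloor n (q m) (x i.castSucc) + 2 * W + 2 + gridFloor n (q m) (x j.succ) : ℝ) ≤
            gridFloor n (q m) (x j.castSucc) + gridFloor n (q m) (x i.succ) := by
          rw [hWr]
          linarith
        simp only [gridPt]
        exact_mod_cast this
    rw [Ultrafilter.eventually_or] at hev
    refine hev.imp (fun h1 => ?_) fun h1 => ?_
    · have h2 := (hH x).add (hzero C₀)
      rw [add_zero] at h2
      refine le_of_tendsto_of_tendsto (hH _) h2 ?_
      filter_upwards [h1] with m hm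
      have h0 := hq0 m
      rw [← add_div]
      gcongr
    · have h2 := ((hH (x - Pi.single j.castSucc Δ)).add_const (Δ - θ)).sub (hzero (C₀ + 2))
      rw [sub_zero] at h2
      have := le_of_tendsto_of_tendsto h2 (hH x) (by
        filter_upwards [h1] with m hm
        have h0 := hq0 m
        rw [le_div_iff₀ h0]
        refine le_trans (le_of_eq ?_) hm
        field_simp
        ring)
      linarith
  · intro s hs0 hsn
    have h1 := (hH fun _ => s).add (hzero C₀)
    rw [add_zero] at h1
    have h2 : Tendsto (fun m => (gridFloor n (q m) s : ℝ) / q m) (hyperfilter ℕ : Filter ℕ)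
        (𝓝 s) := by
      have h3 := (tendsto_const_nhds (x := s)).sub (hzero 1)
      rw [sub_zero] at h3
      refine tendsto_of_tendsto_of_tendsto_of_le_of_le h3 (tendsto_const_nhds (x := s))
        (fun m => ?_) fun m => ?_
      · have h0 := hq0 m
        have := lt_gridFloor_add_one (q := q m) hsn
        simp only
        rw [le_div_iff₀ h0, sub_mul, div_mul_cancel₀ _ h0.ne']
        linarith
      · have h0 := hq0 m
        have := gridFloor_le_mul (n := n) (q := q m) hs0
        simp only
        rw [div_le_iff₀ h0]
        linarith
    refine le_of_tendsto_of_tendsto (hα.mul h2) h1 (Eventually.of_forall fun m => ?_)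
    have h3 := (hh m).diag (gridFloor n (q m) s) (gridFloor_le n (q m) s)
    have h0 := hq0 m
    have e : gridPt n (q m) (fun _ => s) = fun _ => gridFloor n (q m) s := rfl
    simp only [e]
    rw [← add_div, ← mul_div_assoc]
    gcongr
    linarith

/-- Discrete admissible functions are asymptotically large at the decreasing progression. -/
theorem exists_le_decreasing (n k : ℕ) (hn : 1 ≤ n) (C₀ : ℝ) {ε : ℝ} (hε : 0 < ε) :
    ∃ q₀ : ℕ, ∀ q, q₀ ≤ q → ∀ (α : ℝ) (h : (Fin (n + 1) → ℕ) → ℝ), 0 ≤ α → α ≤ k + 1 →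
      IsDiscreteAdmissible n q α C₀ h →
      q * (n * α - k * (k + 1) / 2 - ε) ≤ h fun i => (n - i) * q := by
  by_contra hcon
  push Not at hcon
  choose q hq α h hα0 hα1 hh hlt using fun m : ℕ => hcon (m + 1)
  have hle : (hyperfilter ℕ : Filter ℕ) ≤ atTop := by
    rw [← Nat.cofinite_eq_atTop]; exact hyperfilter_le_cofinite
  have hq1 : ∀ m, (1 : ℝ) ≤ q m := fun m => by
    have := hq m
    exact_mod_cast (by omega : 1 ≤ q m)
  obtain ⟨A, hA⟩ := exists_tendsto_hyperfilter (f := α) (B := k + 1)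
    (Eventually.of_forall fun m => abs_le.2 ⟨by linarith [hα0 m], hα1 m⟩)
  have hbd : ∀ x : Fin (n + 1) → ℝ, ∃ L, Tendsto (fun m => h m (gridPt n (q m) x) / q m)
      (hyperfilter ℕ : Filter ℕ) (𝓝 L) := by
    intro x
    set B : ℝ := n * (k + 1) + k * (k + 1) + ε + (n + 1) * n + 4 * |C₀| with hB
    refine exists_tendsto_hyperfilter (B := B) (Eventually.of_forall fun m => ?_)
    have h1 := hq1 m
    have hC := le_abs_self C₀
    have hC' := abs_nonneg C₀
    have h2 := (hh m).mono 0 _ (fun i => Nat.zero_le _) (gridPt_le n (q m) x)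
    have h3 := (hh m).lip 0 _ (fun i => Nat.zero_le _) (gridPt_le n (q m) x)
    have h4 := (hh m).mono 0 (fun i => (n - i) * q m) (fun i => Nat.zero_le _)
      (fun i => Nat.mul_le_mul_right _ (Nat.sub_le _ _))
    have h5 := (hh m).diag 0 (Nat.zero_le _)
    have e : (fun _ : Fin (n + 1) => (0 : ℕ)) = 0 := rfl
    rw [e] at h5
    simp only [Nat.cast_zero, mul_zero] at h5
    have h6 : ∑ i, ((gridPt n (q m) x i : ℝ) - (0 : Fin (n + 1) → ℕ) i) ≤
        (n + 1) * (n * q m) := by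
      calc _ ≤ ∑ i : Fin (n + 1), (n * q m : ℝ) := by
            refine Finset.sum_le_sum fun i _ => ?_
            have : (gridPt n (q m) x i : ℝ) ≤ n * q m := by exact_mod_cast gridPt_le n (q m) x i
            simpa using this
        _ = _ := by simp
    have h7 := hlt m
    have h8 : (n : ℝ) * α m ≤ n * (k + 1) := by gcongr; exact hα1 m
    have h9 : (n : ℝ) * α m - k * (k + 1) / 2 - ε ≤ n * (k + 1) + k * (k + 1) + ε := by
      have : (0 : ℝ) ≤ k * (k + 1) := by positivity
      linarith
    have h10 : q m * ((n : ℝ) * α m - k * (k + 1) / 2 - ε) ≤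
        q m * (n * (k + 1) + k * (k + 1) + ε) := by gcongr
    have h11 : |C₀| ≤ q m * |C₀| := le_mul_of_one_le_left hC' h1
    have h12 : 0 ≤ q m * (n * (k + 1) + k * (k + 1) + ε + (n + 1) * n : ℝ) := by positivity
    rw [abs_div, abs_of_pos (by linarith : (0 : ℝ) < q m), div_le_iff₀ (by linarith), abs_le]
    constructor <;> nlinarith
  choose H hH using hbd
  have hadm := isAdmissible_of_tendsto (fun m => hq m) hh hA hH
  have hA1 : A ≤ k + 1 := le_of_tendsto' hA hα1
  have hfin := hadm.le_decreasing hn (Φ := k * (k + 1) / 2) (by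
    intro l hl
    have h1 : A * l ≤ (k + 1) * l := by gcongr
    have h2 : (0 : ℝ) ≤ ((k : ℝ) - l) * (k + 1 - l) := by
      rcases le_or_gt l k with h | h
      · have : (l : ℝ) ≤ k := by exact_mod_cast h
        exact mul_nonneg (by linarith) (by linarith)
      · have : (k : ℝ) + 1 ≤ l := by exact_mod_cast h
        exact mul_nonneg_of_nonpos_of_nonpos (by linarith) (by linarith)
    nlinarith)
  have e : ∀ m, gridPt n (q m) (fun i => (n : ℝ) - i) = fun i : Fin (n + 1) => (n - i) * q m := by
    intro m
    ext i
    have h1 : (i : ℕ) ≤ n := Nat.le_of_lt_succ i.2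
    have h2 : (n : ℝ) - i = ((n - i : ℕ) : ℝ) := by push_cast [h1]; ring
    simp only [gridPt, gridFloor]
    rw [h2, min_eq_left (by exact_mod_cast Nat.sub_le n i), max_eq_right (by positivity),
      ← Nat.cast_mul, Nat.floor_natCast, mul_comm]
  have h1 := hH fun i => (n : ℝ) - i
  have h2 := le_of_tendsto_of_tendsto h1 (((hA.const_mul (n : ℝ)).sub_const
    (k * (k + 1) / 2 : ℝ)).sub_const ε) (Eventually.of_forall fun m => by
      have h0 : (0 : ℝ) < q m := by linarith [hq1 m]
      simp only [e]
      rw [div_le_iff₀ h0]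
      linarith [hlt m])
  linarith

end IsDiscreteAdmissible

section Counting

/-- Few points have a fiber much smaller than the set of points they are related to. -/
theorem mul_card_filter_fiber_lt_le {V B : Type*} [DecidableEq B] (F G : Finset V)
    (rel : V → V → Prop) [∀ w w', Decidable (rel w w')] (g : V → B) (M L : ℕ)
    (hL : ∀ w' ∈ F, ((G.filter fun w => rel w w').image g).card ≤ L) :
    M * (G.filter fun w => M * (G.filter fun w'' => g w'' = g w).card <
      (F.filter fun w' => rel w w').card).card ≤ L * F.card := by
  set S := G.filter fun w => M * (G.filter fun w'' => g w'' = g w).card <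
      (F.filter fun w' => rel w w').card with hS
  have hpos : ∀ w ∈ G, (0 : ℚ) < (G.filter fun w'' => g w'' = g w).card := by
    intro w hw
    have : 0 < (G.filter fun w'' => g w'' = g w).card :=
      Finset.card_pos.2 ⟨w, Finset.mem_filter.2 ⟨hw, rfl⟩⟩
    exact_mod_cast this
  have h1 : (M : ℚ) * S.card ≤ ∑ w ∈ S, ((F.filter fun w' => rel w w').card : ℚ) /
      (G.filter fun w'' => g w'' = g w).card := by
    rw [mul_comm, ← nsmul_eq_mul]
    refine Finset.card_nsmul_le_sum _ _ _ fun w hw => ?_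
    rw [hS, Finset.mem_filter] at hw
    rw [le_div_iff₀ (hpos w hw.1)]
    exact_mod_cast hw.2.le
  have h2 : ∑ w ∈ S, ((F.filter fun w' => rel w w').card : ℚ) /
      (G.filter fun w'' => g w'' = g w).card ≤
      ∑ w ∈ G, ((F.filter fun w' => rel w w').card : ℚ) /
      (G.filter fun w'' => g w'' = g w).card :=
    Finset.sum_le_sum_of_subset_of_nonneg (Finset.filter_subset _ _) fun _ _ _ => by positivity
  have h3 : ∑ w ∈ G, ((F.filter fun w' => rel w w').card : ℚ) /
      (G.filter fun w'' => g w'' = g w).card = ∑ w' ∈ F, ∑ w ∈ G.filter fun w => rel w w',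
        1 / ((G.filter fun w'' => g w'' = g w).card : ℚ) := by
    simp only [Finset.card_filter, Nat.cast_sum, Finset.sum_div, Finset.sum_filter]
    rw [Finset.sum_comm]
    refine Finset.sum_congr rfl fun w' _ => Finset.sum_congr rfl fun w _ => ?_
    split_ifs <;> simp
  have h4 : ∀ w' ∈ F, ∑ w ∈ G.filter fun w => rel w w',
      1 / ((G.filter fun w'' => g w'' = g w).card : ℚ) ≤ L := by
    intro w' hw'
    refine le_trans ?_ (Nat.cast_le.2 (hL w' hw'))
    rw [← Finset.sum_fiberwise_of_maps_to (g := g) (t := (G.filter fun w => rel w w').image g)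
      fun w hw => Finset.mem_image_of_mem _ hw, Finset.card_eq_sum_ones, Nat.cast_sum]
    refine Finset.sum_le_sum fun b _ => ?_
    have e : ∀ w ∈ (G.filter fun w => rel w w').filter fun w => g w = b,
        1 / ((G.filter fun w'' => g w'' = g w).card : ℚ) =
          1 / ((G.filter fun w'' => g w'' = b).card : ℚ) := by
      intro w hw
      rw [(Finset.mem_filter.1 hw).2]
    rw [Finset.sum_congr rfl e, Finset.sum_const, nsmul_eq_mul, mul_one_div, Nat.cast_one]
    refine div_le_one_of_le₀ ?_ (by positivity)
    exact_mod_cast Finset.card_le_card (Finset.filter_subset_filter _ (Finset.filter_subset _ _))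
  have h5 := Finset.sum_le_sum h4
  rw [Finset.sum_const, nsmul_eq_mul, mul_comm] at h5
  have := h1.trans (h2.trans (h3.le.trans h5))
  exact_mod_cast this

/-- The measure of `{(r, w) : r ∈ J, w ∈ F, S r w}`. -/
def sliceMeasure {V : Type*} (J : Set ℝ) (F : Finset V) (S : ℝ → V → Prop) : ℝ :=
  ∑ w ∈ F, volume.real {r | r ∈ J ∧ S r w}

theorem sliceMeasure_eq_integral {V : Type*} {J : Set ℝ} {F : Finset V} {S : ℝ → V → Prop}
    [∀ r w, Decidable (S r w)] (hJ' : volume J ≠ ⊤)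
    (hS : ∀ w ∈ F, MeasurableSet {r | S r w}) :
    IntegrableOn (fun r => ((F.filter fun w => S r w).card : ℝ)) J ∧
      sliceMeasure J F S = ∫ r in J, ((F.filter fun w => S r w).card : ℝ) := by
  have e : (fun r => ((F.filter fun w => S r w).card : ℝ)) =
      fun r => ∑ w ∈ F, Set.indicator {r | S r w} (fun _ => (1 : ℝ)) r := by
    ext r
    rw [Finset.card_filter, Nat.cast_sum]
    refine Finset.sum_congr rfl fun w _ => ?_
    by_cases h : S r w <;> simp [h]
  have hInt : ∀ w ∈ F, IntegrableOn (Set.indicator {r | S r w} fun _ => (1 : ℝ)) J := by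
    intro w hw
    exact (integrableOn_const hJ').indicator (hS w hw)
  rw [e]
  refine ⟨integrable_finsetSum _ hInt, ?_⟩
  rw [integral_finsetSum _ hInt, sliceMeasure]
  refine Finset.sum_congr rfl fun w hw => ?_
  rw [setIntegral_indicator (hS w hw), setIntegral_const, smul_eq_mul, mul_one]
  rfl

theorem sliceMeasure_le {V : Type*} {J : Set ℝ} {F : Finset V} {S : ℝ → V → Prop} {b : ℝ}
    [∀ r w, Decidable (S r w)] (hJ : MeasurableSet J) (hJ' : volume J ≠ ⊤)
    (hS : ∀ w ∈ F, MeasurableSet {r | S r w})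
    (hb : ∀ r ∈ J, ((F.filter fun w => S r w).card : ℝ) ≤ b) :
    sliceMeasure J F S ≤ b * volume.real J := by
  obtain ⟨h1, h2⟩ := sliceMeasure_eq_integral hJ' hS
  rw [h2]
  refine (setIntegral_mono_on h1 (integrableOn_const hJ') hJ hb).trans ?_
  rw [setIntegral_const, smul_eq_mul, mul_comm]

theorem le_sliceMeasure {V : Type*} {J : Set ℝ} {F : Finset V} {S : ℝ → V → Prop} {b : ℝ}
    [∀ r w, Decidable (S r w)] (hJ : MeasurableSet J) (hJ' : volume J ≠ ⊤)
    (hS : ∀ w ∈ F, MeasurableSet {r | S r w})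
    (hb : ∀ r ∈ J, b ≤ ((F.filter fun w => S r w).card : ℝ)) :
    b * volume.real J ≤ sliceMeasure J F S := by
  obtain ⟨h1, h2⟩ := sliceMeasure_eq_integral hJ' hS
  rw [h2]
  refine le_trans ?_ (setIntegral_mono_on (integrableOn_const hJ') h1 hJ hb)
  rw [setIntegral_const, smul_eq_mul, mul_comm]

theorem sliceMeasure_le_of_subset {V : Type*} {J J' : Set ℝ} (F : Finset V)
    (S : ℝ → V → Prop) (h : J ⊆ J') (hJ' : volume J' ≠ ⊤) :
    sliceMeasure J F S ≤ sliceMeasure J' F S :=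
  Finset.sum_le_sum fun _ _ => measureReal_mono (fun _ hr => ⟨h hr.1, hr.2⟩)
    (measure_ne_top_of_subset (fun _ hr => hr.1) hJ')

theorem sliceMeasure_le_sum {V ι : Type*} {J : Set ℝ} (hJ : volume J ≠ ⊤) (F : Finset V)
    (S : ℝ → V → Prop) (s : Finset ι) (T : ι → ℝ → V → Prop)
    (h : ∀ r ∈ J, ∀ w ∈ F, S r w → ∃ i ∈ s, T i r w) :
    sliceMeasure J F S ≤ ∑ i ∈ s, sliceMeasure J F (T i) := by
  unfold sliceMeasure
  rw [Finset.sum_comm]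
  refine Finset.sum_le_sum fun w hw => ?_
  refine le_trans (measureReal_mono ?_ ?_) (measureReal_biUnion_finset_le s
    fun i => {r | r ∈ J ∧ T i r w})
  · rintro r ⟨h1, h2⟩
    obtain ⟨i, hi, h3⟩ := h r h1 w hw h2
    exact Set.mem_biUnion hi ⟨h1, h3⟩
  · refine measure_ne_top_of_subset ?_ hJ
    intro r hr
    simp only [Set.mem_iUnion] at hr
    obtain ⟨i, -, hr⟩ := hr
    exact hr.1

theorem sliceMeasure_le_add {V : Type*} {J : Set ℝ} (hJ : volume J ≠ ⊤) (F : Finset V)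
    (S T : ℝ → V → Prop) :
    sliceMeasure J F S ≤ sliceMeasure J F T + sliceMeasure J F fun r w => S r w ∧ ¬ T r w := by
  classical
  have := sliceMeasure_le_sum hJ F S Finset.univ
    (fun b : Bool => if b then T else fun r w => S r w ∧ ¬ T r w) (fun r _ w _ h => by
      by_cases hT : T r w
      · exact ⟨true, by simp, by simpa using hT⟩
      · exact ⟨false, by simp, by simpa using ⟨h, hT⟩⟩)
  simpa using this

theorem exists_of_sliceMeasure_pos {V : Type*} {J : Set ℝ} {F : Finset V} {S : ℝ → V → Prop}
    (h : 0 < sliceMeasure J F S) : ∃ r ∈ J, ∃ w ∈ F, S r w := by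
  by_contra hcon
  push Not at hcon
  refine h.ne' (Finset.sum_eq_zero fun w hw => ?_)
  have : {r | r ∈ J ∧ S r w} = ∅ := by
    ext r
    simp only [Set.mem_ofPred_eq, Set.mem_empty_iff_false, iff_false, not_and]
    exact fun hr => hcon r hr w hw
  rw [this, measureReal_empty]

end Counting

section Cells

variable {V : Type*} {n : ℕ}

/-- The index of the cell of side lengths `Q ^ (-a i)` containing `P w · r`. -/
def cellIdx (P : V → Fin (n + 1) → ℝ → ℝ) (Q : ℕ) (a : Fin (n + 1) → ℕ) (r : ℝ) (w : V) :
    Fin (n + 1) → ℤ := fun i => ⌊P w i r * (Q : ℝ) ^ a i⌋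

/-- The number of points of `F` in the cell of `w`. -/
def cellCard (P : V → Fin (n + 1) → ℝ → ℝ) (Q : ℕ) (F : Finset V) (a : Fin (n + 1) → ℕ) (r : ℝ)
    (w : V) : ℕ := (F.filter fun w' => cellIdx P Q a r w' = cellIdx P Q a r w).card

/-- The number of points of `F` in the box of half side lengths `K * Q ^ (-a i)` around `w`. -/
def boxCard (P : V → Fin (n + 1) → ℝ → ℝ) (Q : ℕ) (F : Finset V) (K : ℕ) (a : Fin (n + 1) → ℕ)
    (r : ℝ) (w : V) : ℕ :=
  (F.filter fun w' => ∀ i, |P w' i r - P w i r| * (Q : ℝ) ^ a i ≤ K).card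

variable {P : V → Fin (n + 1) → ℝ → ℝ} {Q : ℕ} {F : Finset V} {a b : Fin (n + 1) → ℕ} {r : ℝ}
  {w w' : V}

theorem cellIdx_eq_ediv (hQ : 0 < Q) (h : a ≤ b) (i : Fin (n + 1)) :
    cellIdx P Q a r w i = cellIdx P Q b r w i / ((Q ^ (b i - a i) : ℕ) : ℤ) := by
  have hQ' : (0 : ℝ) < Q := by exact_mod_cast hQ
  unfold cellIdx
  rw [← Int.floor_div_natCast]
  congr 1
  rw [eq_div_iff (by positivity), mul_assoc]
  congr 1
  push_cast
  rw [← pow_add]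
  congr 1
  exact Nat.add_sub_cancel' (h i)

theorem cellIdx_eq_of_le (hQ : 0 < Q) (h : a ≤ b) (hw : cellIdx P Q b r w' = cellIdx P Q b r w) :
    cellIdx P Q a r w' = cellIdx P Q a r w := by
  ext i
  rw [cellIdx_eq_ediv hQ h, cellIdx_eq_ediv hQ h, hw]

theorem cellIdx_sup_eq (ha : cellIdx P Q a r w' = cellIdx P Q a r w)
    (hb : cellIdx P Q b r w' = cellIdx P Q b r w) :
    cellIdx P Q (a ⊔ b) r w' = cellIdx P Q (a ⊔ b) r w := by
  ext i
  have h1 := congrFun ha i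
  have h2 := congrFun hb i
  unfold cellIdx at *
  rcases le_total (a i) (b i) with h | h
  · simpa [Pi.sup_apply, sup_eq_right.2 h] using h2
  · simpa [Pi.sup_apply, sup_eq_left.2 h] using h1

theorem abs_sub_mul_lt_one_of_cellIdx_eq (h : cellIdx P Q a r w' = cellIdx P Q a r w)
    (i : Fin (n + 1)) : |P w' i r - P w i r| * (Q : ℝ) ^ a i < 1 := by
  have := Int.abs_sub_lt_one_of_floor_eq_floor (congrFun h i)
  rwa [← sub_mul, abs_mul, abs_of_nonneg (by positivity : (0 : ℝ) ≤ (Q : ℝ) ^ a i)] at this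

theorem cellCard_le_boxCard {K : ℕ} (hK : 1 ≤ K) :
    cellCard P Q F a r w ≤ boxCard P Q F K a r w := by
  refine Finset.card_le_card (Finset.monotone_filter_right _ fun w' _ h i => ?_)
  exact (abs_sub_mul_lt_one_of_cellIdx_eq h i).le.trans (by exact_mod_cast hK)

theorem boxCard_mono {K K' : ℕ} (hK : K ≤ K') : boxCard P Q F K a r w ≤ boxCard P Q F K' a r w :=
  Finset.card_le_card (Finset.monotone_filter_right _ fun _ _ h i =>
    (h i).trans (by exact_mod_cast hK))

theorem cellCard_anti (hQ : 0 < Q) (h : a ≤ b) : cellCard P Q F b r w ≤ cellCard P Q F a r w :=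
  Finset.card_le_card (Finset.monotone_filter_right _ fun _ _ hw => cellIdx_eq_of_le hQ h hw)

theorem cellCard_pos (hw : w ∈ F) : 0 < cellCard P Q F a r w :=
  Finset.card_pos.2 ⟨w, Finset.mem_filter.2 ⟨hw, rfl⟩⟩

theorem card_image_cellIdx_le_of_le (hQ : 0 < Q) (h : a ≤ b) (G : Finset V) (w' : V) :
    ((G.filter fun w => cellIdx P Q a r w' = cellIdx P Q a r w).image
      fun w => cellIdx P Q b r w).card ≤ Q ^ ∑ i, (b i - a i) := by
  have hD : ∀ i, (0 : ℤ) < ((Q ^ (b i - a i) : ℕ) : ℤ) := fun i => by positivity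
  refine (Finset.card_le_card (t := Fintype.piFinset fun i =>
    Finset.Ico (cellIdx P Q a r w' i * ((Q ^ (b i - a i) : ℕ) : ℤ))
      (cellIdx P Q a r w' i * ((Q ^ (b i - a i) : ℕ) : ℤ) + ((Q ^ (b i - a i) : ℕ) : ℤ))) ?_).trans
      ?_
  · intro c hc
    obtain ⟨w, hw, rfl⟩ := Finset.mem_image.1 hc
    rw [Finset.mem_filter] at hw
    rw [Fintype.mem_piFinset]
    intro i
    rw [hw.2, cellIdx_eq_ediv hQ h, Finset.mem_Ico]
    have h1 := Int.ediv_mul_le (cellIdx P Q b r w i) (hD i).ne'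
    have h2 := Int.lt_ediv_add_one_mul_self (cellIdx P Q b r w i) (hD i)
    exact ⟨h1, by linarith⟩
  · rw [Fintype.card_piFinset, Finset.prod_congr rfl fun i _ => by
      rw [Int.card_Ico, add_sub_cancel_left, Int.toNat_natCast], Finset.prod_pow_eq_pow_sum]

theorem card_image_cellIdx_le_of_box (K : ℕ) (G : Finset V) (w' : V) :
    ((G.filter fun w => ∀ i, |P w' i r - P w i r| * (Q : ℝ) ^ a i ≤ K).image
      fun w => cellIdx P Q a r w).card ≤ (2 * K + 3) ^ (n + 1) := by
  refine (Finset.card_le_card (t := Fintype.piFinset fun i =>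
    Finset.Icc (cellIdx P Q a r w' i - (K + 1)) (cellIdx P Q a r w' i + (K + 1))) ?_).trans ?_
  · intro c hc
    obtain ⟨w, hw, rfl⟩ := Finset.mem_image.1 hc
    rw [Finset.mem_filter] at hw
    rw [Fintype.mem_piFinset]
    intro i
    have h1 := hw.2 i
    rw [← abs_of_nonneg (by positivity : (0 : ℝ) ≤ (Q : ℝ) ^ a i), ← abs_mul, sub_mul, abs_le] at h1
    have e1 := Int.floor_le (P w' i r * (Q : ℝ) ^ a i)
    have e2 := Int.lt_floor_add_one (P w' i r * (Q : ℝ) ^ a i)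
    have e3 := Int.floor_le (P w i r * (Q : ℝ) ^ a i)
    have e4 := Int.lt_floor_add_one (P w i r * (Q : ℝ) ^ a i)
    rw [Finset.mem_Icc]
    unfold cellIdx
    constructor
    · have : ((⌊P w' i r * (Q : ℝ) ^ a i⌋ : ℤ) : ℝ) <
          ((⌊P w i r * (Q : ℝ) ^ a i⌋ + K + 1 : ℤ) : ℝ) := by
        push_cast; linarith
      have := Int.cast_lt.1 this
      linarith
    · have : ((⌊P w i r * (Q : ℝ) ^ a i⌋ : ℤ) : ℝ) <
          ((⌊P w' i r * (Q : ℝ) ^ a i⌋ + K + 1 : ℤ) : ℝ) := by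
        push_cast; linarith
      have := Int.cast_lt.1 this
      linarith
  · rw [Fintype.card_piFinset]
    refine le_of_eq ?_
    rw [Finset.prod_congr rfl (g := fun _ => 2 * K + 3) fun i _ => by rw [Int.card_Icc]; omega]
    simp

/-- The functions `r ↦ P w i r` are continuous, and differences of them over `w` are given by
Taylor expansions in which `P w (i + 1)` is the derivative of `P w i`. -/
structure IsTaylorFamily (P : V → Fin (n + 1) → ℝ → ℝ) : Prop where
  cont : ∀ w i, Continuous (P w i)
  taylor : ∀ w w' i r s, P w' i s - P w i s =
    ∑ l, if i ≤ l then (P w' l r - P w l r) * (s - r) ^ (l.1 - i.1) / (l.1 - i.1).factorial else 0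

theorem IsTaylorFamily.measurable_cellIdx (hP : IsTaylorFamily P) (a : Fin (n + 1) → ℕ) (w : V) :
    Measurable fun r => cellIdx P Q a r w :=
  measurable_pi_lambda _ fun i =>
    Int.measurable_floor.comp ((hP.cont w i).mul continuous_const).measurable

theorem measurable_card_filter {S : ℝ → V → Prop} [∀ r w, Decidable (S r w)]
    (hS : ∀ w ∈ F, MeasurableSet {r | S r w}) :
    Measurable fun r => (F.filter fun w => S r w).card := by
  simp only [Finset.card_filter]
  exact Finset.measurable_sum _ fun w hw =>
    Measurable.ite (hS w hw) measurable_const measurable_const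

theorem IsTaylorFamily.measurable_cellCard (hP : IsTaylorFamily P) (a : Fin (n + 1) → ℕ) (w : V) :
    Measurable fun r => cellCard P Q F a r w :=
  measurable_card_filter fun w' _ =>
    measurableSet_eq_fun (hP.measurable_cellIdx a w') (hP.measurable_cellIdx a w)

theorem IsTaylorFamily.measurable_boxCard (hP : IsTaylorFamily P) (K : ℕ) (a : Fin (n + 1) → ℕ)
    (w : V) : Measurable fun r => boxCard P Q F K a r w := by
  refine measurable_card_filter fun w' _ => ?_
  have : {r | ∀ i, |P w' i r - P w i r| * (Q : ℝ) ^ a i ≤ K} =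
      ⋂ i, {r | |P w' i r - P w i r| * (Q : ℝ) ^ a i ≤ K} := by
    ext r; simp
  rw [this]
  refine MeasurableSet.iInter fun i => ?_
  have h1 := hP.cont w' i
  have h2 := hP.cont w i
  exact measurableSet_le (by fun_prop) measurable_const

theorem volume_Icc_zero_one_ne_top : volume (Set.Icc (0 : ℝ) 1) ≠ ⊤ := by simp

/-- Boxes rarely contain many more points than the corresponding cells. -/
theorem IsTaylorFamily.sliceMeasure_boxCard_le (hP : IsTaylorFamily P) (hQ : 0 < Q) (K m : ℕ)
    (a : Fin (n + 1) → ℕ) :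
    sliceMeasure (Set.Icc 0 1) F (fun r w => Q ^ m * cellCard P Q F a r w < boxCard P Q F K a r w) ≤
      (2 * K + 3) ^ (n + 1) * F.card / Q ^ m := by
  have hQ' : (0 : ℝ) < Q := by exact_mod_cast hQ
  refine (sliceMeasure_le measurableSet_Icc volume_Icc_zero_one_ne_top ?_
    (b := (2 * K + 3) ^ (n + 1) * F.card / Q ^ m) ?_).trans (by simp)
  · intro w _
    exact measurableSet_lt ((hP.measurable_cellCard a w).const_mul _) (hP.measurable_boxCard K a w)
  · intro r _
    rw [le_div_iff₀ (by positivity), mul_comm]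
    have : Q ^ m * (F.filter fun w => Q ^ m * cellCard P Q F a r w < boxCard P Q F K a r w).card ≤
        (2 * K + 3) ^ (n + 1) * F.card := mul_card_filter_fiber_lt_le F F
      (fun w w' => ∀ i, |P w' i r - P w i r| * (Q : ℝ) ^ a i ≤ K) (fun w => cellIdx P Q a r w)
      (Q ^ m) ((2 * K + 3) ^ (n + 1)) fun w' _ => card_image_cellIdx_le_of_box K F w'
    exact_mod_cast this

/-- Cells rarely contain many fewer points than coarser cells. -/
theorem IsTaylorFamily.sliceMeasure_cellCard_le (hP : IsTaylorFamily P) (hQ : 0 < Q) (m : ℕ)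
    (h : a ≤ b) :
    sliceMeasure (Set.Icc 0 1) F (fun r w => Q ^ ((∑ i, (b i - a i)) + m) * cellCard P Q F b r w <
      cellCard P Q F a r w) ≤ F.card / Q ^ m := by
  have hQ' : (0 : ℝ) < Q := by exact_mod_cast hQ
  refine (sliceMeasure_le measurableSet_Icc volume_Icc_zero_one_ne_top ?_
    (b := F.card / Q ^ m) ?_).trans (by simp)
  · intro w _
    exact measurableSet_lt ((hP.measurable_cellCard b w).const_mul _) (hP.measurable_cellCard a w)
  · intro r _
    rw [le_div_iff₀ (by positivity), mul_comm]
    have : Q ^ ((∑ i, (b i - a i)) + m) * (F.filter fun w => Q ^ ((∑ i, (b i - a i)) + m) *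
        cellCard P Q F b r w < cellCard P Q F a r w).card ≤ (Q ^ ∑ i, (b i - a i)) * F.card :=
      mul_card_filter_fiber_lt_le F F
      (fun w w' => cellIdx P Q a r w' = cellIdx P Q a r w) (fun w => cellIdx P Q b r w)
      (Q ^ ((∑ i, (b i - a i)) + m)) (Q ^ ∑ i, (b i - a i))
      fun w' _ => card_image_cellIdx_le_of_le hQ h F w'
    have := le_of_mul_le_mul_left ((mul_assoc _ _ _).symm.trans_le
      ((congrArg (· * _) (pow_add Q _ m).symm).trans_le this)) (by positivity)
    exact_mod_cast this

/-- Points of a set rarely lie in cells that contain few points of the set. -/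
theorem IsTaylorFamily.sliceMeasure_filter_cell_le (hP : IsTaylorFamily P) (hQ : 0 < Q) (m : ℕ)
    {B : ℝ → V → Prop} [∀ r w, Decidable (B r w)]
    (hB : ∀ w ∈ F, MeasurableSet {r | B r w}) (a : Fin (n + 1) → ℕ) :
    sliceMeasure (Set.Icc 0 1) F (fun r w => B r w ∧
      Q ^ m * (F.filter fun w' => B r w' ∧ cellIdx P Q a r w' = cellIdx P Q a r w).card <
        cellCard P Q F a r w) ≤ F.card / Q ^ m := by
  have hQ' : (0 : ℝ) < Q := by exact_mod_cast hQ
  refine (sliceMeasure_le measurableSet_Icc volume_Icc_zero_one_ne_top ?_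
    (b := F.card / Q ^ m) ?_).trans (by simp)
  · intro w hw
    refine (hB w hw).inter (measurableSet_lt (Measurable.const_mul ?_ _)
      (hP.measurable_cellCard a w))
    exact measurable_card_filter fun w' hw' => (hB w' hw').inter
      (measurableSet_eq_fun (hP.measurable_cellIdx a w') (hP.measurable_cellIdx a w))
  · intro r _
    rw [le_div_iff₀ (by positivity), mul_comm]
    have := mul_card_filter_fiber_lt_le F (F.filter fun w => B r w)
      (fun w w' => cellIdx P Q a r w' = cellIdx P Q a r w) (fun w => cellIdx P Q a r w)
      (Q ^ m) 1 fun w' _ => by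
        simpa using card_image_cellIdx_le_of_le hQ (le_refl a) (F.filter fun w => B r w) w'
    simp only [Finset.filter_filter, one_mul] at this
    exact_mod_cast this

end Cells

section UniformClass

theorem card_le_mul_card_image_mul_card_image {V β γ : Type*} [DecidableEq β] [DecidableEq γ]
    (X : Finset V) (f : V → β) (g : V → γ) (m : ℕ)
    (hm : ∀ w₁ ∈ X, (X.filter fun w => f w = f w₁ ∧ g w = g w₁).card ≤ m) :
    X.card ≤ m * ((X.image f).card * (X.image g).card) := by
  rw [← Finset.card_product]
  refine Finset.card_le_mul_card_image_of_maps_to (f := fun w => (f w, g w)) (fun w hw =>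
    Finset.mem_product.2 ⟨Finset.mem_image_of_mem f hw, Finset.mem_image_of_mem g hw⟩) _ ?_
  intro v _
  rcases (X.filter fun w => (f w, g w) = v).eq_empty_or_nonempty with he | ⟨w₁, hw₁⟩
  · rw [he]; simp
  · obtain ⟨hw₁X, rfl⟩ := Finset.mem_filter.1 hw₁
    simpa only [Prod.mk.injEq] using hm w₁ hw₁X

variable {V : Type*} {n : ℕ}

/-- A large set `B` of pairs `(r, w)` on which the number of points of `F` in each cell is constant
up to a factor `Q`, and comparable to the number of points in boxes. -/
structure IsUniformClass (P : V → Fin (n + 1) → ℝ → ℝ) (Q q : ℕ) (F : Finset V)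
    (e : (Fin (n + 1) → ℕ) → ℕ) (B : ℝ → V → Prop) : Prop where
  mem : ∀ r w, B r w → r ∈ Set.Icc (0 : ℝ) 1 ∧ w ∈ F
  meas : ∀ w ∈ F, MeasurableSet {r | B r w}
  large : (F.card : ℝ) / Q ^ 3 ≤ sliceMeasure (Set.Icc 0 1) F B
  log_eq : ∀ r w, B r w → ∀ a, (∀ i, a i ≤ n * q) → Nat.log Q (cellCard P Q F a r w) = e a
  boxCard_le : ∀ r w, B r w → ∀ a, (∀ i, a i ≤ n * q) →
    boxCard P Q F 3 a r w ≤ Q ^ 3 * cellCard P Q F a r w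
  cellCard_le : ∀ r w, B r w → ∀ a b, a ≤ b → (∀ i, b i ≤ n * q) →
    cellCard P Q F a r w ≤ Q ^ ((∑ i, (b i - a i)) + 3) * cellCard P Q F b r w

variable {P : V → Fin (n + 1) → ℝ → ℝ} {Q q : ℕ} {F : Finset V} {e : (Fin (n + 1) → ℕ) → ℕ}
  {B : ℝ → V → Prop} {a b : Fin (n + 1) → ℕ} {r : ℝ} {w : V}

namespace IsUniformClass

theorem pow_le_cellCard (h : IsUniformClass P Q q F e B) (hB : B r w) (ha : ∀ i, a i ≤ n * q) :
    Q ^ e a ≤ cellCard P Q F a r w := by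
  rw [← h.log_eq r w hB a ha]
  exact Nat.pow_log_le_self _ (cellCard_pos (h.mem r w hB).2).ne'

theorem cellCard_lt_pow (h : IsUniformClass P Q q F e B) (hQ : 2 ≤ Q) (hB : B r w)
    (ha : ∀ i, a i ≤ n * q) : cellCard P Q F a r w < Q ^ (e a + 1) := by
  rw [← h.log_eq r w hB a ha]
  exact Nat.lt_pow_succ_log_self hQ _

theorem exists_mem (h : IsUniformClass P Q q F e B) (hQ : 2 ≤ Q) (hF : F.Nonempty) :
    ∃ r w, B r w := by
  have h1 := h.large
  have h2 : (0 : ℝ) < F.card := by exact_mod_cast hF.card_pos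
  have h3 : (0 : ℝ) < Q := by positivity
  obtain ⟨r, -, w, -, hB⟩ := exists_of_sliceMeasure_pos ((by positivity : (0 : ℝ) < _).trans_le h1)
  exact ⟨r, w, hB⟩

theorem le_of_le (h : IsUniformClass P Q q F e B) (hQ : 2 ≤ Q) (hF : F.Nonempty) (hab : a ≤ b)
    (hb : ∀ i, b i ≤ n * q) : e b ≤ e a := by
  obtain ⟨r, w, hB⟩ := h.exists_mem hQ hF
  rw [← h.log_eq r w hB b hb, ← h.log_eq r w hB a fun i => (hab i).trans (hb i)]
  exact Nat.log_mono_right (cellCard_anti (by omega) hab)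

theorem le_add_of_le (h : IsUniformClass P Q q F e B) (hQ : 2 ≤ Q) (hF : F.Nonempty) (hab : a ≤ b)
    (hb : ∀ i, b i ≤ n * q) : e a ≤ e b + (∑ i, (b i - a i)) + 3 := by
  obtain ⟨r, w, hB⟩ := h.exists_mem hQ hF
  have h1 := h.pow_le_cellCard hB fun i => (hab i).trans (hb i)
  have h2 := h.cellCard_le r w hB a b hab hb
  have h3 := h.cellCard_lt_pow hQ hB hb
  have h4 : Q ^ e a < Q ^ ((∑ i, (b i - a i)) + 3 + (e b + 1)) := by
    rw [pow_add _ _ (e b + 1)]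
    exact h1.trans_lt (h2.trans_lt (Nat.mul_lt_mul_of_pos_left h3 (by positivity)))
  have := (Nat.pow_lt_pow_iff_right hQ).1 h4
  omega

/-- A large part of some cell belongs to the class. -/
theorem exists_cellCard_le [∀ r w, Decidable (B r w)] (h : IsUniformClass P Q q F e B)
    (hP : IsTaylorFamily P) (hQ : 2 ≤ Q) (hF : F.Nonempty) (a : Fin (n + 1) → ℕ) :
    ∃ r w, B r w ∧ cellCard P Q F a r w ≤
      Q ^ 4 * (F.filter fun w' => B r w' ∧ cellIdx P Q a r w' = cellIdx P Q a r w).card := by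
  have h1 := hP.sliceMeasure_filter_cell_le (F := F) (by omega : 0 < Q) 4 h.meas a
  have h2 : (0 : ℝ) < F.card := by exact_mod_cast hF.card_pos
  have h3 : (1 : ℝ) < Q := by exact_mod_cast hQ
  have h4 : (F.card : ℝ) / Q ^ 4 < F.card / Q ^ 3 :=
    div_lt_div_of_pos_left h2 (by positivity) (pow_lt_pow_right₀ h3 (by norm_num))
  have h5 := sliceMeasure_le_add volume_Icc_zero_one_ne_top F B (fun r w => B r w ∧
      Q ^ 4 * (F.filter fun w' => B r w' ∧ cellIdx P Q a r w' = cellIdx P Q a r w).card <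
        cellCard P Q F a r w)
  have h6 := h.large
  obtain ⟨r, -, w, -, hB, hcon⟩ := exists_of_sliceMeasure_pos (J := Set.Icc 0 1) (F := F)
    (S := fun r w => B r w ∧ ¬ (B r w ∧
      Q ^ 4 * (F.filter fun w' => B r w' ∧ cellIdx P Q a r w' = cellIdx P Q a r w).card <
        cellCard P Q F a r w)) (by linarith)
  exact ⟨r, w, hB, not_lt.1 fun h => hcon ⟨hB, h⟩⟩

theorem pow_mul_card_image_le [∀ r w, Decidable (B r w)] (h : IsUniformClass P Q q F e B)
    (hQ : 2 ≤ Q) {c : Fin (n + 1) → ℕ} (hca : c ≤ a) (ha : ∀ i, a i ≤ n * q) :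
    Q ^ e a * ((F.filter fun w' => B r w' ∧ cellIdx P Q c r w' = cellIdx P Q c r w).image
      fun w' => cellIdx P Q a r w').card ≤ cellCard P Q F c r w := by
  set I := (F.filter fun w' => B r w' ∧ cellIdx P Q c r w' = cellIdx P Q c r w).image
      fun w' => cellIdx P Q a r w' with hI
  refine (Finset.mul_card_image_le_card_of_maps_to (t := I) (f := fun w' => cellIdx P Q a r w')
    (s := (F.filter fun w' => cellIdx P Q c r w' = cellIdx P Q c r w).filter
      fun w' => cellIdx P Q a r w' ∈ I) (fun w' hw' => (Finset.mem_filter.1 hw').2)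
      (Q ^ e a) ?_).trans
    (Finset.card_le_card (Finset.filter_subset _ _))
  intro v hv
  obtain ⟨w₁, hw₁, rfl⟩ := Finset.mem_image.1 hv
  obtain ⟨hw₁F, hB, hc⟩ := Finset.mem_filter.1 hw₁
  refine (h.pow_le_cellCard hB ha).trans (Finset.card_le_card ?_)
  intro w' hw'
  obtain ⟨hF', hw'⟩ := Finset.mem_filter.1 hw'
  simp only [Finset.mem_filter]
  exact ⟨⟨⟨hF', (cellIdx_eq_of_le (by omega) hca hw').trans hc⟩, hw' ▸ hv⟩, hw'⟩

theorem add_le_sup_add_inf (h : IsUniformClass P Q q F e B) (hP : IsTaylorFamily P) (hQ : 2 ≤ Q)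
    (hF : F.Nonempty) (ha : ∀ i, a i ≤ n * q) (hb : ∀ i, b i ≤ n * q) :
    e a + e b ≤ e (a ⊔ b) + e (a ⊓ b) + 7 := by
  have : ∀ r w, Decidable (B r w) := fun _ _ => Classical.propDecidable _
  obtain ⟨r, w, hB, hX⟩ := h.exists_cellCard_le hP hQ hF (a ⊓ b)
  have hinf : ∀ i, (a ⊓ b) i ≤ n * q := fun i => inf_le_left.trans (ha i)
  have hsup : ∀ i, (a ⊔ b) i ≤ n * q := fun i => sup_le (ha i) (hb i)
  have ka := h.pow_mul_card_image_le (r := r) (w := w) hQ (inf_le_left : a ⊓ b ≤ a) ha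
  have kb := h.pow_mul_card_image_le (r := r) (w := w) hQ (inf_le_right : a ⊓ b ≤ b) hb
  set X := F.filter fun w' => B r w' ∧ cellIdx P Q (a ⊓ b) r w' = cellIdx P Q (a ⊓ b) r w with hXd
  have hN := h.cellCard_lt_pow hQ hB hinf
  have hXc : X.card ≤ Q ^ (e (a ⊔ b) + 1) * ((X.image fun w' => cellIdx P Q a r w').card *
      (X.image fun w' => cellIdx P Q b r w').card) := by
    refine card_le_mul_card_image_mul_card_image X _ _ _ fun w₁ hw₁ => ?_
    refine (Finset.card_le_card ?_).trans
      (h.cellCard_lt_pow hQ (Finset.mem_filter.1 hw₁).2.1 hsup).le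
    intro w' hw'
    obtain ⟨hw'X, hw'⟩ := Finset.mem_filter.1 hw'
    exact Finset.mem_filter.2 ⟨(Finset.mem_filter.1 hw'X).1, cellIdx_sup_eq hw'.1 hw'.2⟩
  set A := (X.image fun w' => cellIdx P Q a r w').card
  set A' := (X.image fun w' => cellIdx P Q b r w').card
  set N := cellCard P Q F (a ⊓ b) r w with hNd
  have hNpos : 0 < N := cellCard_pos (h.mem r w hB).2
  have key : Q ^ (e a + e b) * N ≤ Q ^ (e (a ⊔ b) + 5) * N * N := by
    calc Q ^ (e a + e b) * N ≤ Q ^ (e a + e b) * (Q ^ 4 * (Q ^ (e (a ⊔ b) + 1) * (A * A'))) := by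
          gcongr; exact hX.trans (by gcongr)
      _ = Q ^ (e (a ⊔ b) + 5) * (Q ^ e a * A) * (Q ^ e b * A') := by ring
      _ ≤ Q ^ (e (a ⊔ b) + 5) * N * N := by gcongr
  have key2 := le_of_mul_le_mul_right key hNpos
  have key3 : Q ^ (e a + e b) < Q ^ (e (a ⊔ b) + 5 + (e (a ⊓ b) + 1)) := by
    rw [pow_add _ _ (e (a ⊓ b) + 1)]
    exact key2.trans_lt (Nat.mul_lt_mul_of_pos_left hN (by positivity))
  have := (Nat.pow_lt_pow_iff_right hQ).1 key3
  omega

end IsUniformClass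

end UniformClass

section Pair

variable {V : Type*} {n : ℕ}

theorem sum_inv_factorial_le_three (i : Fin (n + 1)) :
    ∑ l : Fin (n + 1), (if i ≤ l then 1 / ((l.1 - i.1).factorial : ℝ) else 0) ≤ 3 := by
  have h1 : ∑ l : Fin (n + 1), (if i ≤ l then 1 / ((l.1 - i.1).factorial : ℝ) else 0) =
      ∑ l ∈ Finset.range (n + 1), if i.1 ≤ l then 1 / ((l - i.1).factorial : ℝ) else 0 :=
    Fin.sum_univ_eq_sum_range (fun l => if i.1 ≤ l then 1 / ((l - i.1).factorial : ℝ) else 0) _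
  have h2 : (Finset.range (n + 1)).filter (fun l => i.1 ≤ l) = Finset.Ico i.1 (n + 1) := by
    ext l; simp [and_comm]
  rw [h1, ← Finset.sum_filter, h2, Finset.sum_Ico_eq_sum_range]
  have h3 := Real.sum_le_exp_of_nonneg (zero_le_one : (0 : ℝ) ≤ 1) (n + 1 - i.1)
  have h4 := Real.exp_one_lt_d9
  simp only [one_pow] at h3
  simp only [add_tsub_cancel_left]
  linarith

theorem le_add_mul_of_gap {a : Fin (n + 1) → ℕ} {p : ℕ}
    (ha : ∀ i : Fin n, a i.castSucc ≤ a i.succ + p) {i l : Fin (n + 1)} (h : i ≤ l) :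
    a i ≤ a l + (l.1 - i.1) * p := by
  induction l using Fin.induction with
  | zero => rw [Fin.le_zero_iff.1 h]; simp
  | succ l ih =>
    rcases h.eq_or_lt with rfl | h
    · simp
    · have h' : i ≤ l.castSucc := by
        rw [Fin.le_def]; rw [Fin.lt_def] at h; simp at h ⊢; omega
      have := ih h'
      have h3 := ha l
      have h4 : l.succ.1 - i.1 = l.castSucc.1 - i.1 + 1 := by
        rw [Fin.le_def] at h'; simp at h' ⊢; omega
      rw [h4]
      linarith

theorem abs_taylor_term_mul_le {Q : ℝ} (hQ : 0 < Q) {d τ : ℝ} {p k k' m : ℕ} (hτ : |τ| * Q ^ p ≤ 1)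
    (hd : |d| * Q ^ k ≤ 1) (hk : k' ≤ k + m * p) (hQ1 : 1 ≤ Q) : |d * τ ^ m| * Q ^ k' ≤ 1 := by
  calc |d * τ ^ m| * Q ^ k' ≤ |d * τ ^ m| * Q ^ (k + m * p) := by gcongr
    _ = (|d| * Q ^ k) * (|τ| * Q ^ p) ^ m := by rw [abs_mul, abs_pow]; ring
    _ ≤ 1 * 1 ^ m := by gcongr
    _ = 1 := by simp

theorem abs_taylor_mul_le {Q : ℝ} (hQ1 : 1 ≤ Q) {d : Fin (n + 1) → ℝ} {τ : ℝ} {p : ℕ}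
    {a : Fin (n + 1) → ℕ} (ha : ∀ i : Fin n, a i.castSucc ≤ a i.succ + p)
    (hτ : |τ| * Q ^ p ≤ 1) (hd : ∀ l, |d l| * Q ^ a l ≤ 1) (i : Fin (n + 1)) :
    |∑ l, if i ≤ l then d l * τ ^ (l.1 - i.1) / (l.1 - i.1).factorial else 0| * Q ^ a i ≤ 3 := by
  refine le_trans ?_ (sum_inv_factorial_le_three i)
  refine (mul_le_mul_of_nonneg_right (Finset.abs_sum_le_sum_abs _ _) (by positivity)).trans ?_
  rw [Finset.sum_mul]
  refine Finset.sum_le_sum fun l _ => ?_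
  split_ifs with h
  · rw [abs_div, Nat.abs_cast, div_mul_eq_mul_div]
    gcongr
    exact abs_taylor_term_mul_le (by linarith) hτ (hd l) (le_add_mul_of_gap ha h) hQ1
  · simp

/-- A function whose derivative is large compared to its higher derivatives cannot be small at
two points far from each other. -/
theorem abs_mul_le_of_taylor {Q : ℝ} (hQ2 : 2 ≤ Q) {d : Fin (n + 1) → ℝ} {τ : ℝ} {p W v : ℕ}
    {x : Fin (n + 1) → ℕ} {j : Fin n} (hvW : v ≤ W)
    (hx : ∀ i, i ≠ j → x i.castSucc + W + 2 ≤ x i.succ + p)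
    (hτ : |τ| * Q ^ p ≤ 1) (hd : ∀ l, |d l| * Q ^ x l ≤ 1)
    (hfar : 1 < |d j.succ| * Q ^ (x j.succ + v))
    (hsmall : |∑ l, if j.castSucc ≤ l then
      d l * τ ^ (l.1 - j.castSucc.1) / (l.1 - j.castSucc.1).factorial else 0| *
        Q ^ x j.castSucc ≤ 1) :
    |τ| * Q ^ x j.castSucc ≤ 3 * Q ^ (x j.succ + v) := by
  have hQ0 : 0 < Q := by linarith
  have hQ1 : 1 ≤ Q := by linarith
  set c : Fin (n + 1) → ℝ := fun l => if j.castSucc ≤ l then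
      d l * τ ^ (l.1 - j.castSucc.1) / (l.1 - j.castSucc.1).factorial else 0 with hc
  set β : Fin (n + 1) → ℝ := fun l => if j.castSucc ≤ l then
      1 / ((l.1 - j.castSucc.1).factorial : ℝ) else 0 with hβ
  have hjc : c j.castSucc = d j.castSucc := by simp [hc]
  have hle : j.castSucc ≤ j.succ := j.castSucc_lt_succ.le
  have hsub : j.succ.1 - j.castSucc.1 = 1 := by simp
  have hjs : c j.succ = d j.succ * τ := by simp only [hc, if_pos hle, hsub]; simp
  have hbjc : β j.castSucc = 1 := by simp [hβ]
  have hbjs : β j.succ = 1 := by simp only [hβ, if_pos hle, hsub]; simp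
  have hmem : j.succ ∈ Finset.univ.erase j.castSucc := by
    simp [j.castSucc_lt_succ.ne']
  set s := (Finset.univ.erase j.castSucc).erase j.succ with hs
  have hsum : ∀ f : Fin (n + 1) → ℝ, ∑ l, f l = f j.castSucc + (f j.succ + ∑ l ∈ s, f l) := by
    intro f
    rw [hs, Finset.add_sum_erase _ _ hmem, Finset.add_sum_erase _ _ (Finset.mem_univ _)]
  have hβs : ∑ l ∈ s, β l ≤ 1 := by
    have h1 := sum_inv_factorial_le_three j.castSucc
    have h2 := hsum β
    rw [hbjc, hbjs] at h2
    have h3 : ∑ l, β l ≤ 3 := h1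
    linarith
  have hrem : |∑ l ∈ s, c l| * Q ^ (x j.succ + W + 2) ≤ |τ| := by
    have h0 : |τ| * ∑ l ∈ s, β l ≤ |τ| * 1 := by gcongr
    rw [mul_one] at h0
    refine le_trans ?_ h0
    refine (mul_le_mul_of_nonneg_right (Finset.abs_sum_le_sum_abs _ _) (by positivity)).trans ?_
    rw [Finset.sum_mul, Finset.mul_sum]
    refine Finset.sum_le_sum fun l hl => ?_
    simp only [hs, Finset.mem_erase, Finset.mem_univ, and_true] at hl
    simp only [hc, hβ]
    split_ifs with h
    · have h1 : j.castSucc < l := lt_of_le_of_ne h (Ne.symm hl.2)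
      have h2 : j.1 + 1 < l.1 := by
        rw [Fin.lt_def] at h1
        have h3 : l.1 ≠ j.1 + 1 := fun h' => hl.1 (Fin.ext h')
        simp at h1
        omega
      obtain ⟨m, hm⟩ : ∃ m, l.1 - j.castSucc.1 = m + 1 := ⟨l.1 - j.1 - 1, by simp; omega⟩
      have hgap : x j.succ + W + 2 ≤ x l + m * p := by
        obtain ⟨i, rfl⟩ : ∃ i : Fin n, l = i.succ := ⟨⟨l.1 - 1, by omega⟩, by ext; simp; omega⟩
        simp at h2 hm
        have h3 := hx i (by rintro rfl; omega)
        set y : Fin (n + 1) → ℕ := fun i => if j.succ ≤ i then x i else x j.succ with hy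
        have h4 := le_add_mul_of_gap (a := y) (p := p) (fun i => by
          simp only [hy]
          by_cases h5 : j.succ ≤ i.castSucc
          · rw [if_pos h5, if_pos (h5.trans i.castSucc_lt_succ.le)]
            have := hx i (by rintro rfl; exact absurd h5 (not_le.2 i.castSucc_lt_succ))
            omega
          · rw [if_neg h5]
            split_ifs with h6
            · have : j = i := by
                rw [Fin.le_def] at h5 h6; ext; simp at h5 h6; omega
              subst this
              omega
            · omega) (i := j.succ) (l := i.castSucc) (by rw [Fin.le_def]; simp; omega)
        simp only [hy, le_refl, if_true] at h4
        rw [if_pos (by rw [Fin.le_def]; simp; omega)] at h4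
        obtain ⟨m', rfl⟩ : ∃ m', m = m' + 1 := ⟨m - 1, by omega⟩
        have h7 : i.castSucc.1 - j.succ.1 = m' := by simp; omega
        rw [h7] at h4
        linarith
      rw [hm, abs_div, Nat.abs_cast, div_mul_eq_mul_div, mul_one_div]
      gcongr
      have := abs_taylor_term_mul_le hQ0 hτ (hd l) hgap hQ1
      calc |d l * τ ^ (m + 1)| * Q ^ (x j.succ + W + 2)
          = |τ| * (|d l * τ ^ m| * Q ^ (x j.succ + W + 2)) := by
            rw [pow_succ, ← mul_assoc, abs_mul]; ring
        _ ≤ |τ| * 1 := by gcongr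
        _ = |τ| := mul_one _
    · simp
  have htri : |τ| * |d j.succ| ≤ |∑ l, c l| + |d j.castSucc| + |∑ l ∈ s, c l| := by
    have h1 : d j.succ * τ = (∑ l, c l) - d j.castSucc - ∑ l ∈ s, c l := by
      rw [hsum c, hjc, hjs]; ring
    rw [← abs_mul, mul_comm, h1]
    exact (abs_sub _ _).trans (add_le_add_left (abs_sub _ _) _)
  have hrem' : |∑ l ∈ s, c l| * Q ^ (x j.succ + v) ≤ |τ| / 4 := by
    rw [le_div_iff₀ (by norm_num)]
    refine le_trans ?_ hrem
    rw [mul_assoc]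
    gcongr
    calc Q ^ (x j.succ + v) * 4 ≤ Q ^ (x j.succ + W) * Q ^ 2 := by
          gcongr
          nlinarith
      _ = _ := by ring
  have hdj := hd j.castSucc
  set X := Q ^ x j.castSucc with hX
  set Y := Q ^ (x j.succ + v) with hY
  have hXp : 0 < X := by positivity
  have hYp : 0 < Y := by positivity
  have hτ0 := abs_nonneg τ
  have k1 : |τ| ≤ |τ| * (|d j.succ| * Y) := by nlinarith
  have k2 : |τ| * (|d j.succ| * Y) ≤ |∑ l, c l| * Y + |d j.castSucc| * Y + |τ| / 4 := by
    have := mul_le_mul_of_nonneg_right htri hYp.le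
    linarith
  have k3 : |τ| * X * (3 / 4) ≤ 2 * Y := by
    have h5 : |τ| * (3 / 4) ≤ |∑ l, c l| * Y + |d j.castSucc| * Y := by linarith
    have h6 := mul_le_mul_of_nonneg_right h5 hXp.le
    have h7 : (|∑ l, c l| * X) * Y ≤ 1 * Y := by gcongr
    have h8 : (|d j.castSucc| * X) * Y ≤ 1 * Y := by gcongr
    linarith
  nlinarith

theorem volume_real_le_of_pairwise {S : Set ℝ} {δ : ℝ} (hδ : 0 ≤ δ)
    (h : ∀ r ∈ S, ∀ s ∈ S, |s - r| ≤ δ) : volume.real S ≤ 2 * δ := by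
  rcases S.eq_empty_or_nonempty with rfl | ⟨r, hr⟩
  · simp [hδ]
  · have h1 : S ⊆ Set.Icc (r - δ) (r + δ) := fun s hs => by
      have := abs_le.1 (h r hr s hs)
      exact ⟨by linarith, by linarith⟩
    refine (measureReal_mono h1 (by simp)).trans ?_
    rw [Real.volume_real_Icc_of_le (by linarith)]
    linarith

theorem exists_volume_inter_Icc_ge {E : Set ℝ} (hE : E ⊆ Set.Icc 0 1) {N : ℕ} (hN : 0 < N) :
    ∃ k : ℕ, volume.real E / N ≤ volume.real (E ∩ Set.Icc ((k : ℝ) / N) ((k + 1) / N)) := by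
  have hN' : (0 : ℝ) < N := by exact_mod_cast hN
  by_contra hcon
  push Not at hcon
  have hsub : E ⊆ ⋃ k ∈ Finset.range N, E ∩ Set.Icc ((k : ℝ) / N) ((k + 1) / N) := by
    intro r hr
    obtain ⟨h0, h1⟩ := hE hr
    have h2 : 0 ≤ r * N := by positivity
    simp only [Set.mem_iUnion, Finset.mem_range]
    rcases h1.eq_or_lt with rfl | h1
    · refine ⟨N - 1, by omega, hr, ?_, ?_⟩
      · rw [div_le_one hN']; exact_mod_cast Nat.sub_le N 1
      · rw [le_div_iff₀ hN', one_mul, Nat.cast_sub (by omega)]; simp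
    · refine ⟨⌊r * N⌋₊, ?_, hr, ?_, ?_⟩
      · rw [Nat.floor_lt h2]; nlinarith
      · rw [div_le_iff₀ hN']; exact Nat.floor_le h2
      · rw [le_div_iff₀ hN']; exact (Nat.lt_floor_add_one _).le
  have h3 : volume.real E ≤ ∑ k ∈ Finset.range N,
      volume.real (E ∩ Set.Icc ((k : ℝ) / N) ((k + 1) / N)) := by
    refine (measureReal_mono hsub ?_).trans (measureReal_biUnion_finset_le _ _)
    refine measure_ne_top_of_subset ?_ volume_Icc_zero_one_ne_top
    exact Set.iUnion₂_subset fun k _ => Set.inter_subset_left.trans hE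
  have h4 := Finset.sum_lt_sum_of_nonempty (s := Finset.range N) ⟨0, by simpa⟩
    fun k _ => hcon k
  rw [Finset.sum_const, Finset.card_range, nsmul_eq_mul, mul_div_cancel₀ _ hN'.ne'] at h4
  linarith

end Pair

section PairLemma

variable {V : Type*} {n : ℕ} {P : V → Fin (n + 1) → ℝ → ℝ} {Q q : ℕ} {F : Finset V}
  {e : (Fin (n + 1) → ℕ) → ℕ} {B : ℝ → V → Prop} {a : Fin (n + 1) → ℕ}

theorem IsUniformClass.exists_large_slice (h : IsUniformClass P Q q F e B) (hF : F.Nonempty) :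
    ∃ w ∈ F, 1 / (Q : ℝ) ^ 3 ≤ volume.real {r | r ∈ Set.Icc (0 : ℝ) 1 ∧ B r w} := by
  refine Finset.exists_le_of_sum_le hF ?_
  rw [Finset.sum_const, nsmul_eq_mul, mul_one_div]
  exact h.large

/-- Pairs of points that share a cell at a time `r` but are far apart in coordinate `j + 1` share
a cell only for a short time. -/
theorem IsTaylorFamily.sliceMeasure_far_le (hP : IsTaylorFamily P) (hQ : 2 ≤ Q)
    {x : Fin (n + 1) → ℕ} {j : Fin n} {p W v : ℕ} (hvW : v ≤ W)
    (hxj : x j.castSucc = x j.succ + p + W)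
    (hx : ∀ i, i ≠ j → x i.castSucc + W + 2 ≤ x i.succ + p)
    (ha : x = a + Pi.single j.castSucc W) {J : Set ℝ}
    (hJ : ∀ r ∈ J, ∀ s ∈ J, |s - r| * (Q : ℝ) ^ p ≤ 1) {r₁ : ℝ} (hr₁ : r₁ ∈ J) (w : V) :
    sliceMeasure J F (fun r w' => cellIdx P Q x r w' = cellIdx P Q x r w ∧
      1 < |P w' j.succ r - P w j.succ r| * (Q : ℝ) ^ (x j.succ + v)) ≤
      boxCard P Q F 3 a r₁ w * (6 * (Q : ℝ) ^ v / (Q : ℝ) ^ (p + W)) := by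
  have hQ1 : (2 : ℝ) ≤ Q := by exact_mod_cast hQ
  have hQ0 : (0 : ℝ) < Q := by linarith
  have hgap : ∀ i : Fin n, a i.castSucc ≤ a i.succ + p := by
    intro i
    have h1 : x i.castSucc = a i.castSucc +
        (Pi.single j.castSucc W : Fin (n + 1) → ℕ) i.castSucc := by
      rw [ha]; rfl
    have h2 : x i.succ = a i.succ + (Pi.single j.castSucc W : Fin (n + 1) → ℕ) i.succ := by
      rw [ha]; rfl
    have h3 : (Pi.single j.castSucc W : Fin (n + 1) → ℕ) i.succ ≤ W := by
      rw [Pi.single_apply]; split_ifs <;> simp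
    by_cases hij : i = j
    · subst hij
      rw [Pi.single_eq_same] at h1
      rw [Pi.single_eq_of_ne i.castSucc_lt_succ.ne'] at h2
      omega
    · have := hx i hij
      omega
  unfold sliceMeasure
  rw [boxCard, Finset.card_filter, Nat.cast_sum, Finset.sum_mul]
  refine Finset.sum_le_sum fun w' _ => ?_
  rcases Set.eq_empty_or_nonempty {r | r ∈ J ∧ cellIdx P Q x r w' = cellIdx P Q x r w ∧
      1 < |P w' j.succ r - P w j.succ r| * (Q : ℝ) ^ (x j.succ + v)} with h0 | ⟨r, hr, hc, -⟩
  · rw [h0, measureReal_empty]; positivity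
  · have hd : ∀ l, |P w' l r - P w l r| * (Q : ℝ) ^ a l ≤ 1 := fun l => by
      refine le_trans ?_ (abs_sub_mul_lt_one_of_cellIdx_eq hc l).le
      gcongr
      · linarith
      · rw [ha]; exact Nat.le_add_right _ _
    rw [if_pos fun i => by
      rw [hP.taylor w w' i r r₁]
      exact_mod_cast abs_taylor_mul_le (by linarith) hgap (hJ r hr r₁ hr₁) hd i]
    have hpos : (0 : ℝ) < (Q : ℝ) ^ (p + W) := by positivity
    refine (volume_real_le_of_pairwise (δ := 3 * (Q : ℝ) ^ v / (Q : ℝ) ^ (p + W)) (by positivity)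
      ?_).trans (le_of_eq ?_)
    · rintro r ⟨hr, hc, hfar⟩ s ⟨hs, hc', -⟩
      have := abs_mul_le_of_taylor hQ1 (d := fun l => P w' l r - P w l r) hvW hx (hJ r hr s hs)
        (fun l => (abs_sub_mul_lt_one_of_cellIdx_eq hc l).le) hfar (by
          rw [← hP.taylor w w']
          exact (abs_sub_mul_lt_one_of_cellIdx_eq hc' _).le)
      rw [le_div_iff₀ hpos]
      have hpos' : (0 : ℝ) < (Q : ℝ) ^ x j.succ := by positivity
      refine le_of_mul_le_mul_right ?_ hpos'
      calc |s - r| * (Q : ℝ) ^ (p + W) * (Q : ℝ) ^ x j.succ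
          = |s - r| * (Q : ℝ) ^ x j.castSucc := by rw [hxj]; ring
        _ ≤ 3 * (Q : ℝ) ^ (x j.succ + v) := this
        _ = _ := by ring
    · push_cast; ring

theorem IsUniformClass.pair (h : IsUniformClass P Q q F e B) (hP : IsTaylorFamily P) (hQ : 16 ≤ Q)
    (hF : F.Nonempty) {x : Fin (n + 1) → ℕ} {j : Fin n} {W v : ℕ}
    (ha : x = a + Pi.single j.castSucc W)
    (hbox : ∀ i, (x + Pi.single j.succ v : Fin (n + 1) → ℕ) i ≤ n * q)
    (hxj : x j.succ + W ≤ x j.castSucc)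
    (hx : ∀ i, i ≠ j → x i.castSucc + 2 * W + 2 + x j.succ ≤ x j.castSucc + x i.succ) :
    e x ≤ e (x + Pi.single j.succ v) + 8 ∨ e x + W ≤ e a + v + 8 := by
  have hQ1 : (16 : ℝ) ≤ Q := by exact_mod_cast hQ
  have hQ0 : (0 : ℝ) < Q := by linarith
  have hax : a ≤ x := by rw [ha]; exact le_self_add
  have hxv : x ≤ x + Pi.single j.succ v := le_self_add
  have hxbox : ∀ i, x i ≤ n * q := fun i => (hxv i).trans (hbox i)
  have habox : ∀ i, a i ≤ n * q := fun i => (hax i).trans (hxbox i)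
  have : DecidableEq V := Classical.decEq V
  rcases lt_or_ge W v with hvW | hvW
  · right
    have := h.le_of_le (by omega) hF hax hxbox
    omega
  refine or_iff_not_imp_left.2 fun hcon => ?_
  obtain ⟨p, hp⟩ := Nat.exists_eq_add_of_le hxj
  obtain ⟨w, hw, hvol⟩ := h.exists_large_slice hF
  obtain ⟨k, hk⟩ := exists_volume_inter_Icc_ge (E := {r | r ∈ Set.Icc (0 : ℝ) 1 ∧ B r w})
    (fun r hr => hr.1) (N := Q ^ p) (by positivity)
  set J := {r | r ∈ Set.Icc (0 : ℝ) 1 ∧ B r w} ∩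
    Set.Icc ((k : ℝ) / (Q ^ p : ℕ)) ((k + 1) / (Q ^ p : ℕ)) with hJd
  have hJB : ∀ r ∈ J, B r w := fun r hr => hr.1.2
  have hJmeas : MeasurableSet J :=
    (measurableSet_Icc.inter (h.meas w hw)).inter measurableSet_Icc
  have hJtop : volume J ≠ ⊤ :=
    measure_ne_top_of_subset (fun r hr => hr.1.1) volume_Icc_zero_one_ne_top
  have hJdist : ∀ r ∈ J, ∀ s ∈ J, |s - r| * (Q : ℝ) ^ p ≤ 1 := by
    rintro r ⟨-, h1, h2⟩ s ⟨-, h3, h4⟩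
    push_cast at h1 h2 h3 h4
    rw [add_div] at h2 h4
    rw [← le_div_iff₀ (by positivity), abs_le]
    constructor <;> linarith
  have hJvol : 1 / (Q : ℝ) ^ 3 / (Q : ℝ) ^ p ≤ volume.real J := by
    refine le_trans ?_ hk
    push_cast
    gcongr
  have hJpos : 0 < volume.real J := lt_of_lt_of_le (by positivity) hJvol
  obtain ⟨r₁, hr₁⟩ : J.Nonempty := by
    rw [Set.nonempty_iff_ne_empty]
    intro h0
    rw [h0, measureReal_empty] at hJpos
    exact hJpos.false
  have hupper := hP.sliceMeasure_far_le (F := F) (by omega : 2 ≤ Q) hvW (p := p) (by omega)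
    (fun i hi => by have := hx i hi; omega) ha hJdist hr₁ w
  have hlower := le_sliceMeasure (F := F) (b := (Q : ℝ) ^ e x / 2) hJmeas hJtop
    (S := fun r w' => cellIdx P Q x r w' = cellIdx P Q x r w ∧
      1 < |P w' j.succ r - P w j.succ r| * (Q : ℝ) ^ (x j.succ + v)) (fun w' _ => by
        have h1 := hP.cont w' j.succ
        have h2 := hP.cont w j.succ
        exact (measurableSet_eq_fun (hP.measurable_cellIdx x w')
          (hP.measurable_cellIdx x w)).inter (measurableSet_lt measurable_const
            (by fun_prop : Continuous fun r => |P w' j.succ r - P w j.succ r| *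
              (Q : ℝ) ^ (x j.succ + v)).measurable))
    fun r hr => by
      have hB := hJB r hr
      have h1 := h.pow_le_cellCard hB hxbox
      have h2 := h.boxCard_le r w hB _ hbox
      have h3 := h.cellCard_lt_pow (by omega) hB hbox
      have h4 : cellCard P Q F x r w ≤ (F.filter fun w' => cellIdx P Q x r w' = cellIdx P Q x r w ∧
          1 < |P w' j.succ r - P w j.succ r| * (Q : ℝ) ^ (x j.succ + v)).card +
          boxCard P Q F 3 (x + Pi.single j.succ v) r w := by
        refine (Finset.card_le_card ?_).trans (Finset.card_union_le _ _)
        intro w' hw'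
        obtain ⟨hw'F, hc⟩ := Finset.mem_filter.1 hw'
        rw [Finset.mem_union, Finset.mem_filter, Finset.mem_filter]
        by_cases hfar : 1 < |P w' j.succ r - P w j.succ r| * (Q : ℝ) ^ (x j.succ + v)
        · exact Or.inl ⟨hw'F, hc, hfar⟩
        · refine Or.inr ⟨hw'F, fun i => ?_⟩
          by_cases hi : i = j.succ
          · subst hi
            rw [Pi.add_apply, Pi.single_eq_same]
            push_cast
            linarith
          · rw [Pi.add_apply, Pi.single_eq_of_ne hi, add_zero]
            push_cast
            linarith [abs_sub_mul_lt_one_of_cellIdx_eq hc i]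
      have h5 : 2 * boxCard P Q F 3 (x + Pi.single j.succ v) r w ≤ Q ^ e x := by
        have h6 : Q ^ (e (x + Pi.single j.succ v) + 5) ≤ Q ^ e x :=
          Nat.pow_le_pow_right (by omega) (by omega)
        refine le_trans ?_ h6
        calc 2 * boxCard P Q F 3 (x + Pi.single j.succ v) r w
            ≤ Q * (Q ^ 3 * Q ^ (e (x + Pi.single j.succ v) + 1)) := by
              gcongr
              · omega
              · exact h2.trans (by gcongr)
          _ = _ := by ring
      have h7 : (Q : ℝ) ^ e x ≤ cellCard P Q F x r w := by exact_mod_cast h1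
      have h8 : 2 * (boxCard P Q F 3 (x + Pi.single j.succ v) r w : ℝ) ≤ (Q : ℝ) ^ e x := by
        exact_mod_cast h5
      have h9 : (cellCard P Q F x r w : ℝ) ≤ ((F.filter fun w' => cellIdx P Q x r w' =
          cellIdx P Q x r w ∧
          1 < |P w' j.succ r - P w j.succ r| * (Q : ℝ) ^ (x j.succ + v)).card : ℝ) +
          boxCard P Q F 3 (x + Pi.single j.succ v) r w := by
        exact_mod_cast h4
      linarith
  have hbox1 : (boxCard P Q F 3 a r₁ w : ℝ) ≤ (Q : ℝ) ^ 3 * (Q : ℝ) ^ (e a + 1) := by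
    have h1 := h.boxCard_le r₁ w (hJB r₁ hr₁) a habox
    have h2 := h.cellCard_lt_pow (by omega) (hJB r₁ hr₁) habox
    exact_mod_cast h1.trans (Nat.mul_le_mul_left _ h2.le)
  have hfin : (Q : ℝ) ^ e x / 2 * (1 / (Q : ℝ) ^ 3 / (Q : ℝ) ^ p) ≤
      (Q : ℝ) ^ 3 * (Q : ℝ) ^ (e a + 1) * (6 * (Q : ℝ) ^ v / (Q : ℝ) ^ (p + W)) := by
    refine le_trans (by gcongr) (hlower.trans (hupper.trans ?_))
    gcongr
  have hfin2 : (Q : ℝ) ^ (e x + W) ≤ 12 * (Q : ℝ) ^ (e a + v + 7) := by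
    have h1 := mul_le_mul_of_nonneg_left hfin
      (by positivity : (0 : ℝ) ≤ 2 * (Q : ℝ) ^ 3 * (Q : ℝ) ^ (p + W))
    have e1 : 2 * (Q : ℝ) ^ 3 * (Q : ℝ) ^ (p + W) *
        ((Q : ℝ) ^ e x / 2 * (1 / (Q : ℝ) ^ 3 / (Q : ℝ) ^ p)) = (Q : ℝ) ^ (e x + W) := by
      rw [pow_add, pow_add]; field_simp
    have e2 : 2 * (Q : ℝ) ^ 3 * (Q : ℝ) ^ (p + W) *
        ((Q : ℝ) ^ 3 * (Q : ℝ) ^ (e a + 1) * (6 * (Q : ℝ) ^ v / (Q : ℝ) ^ (p + W))) =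
        12 * (Q : ℝ) ^ (e a + v + 7) := by
      field_simp; ring
    rwa [e1, e2] at h1
  have hfin3 : (Q : ℝ) ^ (e x + W) < (Q : ℝ) ^ (e a + v + 8) := by
    refine hfin2.trans_lt ?_
    rw [pow_succ _ (e a + v + 7), mul_comm]
    have : (0 : ℝ) < (Q : ℝ) ^ (e a + v + 7) := by positivity
    nlinarith
  have := (pow_lt_pow_iff_right₀ (by linarith : (1 : ℝ) < Q)).1 hfin3
  omega

end PairLemma

section Assembly

variable {V : Type*} {n : ℕ} {P : V → Fin (n + 1) → ℝ → ℝ} {Q q : ℕ} {F : Finset V}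
  {e : (Fin (n + 1) → ℕ) → ℕ} {B : ℝ → V → Prop} {T : Fin (n + 1) → ℕ}

theorem IsUniformClass.isDiscreteAdmissible (h : IsUniformClass P Q q F e B)
    (hP : IsTaylorFamily P) (hQ : 16 ≤ Q) (hF : F.Nonempty) {N₀ α : ℝ} (hN₀ : 0 < N₀)
    (hα : ∀ s : ℕ, s ≤ n * q → ∀ r ∈ Set.Icc (0 : ℝ) 1, ∀ w ∈ F,
      (boxCard P Q F 1 (fun _ => s) r w : ℝ) ≤ N₀ * (Q : ℝ) ^ (n + 1) * (Q : ℝ) ^ (-(α * s))) :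
    IsDiscreteAdmissible n q α (n + 10) fun a => Real.logb Q N₀ - e a := by
  have hQ1 : (1 : ℝ) < Q := by
    have : (16 : ℝ) ≤ Q := by exact_mod_cast hQ
    linarith
  have hn : (0 : ℝ) ≤ n := by positivity
  refine ⟨fun a b hab hb => ?_, fun a b hab hb => ?_, fun a b ha hb => ?_, ?_, fun s hs => ?_⟩
  · have : (e b : ℝ) ≤ e a := by exact_mod_cast h.le_of_le (by omega) hF hab hb
    linarith
  · have h1 : (e a : ℝ) ≤ e b + (∑ i, (b i - a i) : ℕ) + 3 := by
      exact_mod_cast h.le_add_of_le (by omega) hF hab hb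
    rw [Nat.cast_sum, Finset.sum_congr rfl fun i _ => Nat.cast_sub (hab i)] at h1
    linarith
  · have h1 : (e a : ℝ) + e b ≤ e (a ⊔ b) + e (a ⊓ b) + 7 := by
      exact_mod_cast h.add_le_sup_add_inf hP (by omega) hF ha hb
    linarith
  · intro a x j W v _ _ ha hbox hxj hx
    rcases h.pair hP hQ hF ha hbox hxj hx with h1 | h1
    · left
      have : (e x : ℝ) ≤ e (x + Pi.single j.succ v) + 8 := by exact_mod_cast h1
      linarith
    · right
      have : (e x : ℝ) + W ≤ e a + v + 8 := by exact_mod_cast h1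
      linarith
  · obtain ⟨r, w, hB⟩ := h.exists_mem (by omega) hF
    obtain ⟨hr, hw⟩ := h.mem r w hB
    have h1 : ((Q ^ e (fun _ => s) : ℕ) : ℝ) ≤ _ := (Nat.cast_le.2 ((h.pow_le_cellCard hB
      fun _ => hs).trans (cellCard_le_boxCard le_rfl))).trans (hα s hs r hr w hw)
    have hQ0 : (0 : ℝ) < Q := by linarith
    have h2 := Real.logb_le_logb_of_le hQ1 (by positivity) h1
    rw [Nat.cast_pow, Real.logb_mul (by positivity) (by positivity),
      Real.logb_mul (by positivity) (by positivity), Real.logb_rpow hQ0 hQ1.ne',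
      Real.logb_pow, Real.logb_pow, Real.logb_self_eq_one hQ1] at h2
    push_cast at h2
    linarith

theorem IsUniformClass.sub_le_logb (h : IsUniformClass P Q q F e B) (hQ : 2 ≤ Q) (hF : F.Nonempty)
    {N₀ θ : ℝ} (hN₀ : 0 < N₀) (hθ : 0 < θ) (hT : ∀ i, T i ≤ n * q)
    (hB : ∀ r w, B r w → θ < boxCard P Q F 2 T r w) :
    Real.logb Q N₀ - e T ≤ Real.logb Q (N₀ / θ) + 4 := by
  have hQ1 : (1 : ℝ) < Q := by exact_mod_cast hQ
  obtain ⟨r, w, hrw⟩ := h.exists_mem hQ hF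
  have h1 : boxCard P Q F 2 T r w ≤ Q ^ (e T + 4) := by
    calc boxCard P Q F 2 T r w ≤ boxCard P Q F 3 T r w := boxCard_mono (by norm_num)
      _ ≤ Q ^ 3 * cellCard P Q F T r w := h.boxCard_le r w hrw T hT
      _ ≤ Q ^ 3 * Q ^ (e T + 1) := by
        gcongr; exact (h.cellCard_lt_pow hQ hrw hT).le
      _ = _ := by ring
  have h2 : θ ≤ (Q : ℝ) ^ (e T + 4) := (hB r w hrw).le.trans (by exact_mod_cast h1)
  have h3 := Real.logb_le_logb_of_le hQ1 hθ h2
  rw [Real.logb_pow, Real.logb_self_eq_one hQ1] at h3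
  rw [Real.logb_div hN₀.ne' hθ.ne']
  push_cast at h3
  linarith

theorem natLog_mem_Icc {Q N k m : ℕ} {N₀ : ℝ} (hQ : 2 ≤ Q) (hN : N ≠ 0)
    (h1 : N₀ ≤ (Q : ℝ) ^ k * N) (h2 : (N : ℝ) ≤ N₀ * (Q : ℝ) ^ m) :
    Nat.log Q N ∈ Finset.Icc (Nat.log Q ⌊N₀⌋₊ - k) (Nat.log Q ⌊N₀⌋₊ + m) := by
  have hQ0 : (0 : ℝ) < Q := by positivity
  set E := Nat.log Q ⌊N₀⌋₊ with hE
  rw [Finset.mem_Icc]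
  constructor
  · have h3 : ⌊N₀⌋₊ ≤ Q ^ k * N := by
      refine Nat.floor_le_of_le ?_
      exact_mod_cast h1
    have h4 := Nat.log_mono_right (b := Q) h3
    have h5 : Nat.log Q (Q ^ k * N) < k + Nat.log Q N + 1 := by
      refine Nat.log_lt_of_lt_pow (by positivity) ?_
      rw [add_assoc, pow_add]
      exact Nat.mul_lt_mul_of_pos_left (Nat.lt_pow_succ_log_self hQ N) (by positivity)
    omega
  · have h3 : N < Q ^ (E + m + 1) := by
      have h4 : N₀ < ⌊N₀⌋₊ + 1 := Nat.lt_floor_add_one _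
      have h5 : ⌊N₀⌋₊ + 1 ≤ Q ^ (E + 1) := Nat.lt_pow_succ_log_self hQ ⌊N₀⌋₊
      have h6 : N₀ < (Q : ℝ) ^ (E + 1) := h4.trans_le (by exact_mod_cast h5)
      have h7 : (N : ℝ) < (Q : ℝ) ^ (E + m + 1) := by
        refine h2.trans_lt ?_
        calc N₀ * (Q : ℝ) ^ m < (Q : ℝ) ^ (E + 1) * (Q : ℝ) ^ m := by gcongr
          _ = _ := by ring
      exact_mod_cast h7
    have := Nat.log_lt_of_lt_pow hN h3
    omega

theorem exists_isUniformClass (n q k : ℕ) : ∃ Q₀ : ℕ, ∀ {V : Type*}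
    {P : V → Fin (n + 1) → ℝ → ℝ} {Q : ℕ} {F : Finset V} {T : Fin (n + 1) → ℕ} {N₀ θ : ℝ},
    Q₀ ≤ Q → IsTaylorFamily P → F.Nonempty → (∀ i, T i ≤ n * q) → N₀ ≤ θ * (Q : ℝ) ^ k →
    (∀ r ∈ Set.Icc (0 : ℝ) 1, ∀ w ∈ F,
      (boxCard P Q F 1 (fun _ => 0) r w : ℝ) ≤ N₀ * (Q : ℝ) ^ (n + 1)) →
    (F.card : ℝ) / Q ^ 2 <
      sliceMeasure (Set.Icc 0 1) F (fun r w => θ < boxCard P Q F 2 T r w) →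
    ∃ e B, IsUniformClass P Q q F e B ∧ ∀ r w, B r w → θ < boxCard P Q F 2 T r w := by
  set box : Finset (Fin (n + 1) → ℕ) := Fintype.piFinset fun _ => Finset.range (n * q + 1) with hbox
  have hmem : ∀ a, a ∈ box ↔ ∀ i, a i ≤ n * q := by
    intro a
    simp [hbox, Fintype.mem_piFinset]
  obtain ⟨pairs, hpairs, hpairs_card⟩ : ∃ pairs : Finset ((Fin (n + 1) → ℕ) × (Fin (n + 1) → ℕ)),
      (∀ c, c ∈ pairs ↔ (c.1 ∈ box ∧ c.2 ∈ box) ∧ c.1 ≤ c.2) ∧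
        pairs.card ≤ box.card * box.card := by
    classical
    exact ⟨(box ×ˢ box).filter fun c => c.1 ≤ c.2, by simp,
      (Finset.card_filter_le _ _).trans (Finset.card_product _ _).le⟩
  set m := box.card with hm
  set k' := k + 6 + (n + 1) * (n * q) with hk'
  set L := (k' + n + 2) ^ m with hL
  refine ⟨2 + 4 * 9 ^ (n + 1) * m + 4 * m * m + 2 * L, ?_⟩
  intro V P Q F T N₀ θ hQ₀ hP hF hT hNθ hfrost hbad
  have hQ : 2 ≤ Q := by omega
  have hQ0 : (0 : ℝ) < Q := by positivity
  have hFc : (0 : ℝ) < F.card := by exact_mod_cast hF.card_pos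
  have hD1 : ((4 * 9 ^ (n + 1) * m : ℕ) : ℝ) ≤ Q := by exact_mod_cast (by omega)
  have hD2 : ((4 * m * m : ℕ) : ℝ) ≤ Q := by exact_mod_cast (by omega)
  have hD3 : ((2 * L : ℕ) : ℝ) ≤ Q := by exact_mod_cast (by omega)
  push_cast at hD1 hD2 hD3
  set I : Set ℝ := Set.Icc 0 1 with hI
  set Bad : ℝ → V → Prop := fun r w => θ < boxCard P Q F 2 T r w with hBad
  set X₁ : ℝ → V → Prop := fun r w => ∃ a ∈ box, Q ^ 3 * cellCard P Q F a r w <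
    boxCard P Q F 3 a r w with hX₁
  set X₂ : ℝ → V → Prop := fun r w => ∃ c ∈ pairs,
    Q ^ ((∑ i, (c.2 i - c.1 i)) + 3) * cellCard P Q F c.2 r w < cellCard P Q F c.1 r w with hX₂
  have hItop : volume I ≠ ⊤ := volume_Icc_zero_one_ne_top
  have h1 : sliceMeasure I F X₁ ≤ F.card / Q ^ 2 / 4 := by
    refine (sliceMeasure_le_sum hItop F X₁ box _ fun r _ w _ h => h).trans ?_
    refine (Finset.sum_le_sum fun a _ => hP.sliceMeasure_boxCard_le (by omega) 3 3 a).trans ?_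
    rw [Finset.sum_const, nsmul_eq_mul, ← hm]
    norm_num
    rw [div_div, ← mul_div_assoc, div_le_div_iff₀ (by positivity) (by positivity)]
    have := mul_le_mul_of_nonneg_right hD1 (by positivity : (0 : ℝ) ≤ F.card * Q ^ 2)
    linarith
  have h2 : sliceMeasure I F X₂ ≤ F.card / Q ^ 2 / 4 := by
    refine (sliceMeasure_le_sum hItop F X₂ _ _ fun r _ w _ h => h).trans ?_
    refine (Finset.sum_le_sum fun c hc => hP.sliceMeasure_cellCard_le (by omega) 3
      ((hpairs c).1 hc).2).trans ?_
    rw [Finset.sum_const, nsmul_eq_mul]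
    have hc : (pairs.card : ℝ) ≤ m * m := by
      exact_mod_cast hpairs_card
    refine (mul_le_mul_of_nonneg_right hc (by positivity)).trans ?_
    rw [div_div, ← mul_div_assoc, div_le_div_iff₀ (by positivity) (by positivity)]
    have := mul_le_mul_of_nonneg_right hD2 (by positivity : (0 : ℝ) ≤ F.card * Q ^ 2)
    linarith
  have h3 := sliceMeasure_le_add hItop F Bad X₁
  have h4 := sliceMeasure_le_add hItop F (fun r w => Bad r w ∧ ¬ X₁ r w) X₂
  set E := Nat.log Q ⌊N₀⌋₊ with hE
  set S : Finset (box → ℕ) := Fintype.piFinset fun _ => Finset.Icc (E - k') (E + (n + 1)) with hS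
  have hScard : S.card ≤ L := by
    rw [hS, Fintype.card_piFinset, Finset.prod_const, Finset.card_univ, Fintype.card_coe,
      Nat.card_Icc]
    exact Nat.pow_le_pow_left (by omega) _
  set Good : (box → ℕ) → ℝ → V → Prop := fun c r w => (r ∈ I ∧ w ∈ F) ∧
    ((Bad r w ∧ ¬ X₁ r w) ∧ ¬ X₂ r w) ∧ ∀ a : box, Nat.log Q (cellCard P Q F a r w) = c a with hGood
  have hlog : ∀ r ∈ I, ∀ w ∈ F, ((Bad r w ∧ ¬ X₁ r w) ∧ ¬ X₂ r w) → ∃ c ∈ S, Good c r w := by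
    rintro r hr w hw hgood
    refine ⟨fun a => Nat.log Q (cellCard P Q F a r w), ?_, ⟨hr, hw⟩, hgood, fun _ => rfl⟩
    obtain ⟨⟨hb, hx1⟩, hx2⟩ := hgood
    rw [hS, Fintype.mem_piFinset]
    rintro ⟨a, ha⟩
    have ha' := (hmem a).1 ha
    refine natLog_mem_Icc hQ (cellCard_pos hw).ne' ?_ ?_
    · have e1 : boxCard P Q F 3 T r w ≤ Q ^ 3 * cellCard P Q F T r w := by
        by_contra hcon
        exact hx1 ⟨T, (hmem T).2 hT, not_le.1 hcon⟩
      have e2 : cellCard P Q F T r w ≤ Q ^ ((∑ i, (n * q - T i)) + 3) *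
          cellCard P Q F (fun _ => n * q) r w := by
        by_contra hcon
        exact hx2 ⟨(T, fun _ => n * q), (hpairs _).2
          ⟨⟨(hmem T).2 hT, (hmem _).2 fun _ => le_rfl⟩, hT⟩, not_le.1 hcon⟩
      have e3 : cellCard P Q F (fun _ => n * q) r w ≤ cellCard P Q F a r w :=
        cellCard_anti (by omega) ha'
      have e4 : ∑ i, (n * q - T i) ≤ (n + 1) * (n * q) := by
        refine (Finset.sum_le_sum fun i _ => Nat.sub_le _ _).trans ?_
        simp
      have e5 : boxCard P Q F 2 T r w * Q ^ k ≤ Q ^ k' * cellCard P Q F a r w := by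
        calc boxCard P Q F 2 T r w * Q ^ k ≤
            (Q ^ 3 * (Q ^ ((n + 1) * (n * q) + 3) * cellCard P Q F a r w)) * Q ^ k := by
              gcongr
              refine (boxCard_mono (by norm_num)).trans (e1.trans ?_)
              gcongr
              refine e2.trans ?_
              gcongr
              omega
          _ = _ := by rw [hk']; ring
      calc N₀ ≤ θ * (Q : ℝ) ^ k := hNθ
        _ ≤ boxCard P Q F 2 T r w * (Q : ℝ) ^ k := by gcongr
        _ ≤ _ := by exact_mod_cast e5
    · refine le_trans ?_ (hfrost r hr w hw)
      have e1 : cellCard P Q F a r w ≤ cellCard P Q F (fun _ => 0) r w :=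
        cellCard_anti (by omega) fun i => Nat.zero_le _
      exact_mod_cast e1.trans (cellCard_le_boxCard le_rfl)
  have h5 := sliceMeasure_le_sum hItop F (fun r w => (Bad r w ∧ ¬ X₁ r w) ∧ ¬ X₂ r w) S Good hlog
  have h6 : (F.card : ℝ) / Q ^ 2 / 2 < ∑ c ∈ S, sliceMeasure I F (Good c) := by linarith
  obtain ⟨c, hc, hlarge⟩ : ∃ c ∈ S, (F.card : ℝ) / Q ^ 3 < sliceMeasure I F (Good c) := by
    refine Finset.exists_lt_of_sum_lt (lt_of_le_of_lt ?_ h6)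
    rw [Finset.sum_const, nsmul_eq_mul]
    have hSc : (S.card : ℝ) ≤ L := by exact_mod_cast hScard
    refine (mul_le_mul_of_nonneg_right hSc (by positivity)).trans ?_
    rw [div_div, ← mul_div_assoc, div_le_div_iff₀ (by positivity) (by positivity)]
    have := mul_le_mul_of_nonneg_right hD3 (by positivity : (0 : ℝ) ≤ F.card * Q ^ 2)
    linarith
  refine ⟨fun a => if ha : a ∈ box then c ⟨a, ha⟩ else 0, Good c, ⟨fun r w h => h.1, ?_, hlarge.le,
    ?_, ?_, ?_⟩, fun r w h => h.2.1.1.1⟩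
  · intro w hw
    have m0 : MeasurableSet {r | r ∈ I ∧ w ∈ F} := measurableSet_Icc.inter (MeasurableSet.const _)
    have mB : MeasurableSet {r | Bad r w} :=
      measurableSet_lt measurable_const (measurable_from_nat.comp (hP.measurable_boxCard 2 T w))
    have m1 : MeasurableSet {r | X₁ r w} := by
      have : {r | X₁ r w} = ⋃ a ∈ box, {r | Q ^ 3 * cellCard P Q F a r w <
          boxCard P Q F 3 a r w} := by
        ext r; simp [hX₁]
      rw [this]
      exact Finset.measurableSet_biUnion _ fun a _ => measurableSet_lt
        ((hP.measurable_cellCard a w).const_mul _) (hP.measurable_boxCard 3 a w)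
    have m2 : MeasurableSet {r | X₂ r w} := by
      have : {r | X₂ r w} = ⋃ c ∈ pairs,
          {r | Q ^ ((∑ i, (c.2 i - c.1 i)) + 3) * cellCard P Q F c.2 r w <
            cellCard P Q F c.1 r w} := by
        ext r; simp [hX₂]
      rw [this]
      exact Finset.measurableSet_biUnion _ fun c _ => measurableSet_lt
        ((hP.measurable_cellCard c.2 w).const_mul _) (hP.measurable_cellCard c.1 w)
    have m3 : MeasurableSet {r | ∀ a : box, Nat.log Q (cellCard P Q F a r w) = c a} := by
      have : {r | ∀ a : box, Nat.log Q (cellCard P Q F a r w) = c a} =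
          ⋂ a : box, {r | Nat.log Q (cellCard P Q F a r w) = c a} := by
        ext r; simp
      rw [this]
      exact MeasurableSet.iInter fun a => measurableSet_eq_fun
        ((measurable_from_nat (f := Nat.log Q)).comp (hP.measurable_cellCard a.1 w))
        measurable_const
    exact m0.inter (((mB.inter m1.compl).inter m2.compl).inter m3)
  · rintro r w h a ha
    have := (hmem a).2 ha
    simp only [dif_pos this]
    exact h.2.2 ⟨a, this⟩
  · rintro r w h a ha
    by_contra hcon
    exact h.2.1.1.2 ⟨a, (hmem a).2 ha, not_le.1 hcon⟩
  · rintro r w h a b hab hb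
    by_contra hcon
    exact h.2.1.2 ⟨(a, b), (hpairs _).2
      ⟨⟨(hmem a).2 fun i => (hab i).trans (hb i), (hmem b).2 hb⟩, hab⟩, not_le.1 hcon⟩

end Assembly

section Exceptional

theorem exists_sliceMeasure_boxCard_le (n : ℕ) (hn : 1 ≤ n) {ε : ℝ} (hε : 0 < ε) :
    ∃ q Q₀ : ℕ, 0 < q ∧ 16 ≤ Q₀ ∧ ∀ {V : Type} {P : V → Fin (n + 1) → ℝ → ℝ} {Q : ℕ}
      {F : Finset V} {N₀ θ α : ℝ}, Q₀ ≤ Q → IsTaylorFamily P → F.Nonempty → 0 < N₀ → 0 < θ →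
      0 ≤ α → α < n + 1 →
      (∀ s : ℕ, s ≤ n * q → ∀ r ∈ Set.Icc (0 : ℝ) 1, ∀ w ∈ F,
        (boxCard P Q F 1 (fun _ => s) r w : ℝ) ≤
          N₀ * (Q : ℝ) ^ (n + 1) * (Q : ℝ) ^ (-(α * s))) →
      N₀ / θ ≤ (Q : ℝ) ^ (q * (n * α - ⌊α⌋₊ * (⌊α⌋₊ + 1) / 2 - ε)) →
      sliceMeasure (Set.Icc 0 1) F
        (fun r w => θ < boxCard P Q F 2 (fun i => (n - i) * q) r w) ≤ F.card / Q ^ 2 := by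
  choose q₀ hq₀ using fun k : ℕ =>
    IsDiscreteAdmissible.exists_le_decreasing n k hn (n + 10) (half_pos hε)
  obtain ⟨m, hm⟩ := exists_nat_gt (8 / ε)
  set q := (Finset.range (n + 1)).sup q₀ + m + 1 with hq
  have hqε : 8 < q * ε := by
    rw [div_lt_iff₀ hε] at hm
    refine hm.trans_le (mul_le_mul_of_nonneg_right ?_ hε.le)
    exact_mod_cast (by omega)
  obtain ⟨Q₁, hQ₁⟩ := exists_isUniformClass n q (q * n * (n + 1))
  refine ⟨q, Q₁ + 16, by omega, by omega, ?_⟩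
  intro V P Q F N₀ θ α hQ hP hF hN₀ hθ hα hαn hfrost hle
  have hQ1 : (1 : ℝ) < Q := by exact_mod_cast (by omega : 1 < Q)
  have hk : ⌊α⌋₊ < n + 1 := by
    rw [Nat.floor_lt hα]
    exact_mod_cast hαn
  have hT : ∀ i : Fin (n + 1), (n - i.1) * q ≤ n * q := fun i =>
    Nat.mul_le_mul_right _ (Nat.sub_le _ _)
  by_contra! hbad
  have hle' : N₀ ≤ θ * (Q : ℝ) ^ (q * n * (n + 1)) := by
    rw [div_le_iff₀ hθ] at hle
    refine hle.trans ?_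
    rw [mul_comm, ← Real.rpow_natCast]
    refine mul_le_mul_of_nonneg_left (Real.rpow_le_rpow_of_exponent_le hQ1.le ?_) hθ.le
    push_cast
    rw [mul_assoc]
    refine mul_le_mul_of_nonneg_left ?_ (Nat.cast_nonneg _)
    have h1 : (n : ℝ) * α ≤ n * (n + 1) := by gcongr
    have h2 : (0 : ℝ) ≤ ⌊α⌋₊ * (⌊α⌋₊ + 1) / 2 := by positivity
    linarith
  obtain ⟨e, B, hB, hBad⟩ := hQ₁ (by omega) hP hF hT hle'
    (fun r hr w hw => by simpa using hfrost 0 (Nat.zero_le _) r hr w hw) hbad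
  have h1 := hq₀ ⌊α⌋₊ q
    ((Finset.le_sup (f := q₀) (Finset.mem_range.2 hk)).trans (by omega)) α _ hα
    (Nat.lt_floor_add_one α).le (hB.isDiscreteAdmissible hP (by omega) hF hN₀ hfrost)
  have h2 := hB.sub_le_logb (by omega) hF hN₀ hθ hT hBad
  have h3 := (Real.logb_le_iff_le_rpow hQ1 (div_pos hN₀ hθ)).2 hle
  linarith

theorem IsTaylorFamily.exists_exceptional {V : Type*} {n : ℕ} {P : V → Fin (n + 1) → ℝ → ℝ}
    (hP : IsTaylorFamily P) {Q K : ℕ} (hQ : 0 < Q) {F : Finset V} (hF : F.Nonempty)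
    {T : Fin (n + 1) → ℕ} {θ : ℝ}
    (h : sliceMeasure (Set.Icc 0 1) F (fun r w => θ < boxCard P Q F K T r w) ≤ F.card / Q ^ 2) :
    ∃ E : Set ℝ, E ⊆ Set.Icc 0 1 ∧ volume E ≤ ENNReal.ofReal (1 / Q) ∧
      ∀ r ∈ Set.Icc (0 : ℝ) 1 \ E,
        ((F.filter fun w => θ < boxCard P Q F K T r w).card : ℝ) ≤ F.card / Q := by
  have hQ0 : (0 : ℝ) < Q := by exact_mod_cast hQ
  have hFc : (0 : ℝ) < F.card := by exact_mod_cast hF.card_pos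
  have hS : ∀ w ∈ F, MeasurableSet {r | θ < boxCard P Q F K T r w} := fun w _ =>
    measurableSet_lt measurable_const (measurable_from_nat.comp (hP.measurable_boxCard K T w))
  set E : Set ℝ := {r | r ∈ Set.Icc (0 : ℝ) 1 ∧
    (F.card : ℝ) / Q < (F.filter fun w => θ < boxCard P Q F K T r w).card} with hE
  have hEm : MeasurableSet E := measurableSet_Icc.inter
    (measurableSet_lt measurable_const ((measurable_from_nat (f := Nat.cast (R := ℝ))).comp
      (measurable_card_filter hS)))
  have hEsub : E ⊆ Set.Icc 0 1 := fun r hr => hr.1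
  have hEtop : volume E ≠ ⊤ := measure_ne_top_of_subset hEsub volume_Icc_zero_one_ne_top
  refine ⟨E, hEsub, ?_, fun r hr => ?_⟩
  · rw [← ENNReal.toReal_le_toReal hEtop ENNReal.ofReal_ne_top,
      ENNReal.toReal_ofReal (by positivity)]
    have h1 := (le_sliceMeasure hEm hEtop hS fun r hr => hr.2.le).trans
      ((sliceMeasure_le_of_subset F _ hEsub volume_Icc_zero_one_ne_top).trans h)
    have h2 : (F.card : ℝ) / Q ^ 2 = F.card / Q * (1 / Q) := by field_simp
    rw [h2] at h1
    exact le_of_mul_le_mul_left h1 (by positivity)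
  · by_contra! hcon
    exact hr.2 ⟨hr.1, hcon⟩

end Exceptional

section Representation

theorem sum_range_pow_div_factorial_mul {n m i : ℕ} (hm : m ≤ n) (x y : ℝ) :
    (∑ l ∈ Finset.range (n + 1), if i ≤ l ∧ l ≤ m then
      x ^ (m - l) / (m - l).factorial * (y ^ (l - i) / (l - i).factorial) else 0) =
      if i ≤ m then (x + y) ^ (m - i) / (m - i).factorial else 0 := by
  split_ifs with him
  · rw [← Finset.sum_filter]
    have e : (Finset.range (n + 1)).filter (fun l => i ≤ l ∧ l ≤ m) = Finset.Ico i (m + 1) := by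
      ext l
      simp only [Finset.mem_filter, Finset.mem_range, Finset.mem_Ico]
      omega
    rw [e, Finset.sum_Ico_eq_sum_range, add_comm x y, add_pow, Finset.sum_div,
      show m + 1 - i = m - i + 1 by omega]
    refine Finset.sum_congr rfl fun j hj => ?_
    have hj' : j ≤ m - i := Nat.lt_succ_iff.1 (Finset.mem_range.1 hj)
    rw [Nat.add_sub_cancel_left, show m - (i + j) = m - i - j by omega,
      Nat.cast_choose ℝ hj']
    have h1 := Nat.cast_ne_zero (R := ℝ).2 (Nat.factorial_ne_zero (m - i))
    field_simp
  · refine Finset.sum_eq_zero fun l _ => if_neg fun h => him (h.1.trans h.2)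

theorem uAct_apply (n : ℕ) (r : ℝ) (w : EuclideanSpace ℝ (Fin (n + 1))) (i : Fin (n + 1)) :
    uAct n r w i =
      ∑ l, if i ≤ l then w l * (r ^ (l.1 - i.1) / (l.1 - i.1).factorial) else 0 := by
  simp only [uAct, xiD, PiLp.continuousLinearEquiv_symm_apply, Nat.add_le_add_iff_right,
    Nat.add_sub_add_right, mul_ite, mul_zero, Fin.le_def]

theorem uAct_zero_apply (n : ℕ) (w : EuclideanSpace ℝ (Fin (n + 1))) (i : Fin (n + 1)) :
    uAct n 0 w i = w i := by
  rw [uAct_apply, Finset.sum_eq_single i]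
  · simp
  · intro l _ hl
    split_ifs with h
    · rw [zero_pow, zero_div, mul_zero]
      have h1 : i.1 ≤ l.1 := h
      have h2 : l.1 ≠ i.1 := fun h => hl (Fin.ext h)
      omega
    · rfl
  · simp

theorem uAct_apply_eq_sum (n : ℕ) (r s : ℝ) (w : EuclideanSpace ℝ (Fin (n + 1)))
    (i : Fin (n + 1)) :
    uAct n s w i = ∑ l, if i ≤ l then
      uAct n r w l * (s - r) ^ (l.1 - i.1) / (l.1 - i.1).factorial else 0 := by
  have e : ∀ l : Fin (n + 1), (if i ≤ l then
      uAct n r w l * (s - r) ^ (l.1 - i.1) / (l.1 - i.1).factorial else 0) =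
      ∑ m : Fin (n + 1), w m * if i.1 ≤ l.1 ∧ l.1 ≤ m.1 then r ^ (m.1 - l.1) /
        (m.1 - l.1).factorial * ((s - r) ^ (l.1 - i.1) / (l.1 - i.1).factorial) else 0 := by
    intro l
    split_ifs with h
    · rw [uAct_apply, mul_div_assoc, Finset.sum_mul]
      refine Finset.sum_congr rfl fun m _ => ?_
      by_cases hlm : l ≤ m
      · rw [if_pos hlm, if_pos ⟨h, hlm⟩, mul_assoc]
      · rw [if_neg hlm, if_neg fun hh => hlm hh.2, zero_mul, mul_zero]
    · refine (Finset.sum_eq_zero fun m _ => ?_).symm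
      rw [if_neg fun hh => h hh.1, mul_zero]
  rw [Finset.sum_congr rfl fun l _ => e l, Finset.sum_comm, uAct_apply]
  refine Finset.sum_congr rfl fun m _ => ?_
  rw [← Finset.mul_sum, Fin.sum_univ_eq_sum_range (fun l => if i.1 ≤ l ∧ l ≤ m.1 then
    r ^ (m.1 - l) / (m.1 - l).factorial * ((s - r) ^ (l - i.1) / (l - i.1).factorial) else 0),
    sum_range_pow_div_factorial_mul (Nat.lt_succ_iff.1 m.2), add_sub_cancel, mul_ite, mul_zero]
  rfl

theorem isTaylorFamily_uAct (n : ℕ) (R : ℝ) :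
    IsTaylorFamily fun (w : EuclideanSpace ℝ (Fin (n + 1))) i r => uAct n r w i / R := by
  refine ⟨fun w i => ?_, fun w w' i r s => ?_⟩
  · simp only [uAct_apply]
    refine Continuous.div_const (continuous_finsetSum _ fun l _ => ?_) _
    split_ifs <;> fun_prop
  · rw [uAct_apply_eq_sum n r s w', uAct_apply_eq_sum n r s w, ← sub_div, ← Finset.sum_sub_distrib,
      Finset.sum_div]
    refine Finset.sum_congr rfl fun l _ => ?_
    split_ifs <;> ring

theorem norm_sub_le_of_abs_uAct_sub_le {n : ℕ} {r η : ℝ} (hr : r ∈ Set.Icc (0 : ℝ) 1)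
    {w w' : EuclideanSpace ℝ (Fin (n + 1))} (h : ∀ i, |uAct n r w' i - uAct n r w i| ≤ η) :
    ‖w' - w‖ ≤ (n + 1) ^ 2 * η := by
  have hη : 0 ≤ η := (abs_nonneg _).trans (h 0)
  have h1 : ∀ i, |w' i - w i| ≤ (n + 1) * η := by
    intro i
    rw [← uAct_zero_apply n w', ← uAct_zero_apply n w, uAct_apply_eq_sum n r 0 w',
      uAct_apply_eq_sum n r 0 w, ← Finset.sum_sub_distrib]
    refine (Finset.abs_sum_le_sum_abs _ _).trans ?_
    refine (Finset.sum_le_card_nsmul _ _ η fun l _ => ?_).trans ?_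
    · split_ifs
      · rw [← sub_div, ← sub_mul, abs_div, abs_mul, abs_pow, zero_sub, abs_neg, Nat.abs_cast,
          abs_of_nonneg hr.1]
        refine (div_le_self (mul_nonneg (abs_nonneg _) (pow_nonneg hr.1 _)) ?_).trans
          ((mul_le_of_le_one_right (abs_nonneg _) (pow_le_one₀ hr.1 hr.2)).trans (h l))
        exact_mod_cast Nat.one_le_iff_ne_zero.2 (Nat.factorial_ne_zero _)
      · simpa using hη
    · simp
  calc ‖w' - w‖ ≤ ∑ i, |w' i - w i| := by
        rw [EuclideanSpace.norm_eq]
        refine Real.sqrt_le_iff.2 ⟨Finset.sum_nonneg fun i _ => abs_nonneg _, ?_⟩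
        simpa using Finset.sum_sq_le_sq_sum_of_nonneg (s := Finset.univ)
          (f := fun i => |w' i - w i|) fun i _ => abs_nonneg _
    _ ≤ Finset.card (Finset.univ : Finset (Fin (n + 1))) • ((n + 1) * η) :=
        Finset.sum_le_card_nsmul _ _ _ fun i _ => h1 i
    _ = _ := by
        rw [Finset.card_univ, Fintype.card_fin, nsmul_eq_mul]
        push_cast
        ring

end Representation

section Final

theorem mass_le_div {V : Type*} {F G : Finset V} {A : Set V} (h : A ∩ F ⊆ G) :
    mass F A ≤ G.card / F.card := by
  unfold mass
  gcongr
  rw [← Nat.card_eq_finsetCard]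
  exact Nat.card_mono G.finite_toSet h

theorem boxCard_uAct_le {n : ℕ} {α C δ₀ R : ℝ} {F : Finset (EuclideanSpace ℝ (Fin (n + 1)))}
    (hα : 0 < α) (hαn : α < n + 1) (hC : 1 ≤ C) (hF : F.Nonempty)
    (hmass : ∀ (x : EuclideanSpace ℝ (Fin (n + 1))) (δ : ℝ), δ ∈ Set.Icc δ₀ 1 →
      mass F (closedBall x δ) ≤ C * δ ^ α)
    (hR : 0 < R) {Q s : ℕ} (hQ : (n + 1) ^ 2 ≤ Q) (hs : δ₀ ≤ R * ((Q : ℝ) ^ s)⁻¹) {r : ℝ}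
    (hr : r ∈ Set.Icc (0 : ℝ) 1) (w : EuclideanSpace ℝ (Fin (n + 1))) :
    (boxCard (fun (w : EuclideanSpace ℝ (Fin (n + 1))) i r => uAct n r w i / R) Q F 1
      (fun _ => s) r w : ℝ) ≤
      F.card * C * R ^ α * (Q : ℝ) ^ (n + 1) * (Q : ℝ) ^ (-(α * s)) := by
  have hQ' : ((n : ℝ) + 1) ^ 2 ≤ Q := by exact_mod_cast hQ
  have hQ0 : (0 : ℝ) < Q := lt_of_lt_of_le (by positivity) hQ'
  have hFc : (0 : ℝ) < F.card := by exact_mod_cast hF.card_pos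
  set x : ℝ := R * ((Q : ℝ) ^ s)⁻¹ with hx
  have hx0 : 0 < x := by positivity
  have hrad : x ≤ (n + 1) ^ 2 * x := by
    refine le_mul_of_one_le_left hx0.le (one_le_pow₀ ?_)
    linarith [(Nat.cast_nonneg n : (0 : ℝ) ≤ n)]
  have hxα : C * ((n + 1) ^ 2 * x) ^ α ≤
      C * R ^ α * (Q : ℝ) ^ (n + 1) * (Q : ℝ) ^ (-(α * s)) := by
    rw [Real.mul_rpow (by positivity) hx0.le, hx, Real.mul_rpow hR.le (by positivity),
      Real.inv_rpow (by positivity), ← Real.rpow_natCast (Q : ℝ) s, ← Real.rpow_mul hQ0.le,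
      ← Real.rpow_neg hQ0.le, mul_comm (s : ℝ)]
    have h1 : (((n : ℝ) + 1) ^ 2) ^ α ≤ (Q : ℝ) ^ (n + 1) := by
      refine (Real.rpow_le_rpow_of_exponent_le (one_le_pow₀ ?_) hαn.le).trans ?_
      · linarith [(Nat.cast_nonneg n : (0 : ℝ) ≤ n)]
      · rw [← Nat.cast_add_one, Real.rpow_natCast]
        push_cast
        gcongr
    calc C * ((((n : ℝ) + 1) ^ 2) ^ α * (R ^ α * (Q : ℝ) ^ (-(α * s)))) ≤
        C * ((Q : ℝ) ^ (n + 1) * (R ^ α * (Q : ℝ) ^ (-(α * s)))) := by gcongr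
      _ = _ := by ring
  have hcard : (boxCard (fun (w : EuclideanSpace ℝ (Fin (n + 1))) i r => uAct n r w i / R) Q F 1
      (fun _ => s) r w : ℝ) ≤ F.card * (C * ((n + 1) ^ 2 * x) ^ α) := by
    rcases le_total ((n + 1) ^ 2 * x) 1 with h1 | h1
    · have h2 := hmass w _ ⟨hs.trans hrad, h1⟩
      refine le_trans ?_ (mul_le_mul_of_nonneg_left h2 hFc.le)
      unfold mass boxCard
      rw [mul_div_cancel₀ _ hFc.ne', ← Nat.card_eq_finsetCard, Nat.cast_le]
      refine Nat.card_mono (F.finite_toSet.subset Set.inter_subset_right) fun w' hw' => ?_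
      obtain ⟨hw'F, hw'⟩ := Finset.mem_filter.1 hw'
      refine ⟨?_, hw'F⟩
      rw [mem_closedBall, dist_eq_norm]
      refine norm_sub_le_of_abs_uAct_sub_le hr fun i => ?_
      have := hw' i
      rw [← sub_div, abs_div, abs_of_pos hR, Nat.cast_one, ← le_div_iff₀ (by positivity),
        div_le_iff₀ hR] at this
      rw [hx, ← div_eq_mul_inv, ← one_div_mul_eq_div]
      exact this
    · refine (Nat.cast_le.2 (Finset.card_filter_le _ _)).trans (le_mul_of_one_le_right hFc.le ?_)
      exact one_le_mul_of_one_le_of_one_le hC (Real.one_le_rpow h1 hα.le)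
  refine hcard.trans ((mul_le_mul_of_nonneg_left hxα hFc.le).trans_eq ?_)
  ring

theorem abs_sub_mul_pow_le_of_norm_aAct_sub_le {n : ℕ} {t δ : ℝ} {Q q : ℕ} (hδ : 0 < δ)
    (hQ : (Q : ℝ) ^ q ≤ Real.exp t) {v v' x : EuclideanSpace ℝ (Fin (n + 1))}
    (hv : ‖aAct n t v - x‖ ≤ δ) (hv' : ‖aAct n t v' - x‖ ≤ δ) (i : Fin (n + 1)) :
    |v' i / (δ * Real.exp (n * t / 2)) - v i / (δ * Real.exp (n * t / 2))| *
      (Q : ℝ) ^ ((n - i.1) * q) ≤ 2 := by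
  have h1 : |aAct n t v' i - aAct n t v i| ≤ 2 * δ := by
    have e1 := (PiLp.norm_apply_le (aAct n t v' - x) i).trans hv'
    have e2 := (PiLp.norm_apply_le (aAct n t v - x) i).trans hv
    rw [PiLp.sub_apply, Real.norm_eq_abs, abs_le] at e1 e2
    rw [abs_le]
    constructor <;> linarith
  have h2 : ∀ v : EuclideanSpace ℝ (Fin (n + 1)), aAct n t v i =
      Real.exp (((n : ℝ) - 2 * (i.1 : ℝ)) * t / 2) * v i := fun v => rfl
  rw [h2, h2, ← mul_sub, abs_mul, abs_of_pos (Real.exp_pos _)] at h1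
  have h3 : (Q : ℝ) ^ ((n - i.1) * q) ≤ Real.exp ((n - i.1) * t) := by
    rw [mul_comm, pow_mul]
    refine (pow_le_pow_left₀ (by positivity) hQ _).trans_eq ?_
    rw [← Real.exp_nat_mul, Nat.cast_sub (Nat.lt_succ_iff.1 i.2)]
  have h4 : Real.exp ((n - i.1) * t) =
      Real.exp (((n : ℝ) - 2 * (i.1 : ℝ)) * t / 2) * Real.exp (n * t / 2) := by
    rw [← Real.exp_add]
    congr 1
    ring
  have hR : 0 < δ * Real.exp (n * t / 2) := by positivity
  rw [← sub_div, abs_div, abs_of_pos hR, div_mul_eq_mul_div, div_le_iff₀ hR]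
  calc |v' i - v i| * (Q : ℝ) ^ ((n - i.1) * q) ≤ |v' i - v i| * Real.exp ((n - i.1) * t) := by
        gcongr
    _ = Real.exp (((n : ℝ) - 2 * (i.1 : ℝ)) * t / 2) * |v' i - v i| * Real.exp (n * t / 2) := by
        rw [h4]; ring
    _ ≤ 2 * δ * Real.exp (n * t / 2) := by gcongr
    _ = _ := by ring

theorem div_le_rpow_of_exp_le {n q Q k : ℕ} {α δ ε t C D N : ℝ} (hn : 1 ≤ n) (hε : 0 < ε)
    (hα : α < n + 1) (hδ : 0 < δ) (hq : 0 < q) (hC : 0 < C) (hD : 1 ≤ D) (hN : 0 < N)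
    (hQ : Real.exp (4 * (n + 1) / ε) ≤ Q) (hQt : Real.exp (t / q) ≤ 2 * Q)
    (hQt' : (Q : ℝ) ≤ Real.exp (t / q)) (hδt : δ ≤ Real.exp (-(n * t) / 2)) :
    N * C * (δ * Real.exp (n * t / 2)) ^ α /
        (N * (D * C * Real.exp (-(t * (n * α - k * (k + 1))) / 2) * δ ^ (α - ε))) ≤
      (Q : ℝ) ^ (q * (n * α - k * (k + 1) / 2 - n * ε / 4)) := by
  have hn' : (1 : ℝ) ≤ n := by exact_mod_cast hn
  have hq' : (0 : ℝ) < q := by exact_mod_cast hq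
  have hQ0 : (0 : ℝ) < Q := (Real.exp_pos _).trans_le hQ
  have hD0 : 0 < D := by linarith
  have hδε : δ ^ ε ≤ Real.exp (-(n * t) / 2 * ε) := by
    rw [Real.exp_mul]
    exact Real.rpow_le_rpow hδ.le hδt hε.le
  have h1 : N * C * (δ * Real.exp (n * t / 2)) ^ α /
      (N * (D * C * Real.exp (-(t * (n * α - k * (k + 1))) / 2) * δ ^ (α - ε))) =
      δ ^ ε * Real.exp (t * (n * α - k * (k + 1) / 2)) / D := by
    have e1 : Real.exp (t * (n * α - k * (k + 1) / 2)) *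
        Real.exp (-(t * (n * α - k * (k + 1))) / 2) = Real.exp (n * t / 2 * α) := by
      rw [← Real.exp_add]
      congr 1
      ring
    have e2 : δ ^ α = δ ^ ε * δ ^ (α - ε) := by
      rw [← Real.rpow_add hδ]
      congr 1
      ring
    rw [Real.mul_rpow hδ.le (Real.exp_pos _).le, ← Real.exp_mul, ← e1, e2]
    have e3 := Real.rpow_pos_of_pos hδ (α - ε)
    field_simp
  rw [h1, Real.rpow_def_of_pos hQ0]
  refine (div_le_self (by positivity) hD).trans ((mul_le_mul_of_nonneg_right hδε
    (Real.exp_pos _).le).trans ?_)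
  rw [← Real.exp_add, Real.exp_le_exp]
  have l1 : 4 * (n + 1) / ε ≤ Real.log Q := by rwa [Real.le_log_iff_exp_le hQ0]
  have l2 : t / q ≤ Real.log Q + 1 := by
    rw [← Real.exp_le_exp, Real.exp_add, Real.exp_log hQ0]
    have : (2 : ℝ) ≤ Real.exp 1 := by linarith [Real.add_one_le_exp (1 : ℝ)]
    nlinarith
  have l3 : Real.log Q ≤ t / q := by rwa [Real.log_le_iff_le_exp hQ0]
  rw [div_le_iff₀ hε] at l1
  set X : ℝ := n * α - k * (k + 1) / 2 - n * ε / 2 with hX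
  have hXle : X ≤ n * (n + 1) := by
    have e1 : (n : ℝ) * α ≤ n * (n + 1) := by gcongr
    have e2 : (0 : ℝ) ≤ k * (k + 1) / 2 := by positivity
    have e3 : (0 : ℝ) ≤ n * ε / 2 := by positivity
    linarith
  have e : -(n * t) / 2 * ε + t * (n * α - k * (k + 1) / 2) = q * (t / q * X) := by
    rw [hX]
    field_simp
    ring
  rw [e, mul_left_comm (Real.log Q)]
  refine mul_le_mul_of_nonneg_left ?_ hq'.le
  have h2 : (t / q - Real.log Q) * X ≤ n * (n + 1) := by
    calc (t / q - Real.log Q) * X ≤ (t / q - Real.log Q) * (n * (n + 1)) :=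
          mul_le_mul_of_nonneg_left hXle (by linarith)
      _ ≤ 1 * (n * (n + 1)) := mul_le_mul_of_nonneg_right (by linarith) (by positivity)
      _ = _ := one_mul _
  have h3 : n * (4 * (n + 1)) ≤ n * (Real.log Q * ε) := by gcongr
  have h4 : Real.log Q * (n * α - k * (k + 1) / 2 - n * ε / 4) =
      Real.log Q * X + n * (Real.log Q * ε) / 4 := by
    rw [hX]; ring
  linarith

end Final

end

theorem stmt12 :
    ∀ n : ℕ, 1 ≤ n →
    ∀ ε : ℝ, 0 < ε →
    ∃ D c : ℝ, 1 ≤ D ∧ 0 < c ∧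
      ∀ (α C δ₀ : ℝ) (F : Finset (EuclideanSpace ℝ (Fin (n + 1)))),
        0 < α → α < (n : ℝ) + 1 → 1 ≤ C → 0 < δ₀ → δ₀ ≤ 1 → F.Nonempty →
        (F : Set (EuclideanSpace ℝ (Fin (n + 1)))) ⊆ closedBall 0 1 →
        (∀ (x : EuclideanSpace ℝ (Fin (n + 1))) (δ : ℝ), δ ∈ Set.Icc δ₀ 1 →
          mass F (closedBall x δ) ≤ C * δ ^ α) →
        ε < min α ((n : ℝ) + 1 - α) / (10 ^ 4 * (n : ℝ)) →
        ∀ δ t : ℝ, δ₀ ≤ δ → δ ≤ 1 / 100 → D ≤ t →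
          Real.exp ((n : ℝ) * t / 2) * δ₀ ≤ δ → δ ≤ Real.exp (-((n : ℝ) * t) / 2) →
          ∃ 𝓔 : Set ℝ, 𝓔 ⊆ Set.Icc 0 1 ∧
            volume 𝓔 ≤ ENNReal.ofReal (D * Real.exp (-(c * ε ^ 2 * t))) ∧
            ∀ r ∈ Set.Icc (0 : ℝ) 1 \ 𝓔,
              ∃ F' : Finset (EuclideanSpace ℝ (Fin (n + 1))), F' ⊆ F ∧
                mass F ((F : Set (EuclideanSpace ℝ (Fin (n + 1)))) \ (F' : Set _)) ≤
                  D * Real.exp (-(c * ε ^ 2 * t)) ∧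
                ∀ x : EuclideanSpace ℝ (Fin (n + 1)),
                  mass F {w' | w' ∈ F' ∧ ‖aAct n t (uAct n r w') - x‖ ≤ δ} ≤
                    D * C *
                      Real.exp (-(t * ((n : ℝ) * α - (⌊α⌋ : ℝ) * ((⌊α⌋ : ℝ) + 1))) / 2) *
                        δ ^ (α - ε) := by
  intro n hn ε hε
  have hn' : (0 : ℝ) < n := by exact_mod_cast hn
  obtain ⟨q, Q₀, hq, hQ₀, key⟩ :=
    exists_sliceMeasure_boxCard_le n hn (ε := n * ε / 4) (by positivity)
  have hq' : (0 : ℝ) < q := by exact_mod_cast hq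
  set Q₁ := Q₀ + (n + 1) ^ 2 + ⌈Real.exp (4 * (n + 1) / ε)⌉₊ with hQ₁
  set D : ℝ := q * Q₁ + 2 with hDdef
  have hD : 2 ≤ D := le_add_of_nonneg_left (by positivity)
  refine ⟨D, 1 / (q * ε ^ 2), by linarith, by positivity, ?_⟩
  intro α C δ₀ F hα hαn hC hδ₀ _ hF _ hmass _ δ t hδ _ ht hδ₀t hδt
  rw [← natCast_floor_eq_intCast_floor hα.le]
  have hδ0 : 0 < δ := hδ₀.trans_le hδ
  have hFc : (0 : ℝ) < F.card := by exact_mod_cast hF.card_pos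
  set Q := ⌊Real.exp (t / q)⌋₊ with hQdef
  have hQ₁Q : Q₁ ≤ Q := by
    refine Nat.le_floor ?_
    have h1 : (Q₁ : ℝ) ≤ t / q := by
      rw [le_div_iff₀ hq']
      linarith
    linarith [Real.add_one_le_exp (t / q)]
  have hQ0 : 0 < Q := by omega
  have hQ0' : (1 : ℝ) ≤ Q := by exact_mod_cast hQ0
  have hQexp : Real.exp (4 * (n + 1) / ε) ≤ Q :=
    (Nat.le_ceil _).trans (Nat.cast_le.2 (by omega))
  have hQt' : (Q : ℝ) ≤ Real.exp (t / q) := Nat.floor_le (Real.exp_pos _).le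
  have hQt : Real.exp (t / q) ≤ 2 * Q := by
    linarith [Nat.lt_floor_add_one (Real.exp (t / q))]
  have hQq : (Q : ℝ) ^ q ≤ Real.exp t := by
    refine (pow_le_pow_left₀ (by positivity) hQt' q).trans_eq ?_
    rw [← Real.exp_nat_mul, mul_div_cancel₀ _ hq'.ne']
  have hQinv : 1 / (Q : ℝ) ≤ D * Real.exp (-(1 / (q * ε ^ 2) * ε ^ 2 * t)) := by
    have h1 : -(1 / (q * ε ^ 2) * ε ^ 2 * t) = -(t / q) := by field_simp
    rw [h1, Real.exp_neg, ← div_eq_mul_inv, div_le_div_iff₀ (by positivity) (Real.exp_pos _)]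
    nlinarith
  set R : ℝ := δ * Real.exp (n * t / 2) with hR
  have hR0 : 0 < R := by positivity
  set P : EuclideanSpace ℝ (Fin (n + 1)) → Fin (n + 1) → ℝ → ℝ :=
    fun w i r => uAct n r w i / R with hPdef
  have hP : IsTaylorFamily P := isTaylorFamily_uAct n R
  set η : ℝ := D * C * Real.exp (-(t * ((n : ℝ) * α - (⌊α⌋₊ : ℝ) * ((⌊α⌋₊ : ℝ) + 1))) / 2) *
    δ ^ (α - ε) with hη
  have hη0 : 0 < η := by positivity
  have hs : ∀ s : ℕ, s ≤ n * q → δ₀ ≤ R * ((Q : ℝ) ^ s)⁻¹ := by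
    intro s hs
    rw [← div_eq_mul_inv, le_div_iff₀ (by positivity)]
    have h1 : (Q : ℝ) ^ s ≤ Real.exp (n * t) := by
      refine (pow_le_pow_right₀ hQ0' hs).trans ?_
      rw [mul_comm, pow_mul, Real.exp_nat_mul]
      exact pow_le_pow_left₀ (by positivity) hQq n
    calc δ₀ * (Q : ℝ) ^ s ≤ δ₀ * Real.exp (n * t) := by gcongr
      _ = Real.exp (n * t / 2) * δ₀ * Real.exp (n * t / 2) := by
        rw [mul_right_comm, ← Real.exp_add, add_halves, mul_comm]
      _ ≤ R := by rw [hR]; gcongr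
  obtain ⟨E, hE, hEvol, hEcard⟩ := hP.exists_exceptional hQ0 hF
    (key (N₀ := F.card * C * R ^ α) (θ := F.card * η) (by omega) hP hF (by positivity)
      (by positivity) hα.le hαn
      (fun s hsn r hr w _ => boxCard_uAct_le hα hαn hC hF hmass hR0 (by omega) (hs s hsn) hr w)
      (div_le_rpow_of_exp_le hn hε hαn hδ0 hq (by positivity) (by linarith) hFc hQexp hQt hQt' hδt))
  refine ⟨E, hE, hEvol.trans (ENNReal.ofReal_le_ofReal hQinv), fun r hr => ?_⟩
  classical
  refine ⟨F.filter fun w => ¬ F.card * η < boxCard P Q F 2 (fun i => (n - i) * q) r w,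
    Finset.filter_subset _ _, ?_, fun x => ?_⟩
  · refine le_trans (mass_le_div (G := F.filter fun w =>
      F.card * η < boxCard P Q F 2 (fun i => (n - i) * q) r w) ?_) (le_trans ?_ hQinv)
    · rintro w ⟨⟨hw, hw'⟩, -⟩
      simp only [Finset.coe_filter, Set.mem_ofPred_eq] at hw' ⊢
      exact ⟨hw, by_contra fun h => hw' ⟨hw, h⟩⟩
    · rw [div_le_div_iff₀ hFc (by positivity)]
      have := hEcard r hr
      rw [le_div_iff₀ (by positivity)] at this
      linarith
  · by_cases hex : ∃ w₀ ∈ F, ¬ F.card * η < boxCard P Q F 2 (fun i => (n - i) * q) r w₀ ∧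
      ‖aAct n t (uAct n r w₀) - x‖ ≤ δ
    · obtain ⟨w₀, -, hw₀, hw₀x⟩ := hex
      refine (mass_le_div (G := F.filter fun w' => ∀ i : Fin (n + 1),
        |P w' i r - P w₀ i r| * (Q : ℝ) ^ ((n - i.1) * q) ≤ (2 : ℕ)) ?_).trans ?_
      · rintro w' ⟨⟨-, hw'⟩, hw'F⟩
        refine Finset.mem_filter.2 ⟨hw'F, fun i => ?_⟩
        exact_mod_cast abs_sub_mul_pow_le_of_norm_aAct_sub_le hδ0 hQq hw₀x hw' i
      · rw [div_le_iff₀ hFc, mul_comm η]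
        exact not_lt.1 hw₀
    · refine (mass_le_div (G := ∅) ?_).trans (by simpa using hη0.le)
      rintro w' ⟨⟨hw', hw'x⟩, hw'F⟩
      exact (hex ⟨w', hw'F, (Finset.mem_filter.1 hw').2, hw'x⟩).elim
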